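/- arXiv:1606.08240 — 2 statements merged into one kernel-verified Lean document; each statement's English description precedes it below -/
import Mathlib

section
/- Let μ be a finite Borel measure on S^{n-1} with μ(S^{n-1}) > 0. Then μ is the surface area measure of a convex body with nonempty interior if and only if the first order moments of μ vanish (∫ u μ(du) = 0) and the matrix M(μ) of second order moments of μ is positive definite. -/
open MeasureTheory Metric Real Filter
open scoped InnerProductSpace ENNReal NNReal Topology

noncomputable section

abbrev En (n : ℕ) := EuclideanSpace ℝ (Fin n)

abbrev Sph (n : ℕ) : Set (En n) := Metric.sphere 0 1

/-- `μ` is the surface area measure `S_{n-1}(K, ·)` of the convex body `K`. -/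
def IsSurfaceAreaMeasure {n : ℕ} (K : Set (En n)) (μ : Measure (Sph n)) : Prop :=
  ((interior K).Nonempty ∧ ∀ ω : Set (Sph n), MeasurableSet ω →
      μ ω = μH[((n : ℝ) - 1)]
        {x ∈ frontier K | ∃ u ∈ ω, ∀ y ∈ K, ⟪y - x, (u : En n)⟫_ℝ ≤ 0})
  ∨ (interior K = ∅ ∧ ∃ u u' : Sph n, (u' : En n) = -(u : En n) ∧
      (∃ c : ℝ, ∀ x ∈ K, ⟪x, (u : En n)⟫_ℝ = c) ∧
      μ = (μH[((n : ℝ) - 1)] K) • (Measure.dirac u + Measure.dirac u'))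

/-- The matrix of second order moments of a measure on the sphere. -/
def secondMomentMatrix {n : ℕ} (μ : Measure (Sph n)) : Matrix (Fin n) (Fin n) ℝ :=
  Matrix.of fun i j => ∫ u, (u : En n) i * (u : En n) j ∂μ

section

open scoped Pointwise

theorem hausdorffMeasure_le_of_dist_le {X Y : Type*} [MetricSpace X] [MetricSpace Y]
    [MeasurableSpace X] [BorelSpace X] [MeasurableSpace Y] [BorelSpace Y]
    {f : X → Y} {s : Set X} {L : ℝ≥0} (h : ∀ x ∈ s, ∀ y ∈ s, dist x y ≤ L * dist (f x) (f y))
    {d : ℝ} (hd : 0 ≤ d) : μH[d] s ≤ (L : ℝ≥0∞) ^ d * μH[d] (f '' s) := by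
  rcases s.eq_empty_or_nonempty with rfl | ⟨x₀, hx₀⟩
  · simp
  have : Nonempty X := ⟨x₀⟩
  have hinj : Set.InjOn f s := fun x hx y hy hxy ↦ by
    have := h x hx y hy
    rw [hxy, dist_self, mul_zero] at this
    exact dist_le_zero.1 this
  have hinv : ∀ x ∈ s, Function.invFunOn f s (f x) = x := fun x hx ↦
    hinj.leftInvOn_invFunOn hx
  have hlip : LipschitzOnWith L (Function.invFunOn f s) (f '' s) := by
    refine LipschitzOnWith.of_dist_le_mul ?_
    rintro _ ⟨x, hx, rfl⟩ _ ⟨y, hy, rfl⟩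
    rw [hinv x hx, hinv y hy]
    exact h x hx y hy
  have hs : Function.invFunOn f s '' (f '' s) = s := by
    rw [Set.image_image]
    exact (Set.image_congr hinv).trans (Set.image_id' s)
  calc μH[d] s = μH[d] (Function.invFunOn f s '' (f '' s)) := by rw [hs]
    _ ≤ _ := hlip.hausdorffMeasure_image_le hd

theorem exists_volume_eq_smul_hausdorffMeasure (n : ℕ) :
    ∃ c : ℝ≥0, c ≠ 0 ∧ (volume : Measure (En n)) = c • μH[(n : ℝ)] := by
  have hH : (μH[(n : ℝ)] : Measure (En n)).IsAddHaarMeasure := by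
    have := isAddHaarMeasure_hausdorffMeasure (E := En n)
    rwa [finrank_euclideanSpace_fin] at this
  refine ⟨Measure.addHaarScalarFactor (volume : Measure (En n)) μH[(n : ℝ)],
    (Measure.addHaarScalarFactor_pos_of_isAddHaarMeasure _ _).ne', ?_⟩
  exact Measure.isAddLeftInvariant_eq_smul (volume : Measure (En n)) μH[(n : ℝ)]

/-- The ratio between Lebesgue measure and the `n`-dimensional Hausdorff measure on `ℝⁿ`. -/
def hausdorffConst (n : ℕ) : ℝ≥0 := (exists_volume_eq_smul_hausdorffMeasure n).choose

theorem hausdorffConst_ne_zero (n : ℕ) : hausdorffConst n ≠ 0 :=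
  (exists_volume_eq_smul_hausdorffMeasure n).choose_spec.1

theorem volume_eq_hausdorffConst_mul {n : ℕ} (s : Set (En n)) :
    volume s = hausdorffConst n * μH[(n : ℝ)] s := by
  conv_lhs => rw [(exists_volume_eq_smul_hausdorffMeasure n).choose_spec.2]
  rfl

theorem volume_image_le_of_lipschitzOnWith {n : ℕ} {f : En n → En n} {s : Set (En n)} {L : ℝ≥0}
    (h : LipschitzOnWith L f s) : volume (f '' s) ≤ (L : ℝ≥0∞) ^ n * volume s := by
  rw [volume_eq_hausdorffConst_mul, volume_eq_hausdorffConst_mul, mul_left_comm]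
  have := h.hausdorffMeasure_image_le (d := n) (by positivity)
  rw [ENNReal.rpow_natCast] at this
  gcongr

theorem volume_le_of_dist_le {n : ℕ} {f : En n → En n} {s : Set (En n)} {L : ℝ≥0}
    (h : ∀ x ∈ s, ∀ y ∈ s, dist x y ≤ L * dist (f x) (f y)) :
    volume s ≤ (L : ℝ≥0∞) ^ n * volume (f '' s) := by
  rw [volume_eq_hausdorffConst_mul, volume_eq_hausdorffConst_mul, mul_left_comm]
  have := hausdorffMeasure_le_of_dist_le h (d := n) (by positivity)
  rw [ENNReal.rpow_natCast] at this
  gcongr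

theorem exists_isometry_hyperplane {m : ℕ} {u : En (m + 1)} (hu : ‖u‖ = 1) :
    ∃ J : En m →ₗᵢ[ℝ] En (m + 1), (∀ y, ⟪J y, u⟫_ℝ = 0) ∧
      Function.Bijective (fun p : En m × ℝ ↦ J p.1 + p.2 • u) ∧
      MeasurePreserving (fun p : En m × ℝ ↦ J p.1 + p.2 • u) volume volume := by
  have hu0 : u ≠ 0 := by
    rintro rfl
    simp at hu
  have : Fact (Module.finrank ℝ (En (m + 1)) = m + 1) := ⟨by simp⟩
  have hfr : Module.finrank ℝ (ℝ ∙ u)ᗮ = m := Submodule.finrank_orthogonal_span_singleton hu0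
  let e : (ℝ ∙ u)ᗮ ≃ₗᵢ[ℝ] En m := ((stdOrthonormalBasis ℝ (ℝ ∙ u)ᗮ).reindex (finCongr hfr)).repr
  let J : En m →ₗᵢ[ℝ] En (m + 1) :=
    (ℝ ∙ u)ᗮ.subtypeₗᵢ.comp e.symm.toLinearIsometry
  have hJ : ∀ y, ⟪J y, u⟫_ℝ = 0 := fun y ↦ by
    have := (e.symm y).2
    rw [Submodule.mem_orthogonal_singleton_iff_inner_left] at this
    exact this
  let Ψ₀ : WithLp 2 (En m × ℝ) →ₗ[ℝ] En (m + 1) :=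
    { toFun := fun p ↦ J p.fst + p.snd • u
      map_add' := fun p q ↦ by
        simp only [WithLp.add_fst, WithLp.add_snd, map_add, add_smul]
        abel
      map_smul' := fun c p ↦ by
        simp only [WithLp.smul_fst, WithLp.smul_snd, map_smul, smul_add, smul_smul, smul_eq_mul,
          RingHom.id_apply] }
  let Ψ₁ : WithLp 2 (En m × ℝ) →ₗᵢ[ℝ] En (m + 1) :=
    { Ψ₀ with
      norm_map' := fun p ↦ by
        have h1 : ‖J p.fst + p.snd • u‖ ^ 2 = ‖p‖ ^ 2 := by
          rw [WithLp.prod_norm_sq_eq_of_L2, norm_add_sq_real, inner_smul_right, hJ, J.norm_map,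
            norm_smul, hu]
          simp
        exact (pow_left_inj₀ (norm_nonneg _) (norm_nonneg _) two_ne_zero).1 h1 }
  let Ψ : WithLp 2 (En m × ℝ) ≃ₗᵢ[ℝ] En (m + 1) := Ψ₁.toLinearIsometryEquiv (by
    rw [LinearEquiv.finrank_eq (WithLp.linearEquiv 2 ℝ (En m × ℝ))]
    simp)
  have hcomp : (fun p : En m × ℝ ↦ J p.1 + p.2 • u) = Ψ ∘ WithLp.toLp 2 := by
    funext p
    rfl
  refine ⟨J, hJ, ?_, ?_⟩
  · rw [hcomp]
    exact Ψ.bijective.comp (WithLp.toLp_bijective 2)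
  · rw [hcomp]
    exact Ψ.measurePreserving.comp (WithLp.volume_preserving_toLp (En m) ℝ)

theorem lintegral_ofReal_div_pow {a : ℝ} (ha : 0 < a) (m : ℕ) :
    ∫⁻ s in Set.Ioc 0 a, ENNReal.ofReal ((s / a) ^ m) = ENNReal.ofReal (a / (m + 1)) := by
  rw [← ofReal_integral_eq_lintegral_ofReal]
  · congr 1
    rw [← intervalIntegral.integral_of_le ha.le]
    simp only [div_pow, intervalIntegral.integral_div, integral_pow]
    field_simp
    simp [pow_succ]
  · exact (Continuous.integrableOn_Icc (by fun_prop)).mono_set Set.Ioc_subset_Icc_self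
  · filter_upwards [ae_restrict_mem measurableSet_Ioc] with s hs
    have := hs.1
    positivity

/-- The volume of a cone over a flat base. -/
theorem volume_cone {m : ℕ} {u : En (m + 1)} (hu : ‖u‖ = 1) {Z : Set (En (m + 1))}
    (hZ : MeasurableSet Z) (hpos : ∀ z ∈ Z, 0 < ⟪z, u⟫_ℝ)
    (hsmul : ∀ z ∈ Z, ∀ s : ℝ, 0 < s → s • z ∈ Z) {a : ℝ} (ha : 0 < a) :
    volume (Z ∩ {z | ⟪z, u⟫_ℝ ≤ a}) =
      ENNReal.ofReal (a / (m + 1)) * (hausdorffConst m * μH[(m : ℝ)] (Z ∩ {z | ⟪z, u⟫_ℝ = a})) := by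
  obtain ⟨J, hJ, hbij, hmp⟩ := exists_isometry_hyperplane hu
  set F : En m × ℝ → En (m + 1) := fun p ↦ J p.1 + p.2 • u with hF
  have hFu : ∀ p, ⟪F p, u⟫_ℝ = p.2 := fun p ↦ by
    simp [hF, inner_add_left, inner_smul_left, hJ, hu]
  have hle : MeasurableSet {z : En (m + 1) | ⟪z, u⟫_ℝ ≤ a} :=
    (isClosed_le (by fun_prop) continuous_const).measurableSet
  set slice : Set (En m) := {y | F (y, a) ∈ Z} with hslice
  have hFsmul : ∀ (t : ℝ) y s, t • F (y, s) = F (t • y, t * s) := fun t y s ↦ by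
    simp [hF, smul_add, smul_smul]
  have hslices : ∀ s : ℝ, 0 < s → {y | F (y, s) ∈ Z} = (s / a) • slice := fun s hs ↦ by
    have hsa : 0 < s / a := by positivity
    ext y
    rw [Set.mem_smul_set_iff_inv_smul_mem₀ hsa.ne']
    have h1 : F ((s / a)⁻¹ • y, a) = (s / a)⁻¹ • F (y, s) := by
      rw [hFsmul]
      congr 2
      field_simp
    simp only [hslice, Set.mem_ofPred_eq, h1]
    refine ⟨fun h ↦ hsmul _ h _ (by positivity), fun h ↦ ?_⟩
    have := hsmul _ h _ hsa
    rwa [smul_smul, mul_inv_cancel₀ hsa.ne', one_smul] at this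
  have hbase : μH[(m : ℝ)] (Z ∩ {z | ⟪z, u⟫_ℝ = a}) = μH[(m : ℝ)] slice := by
    have hiso : Isometry (fun y ↦ F (y, a)) := by
      refine Isometry.of_dist_eq fun x y ↦ ?_
      simp [hF, J.isometry.dist_eq]
    have him : Z ∩ {z | ⟪z, u⟫_ℝ = a} = (fun y ↦ F (y, a)) '' slice := by
      ext z
      constructor
      · rintro ⟨hz, hza⟩
        obtain ⟨⟨y, s⟩, rfl⟩ := hbij.2 z
        have hsa : s = a := by rw [← hza, hFu (y, s)]
        subst hsa
        exact ⟨y, hz, rfl⟩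
      · rintro ⟨y, hy, rfl⟩
        exact ⟨hy, hFu _⟩
    rw [him, hiso.hausdorffMeasure_image (Or.inl (by positivity))]
  rw [hbase, ← volume_eq_hausdorffConst_mul,
    ← hmp.measure_preimage (hZ.inter hle).nullMeasurableSet,
    Measure.volume_eq_prod, Measure.prod_apply_symm (hmp.measurable (hZ.inter hle))]
  have hint : ∀ s : ℝ, volume ((fun y ↦ (y, s)) ⁻¹' (F ⁻¹' (Z ∩ {z | ⟪z, u⟫_ℝ ≤ a}))) =
      (Set.Ioc 0 a).indicator (fun s ↦ ENNReal.ofReal ((s / a) ^ m) * volume slice) s := fun s ↦ by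
    by_cases hs : s ∈ Set.Ioc 0 a
    · rw [Set.indicator_of_mem hs]
      have : (fun y ↦ (y, s)) ⁻¹' (F ⁻¹' (Z ∩ {z | ⟪z, u⟫_ℝ ≤ a})) = (s / a) • slice := by
        rw [← hslices s hs.1]
        ext y
        simp [hFu, hs.2]
      have hsa : 0 ≤ s / a := div_nonneg hs.1.le ha.le
      rw [this, Measure.addHaar_smul, finrank_euclideanSpace_fin, abs_of_nonneg (by positivity)]
    · rw [Set.indicator_of_notMem hs]
      have : (fun y ↦ (y, s)) ⁻¹' (F ⁻¹' (Z ∩ {z | ⟪z, u⟫_ℝ ≤ a})) = ∅ := by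
        ext y
        simp only [Set.mem_preimage, Set.mem_inter_iff, Set.mem_ofPred_eq, hFu,
          Set.mem_empty_iff_false, iff_false]
        rintro ⟨h1, h2⟩
        have := hpos _ h1
        rw [hFu] at this
        exact hs ⟨this, h2⟩
      rw [this, measure_empty]
  simp_rw [hint]
  rw [lintegral_indicator measurableSet_Ioc, lintegral_mul_const _ (by fun_prop),
    lintegral_ofReal_div_pow ha]

/-- The support function of a set. -/
def supportFn {n : ℕ} (K : Set (En n)) (u : En n) : ℝ := sSup ((fun x ↦ ⟪x, u⟫_ℝ) '' K)

section supportFn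

variable {n : ℕ} {K : Set (En n)} {x u v : En n}

theorem inner_le_supportFn (hK : IsCompact K) (hx : x ∈ K) : ⟪x, u⟫_ℝ ≤ supportFn K u :=
  le_csSup (hK.image (by fun_prop : Continuous fun x : En n ↦ ⟪x, u⟫_ℝ)).bddAbove
    (Set.mem_image_of_mem _ hx)

theorem supportFn_le (hne : K.Nonempty) {c : ℝ} (h : ∀ x ∈ K, ⟪x, u⟫_ℝ ≤ c) :
    supportFn K u ≤ c :=
  csSup_le (hne.image _) (by rintro _ ⟨x, hx, rfl⟩; exact h x hx)

theorem abs_supportFn_sub_le (hK : IsCompact K) (hne : K.Nonempty) {R : ℝ}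
    (hR : K ⊆ closedBall 0 R) (u v : En n) :
    |supportFn K u - supportFn K v| ≤ R * ‖u - v‖ := by
  have key : ∀ u v, supportFn K u ≤ supportFn K v + R * ‖u - v‖ := fun u v ↦ by
    refine supportFn_le hne fun x hx ↦ ?_
    have h1 : ⟪x, u⟫_ℝ = ⟪x, v⟫_ℝ + ⟪x, u - v⟫_ℝ := by rw [inner_sub_right]; ring
    have h2 : ⟪x, u - v⟫_ℝ ≤ ‖x‖ * ‖u - v‖ := real_inner_le_norm _ _
    have h3 : ‖x‖ ≤ R := mem_closedBall_zero_iff.1 (hR hx)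
    have h4 := inner_le_supportFn (u := v) hK hx
    nlinarith [norm_nonneg (u - v)]
  rw [abs_le]
  have h1 := key u v
  have h2 := key v u
  rw [norm_sub_rev] at h2
  constructor <;> linarith

theorem continuous_supportFn (hK : IsCompact K) (hne : K.Nonempty) :
    Continuous (supportFn K) := by
  obtain ⟨R, hR⟩ := hK.isBounded.subset_closedBall 0
  have : LipschitzWith (Real.toNNReal R) (supportFn K) := LipschitzWith.of_dist_le_mul fun u v ↦ by
    rw [Real.dist_eq, dist_eq_norm]
    refine (abs_supportFn_sub_le hK hne hR u v).trans ?_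
    gcongr
    exact Real.le_coe_toNNReal R
  exact this.continuous

end supportFn

/-- A compact convex set containing the origin in its interior. -/
structure IsBody {n : ℕ} (K : Set (En n)) : Prop where
  convex : Convex ℝ K
  isCompact : IsCompact K
  zero_mem : (0 : En n) ∈ interior K

namespace IsBody

variable {n : ℕ} {K : Set (En n)}

theorem mem_nhds (hK : IsBody K) : K ∈ 𝓝 (0 : En n) := mem_interior_iff_mem_nhds.1 hK.zero_mem

theorem nonempty (hK : IsBody K) : K.Nonempty := ⟨0, interior_subset hK.zero_mem⟩

theorem absorbent (hK : IsBody K) : Absorbent ℝ K := absorbent_nhds_zero hK.mem_nhds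

theorem exists_ball_subset (hK : IsBody K) : ∃ r : ℝ≥0, 0 < r ∧ ball (0 : En n) r ⊆ K := by
  obtain ⟨r, hr, h⟩ := Metric.mem_nhds_iff.1 hK.mem_nhds
  exact ⟨⟨r, hr.le⟩, hr, h⟩

theorem continuous_gauge (hK : IsBody K) : Continuous (gauge K) :=
  _root_.continuous_gauge hK.convex hK.mem_nhds

theorem gauge_le_one_iff (hK : IsBody K) {x : En n} : gauge K x ≤ 1 ↔ x ∈ K := by
  rw [gauge_le_one_iff_mem_closure hK.convex hK.mem_nhds, hK.isCompact.isClosed.closure_eq]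

theorem gauge_eq_one_iff (hK : IsBody K) {x : En n} : gauge K x = 1 ↔ x ∈ frontier K :=
  gauge_eq_one_iff_mem_frontier hK.convex hK.mem_nhds

theorem gauge_pos_iff (hK : IsBody K) {x : En n} : 0 < gauge K x ↔ x ≠ 0 :=
  gauge_pos hK.absorbent (NormedSpace.isVonNBounded_iff ℝ |>.2 hK.isCompact.isBounded)

theorem inv_gauge_smul_mem (hK : IsBody K) {x : En n} (hx : x ≠ 0) :
    (gauge K x)⁻¹ • x ∈ frontier K := by
  have h := hK.gauge_pos_iff.2 hx
  rw [← hK.gauge_eq_one_iff, gauge_smul_of_nonneg (inv_nonneg.2 h.le), smul_eq_mul,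
    inv_mul_cancel₀ h.ne']

theorem frontier_subset (hK : IsBody K) : frontier K ⊆ K := hK.isCompact.isClosed.frontier_subset

theorem inner_le_gauge_mul (hK : IsBody K) (x u : En n) : ⟪x, u⟫_ℝ ≤ gauge K x * supportFn K u := by
  rcases eq_or_ne x 0 with rfl | hx
  · simp
  · have h := hK.gauge_pos_iff.2 hx
    have := inner_le_supportFn (u := u) hK.isCompact (hK.frontier_subset (hK.inv_gauge_smul_mem hx))
    rw [real_inner_smul_left] at this
    calc ⟪x, u⟫_ℝ = gauge K x * ((gauge K x)⁻¹ * ⟪x, u⟫_ℝ) := by field_simp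
      _ ≤ _ := by gcongr

theorem mul_norm_le_supportFn (hK : IsBody K) {r : ℝ} (hr : 0 < r)
    (hrK : ball (0 : En n) r ⊆ K) (u : En n) :
    r * ‖u‖ ≤ supportFn K u := by
  rcases eq_or_ne u 0 with rfl | hu
  · simpa using inner_le_supportFn (u := 0) hK.isCompact (interior_subset hK.zero_mem)
  have hun : 0 < ‖u‖ := norm_pos_iff.2 hu
  have hsub : closedBall (0 : En n) r ⊆ K := by
    rw [← closure_ball _ hr.ne']
    exact closure_minimal hrK hK.isCompact.isClosed
  have hmem : (r / ‖u‖) • u ∈ K := hsub (by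
    rw [mem_closedBall_zero_iff, norm_smul, Real.norm_of_nonneg (by positivity)]
    field_simp
    rfl)
  have := inner_le_supportFn (u := u) hK.isCompact hmem
  rw [real_inner_smul_left, real_inner_self_eq_norm_sq] at this
  calc r * ‖u‖ = r / ‖u‖ * ‖u‖ ^ 2 := by field_simp
    _ ≤ _ := this

theorem supportFn_pos (hK : IsBody K) {u : En n} (hu : u ≠ 0) : 0 < supportFn K u := by
  obtain ⟨r, hr, hrK⟩ := hK.exists_ball_subset
  have := hK.mul_norm_le_supportFn hr hrK u
  have h2 : 0 < r * ‖u‖ := mul_pos hr (norm_pos_iff.2 hu)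
  exact h2.trans_le this

theorem isNormal_iff (hK : IsBody K) {x u : En n} (hx : x ∈ K) :
    (∀ y ∈ K, ⟪y - x, u⟫_ℝ ≤ 0) ↔ ⟪x, u⟫_ℝ = supportFn K u := by
  constructor
  · intro h
    refine le_antisymm (inner_le_supportFn hK.isCompact hx) (supportFn_le hK.nonempty fun y hy ↦ ?_)
    have := h y hy
    rw [inner_sub_left] at this
    linarith
  · intro h y hy
    rw [inner_sub_left, h]
    linarith [inner_le_supportFn (u := u) hK.isCompact hy]

theorem exists_inner_eq (hK : IsBody K) {x : En n} (hx : x ≠ 0) :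
    ∃ u : Sph n, ⟪x, (u : En n)⟫_ℝ = gauge K x * supportFn K u := by
  have hg := hK.gauge_pos_iff.2 hx
  set y := (gauge K x)⁻¹ • x with hy
  have hyK := hK.inv_gauge_smul_mem hx
  obtain ⟨f, hf⟩ := geometric_hahn_banach_open_point hK.convex.interior isOpen_interior
    (fun h : y ∈ interior K ↦ hyK.2 h)
  set w : En n := (InnerProductSpace.toDual ℝ (En n)).symm f with hw
  have hfw : ∀ a, f a = ⟪a, w⟫_ℝ := fun a ↦ by
    rw [real_inner_comm, hw, InnerProductSpace.toDual_symm_apply]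
  have hw0 : w ≠ 0 := fun h ↦ by
    have := hf 0 hK.zero_mem
    rw [hfw, hfw, h] at this
    simp at this
  have hwn : 0 < ‖w‖ := norm_pos_iff.2 hw0
  have hle : ∀ a ∈ K, ⟪a, w⟫_ℝ ≤ ⟪y, w⟫_ℝ := fun a ha ↦ by
    have hcl : a ∈ closure (interior K) := by
      rw [hK.convex.closure_interior_eq_closure_of_nonempty_interior ⟨0, hK.zero_mem⟩]
      exact subset_closure ha
    have hsub : closure (interior K) ⊆ {a | ⟪a, w⟫_ℝ ≤ ⟪y, w⟫_ℝ} :=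
      closure_minimal (fun a ha ↦ by simpa [hfw] using (hf a ha).le)
        (isClosed_le (by fun_prop) continuous_const)
    exact hsub hcl
  refine ⟨⟨‖w‖⁻¹ • w, by simp [norm_smul, hwn.ne']⟩, ?_⟩
  have h1 : ⟪y, ‖w‖⁻¹ • w⟫_ℝ = supportFn K (‖w‖⁻¹ • w) := by
    refine (hK.isNormal_iff (hK.frontier_subset hyK)).1 fun a ha ↦ ?_
    rw [inner_sub_left, real_inner_smul_right, real_inner_smul_right, ← mul_sub]
    exact mul_nonpos_of_nonneg_of_nonpos (by positivity) (by linarith [hle a ha])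
  change ⟪x, ‖w‖⁻¹ • w⟫_ℝ = gauge K x * supportFn K (‖w‖⁻¹ • w)
  rw [← h1, hy, real_inner_smul_left]
  field_simp

end IsBody

section gaussMap

variable {m : ℕ}

/-- The normalized gradient of the gauge of `K`. -/
def gaussMap (K : Set (En (m + 1))) (x : En (m + 1)) : Sph (m + 1) :=
  if h : gradient (gauge K) x = 0 then ⟨EuclideanSpace.single 0 1, by simp⟩
  else ⟨‖gradient (gauge K) x‖⁻¹ • gradient (gauge K) x, by simp [norm_smul, h]⟩

/-- The nonzero points at which the gauge of `K` is differentiable. -/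
def regularSet (K : Set (En (m + 1))) : Set (En (m + 1)) :=
  {x | x ≠ 0 ∧ DifferentiableAt ℝ (gauge K) x}

theorem measurable_gaussMap (K : Set (En (m + 1))) : Measurable (gaussMap K) := by
  have hgrad : Measurable (gradient (gauge K)) :=
    (InnerProductSpace.toDual ℝ (En (m + 1))).symm.continuous.measurable.comp
      (measurable_fderiv ℝ (gauge K))
  refine (MeasurableEmbedding.subtype_coe isClosed_sphere.measurableSet).measurable_comp_iff.1 ?_
  have : Subtype.val ∘ gaussMap K = fun x ↦ if gradient (gauge K) x = 0 then
      EuclideanSpace.single 0 1 else ‖gradient (gauge K) x‖⁻¹ • gradient (gauge K) x := by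
    funext x
    simp only [Function.comp_apply, gaussMap]
    split_ifs <;> rfl
  rw [this]
  exact Measurable.ite (hgrad (measurableSet_singleton 0)) measurable_const
    (hgrad.norm.inv.smul hgrad)

theorem measurableSet_regularSet (K : Set (En (m + 1))) : MeasurableSet (regularSet K) :=
  (measurableSet_singleton 0).compl.inter (measurableSet_of_differentiableAt ℝ (gauge K))

theorem smul_mem_regularSet {K : Set (En (m + 1))} {x : En (m + 1)} (hx : x ∈ regularSet K) {s : ℝ}
    (hs : 0 < s) : s • x ∈ regularSet K := by
  refine ⟨smul_ne_zero hs.ne' hx.1, ?_⟩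
  have h1 : gauge K = fun y ↦ s * gauge K (s⁻¹ • y) := by
    funext y
    rw [gauge_smul_of_nonneg (inv_nonneg.2 hs.le), smul_eq_mul, mul_inv_cancel_left₀ hs.ne']
  have h2 : DifferentiableAt ℝ (gauge K) (s⁻¹ • s • x) := by
    rw [inv_smul_smul₀ hs.ne']
    exact hx.2
  rw [h1]
  exact (h2.comp (s • x) (by fun_prop : DifferentiableAt ℝ (fun y ↦ s⁻¹ • y) (s • x))).const_mul s

namespace IsBody

variable {K : Set (En (m + 1))}

theorem ae_mem_regularSet (hK : IsBody K) : ∀ᵐ x, x ∈ regularSet K := by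
  obtain ⟨r, hr, hrK⟩ := hK.exists_ball_subset
  have h0 : ∀ᵐ x : En (m + 1), x ≠ 0 := by
    rw [ae_iff]
    simp
  filter_upwards [(hK.convex.lipschitzWith_gauge hr hrK).ae_differentiableAt, h0] with x h1 h2
  exact ⟨h2, h1⟩

theorem eq_gaussMap (hK : IsBody K) {x : En (m + 1)} (hx : x ∈ regularSet K) {u : Sph (m + 1)}
    (hu : ⟪x, (u : En (m + 1))⟫_ℝ = gauge K x * supportFn K u) : u = gaussMap K x := by
  have hun : ‖(u : En (m + 1))‖ = 1 := by simp
  have hu0 : (u : En (m + 1)) ≠ 0 := fun h ↦ by simp [h] at hun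
  have hh := hK.supportFn_pos hu0
  have hgrad := hx.2.hasGradientAt
  have hmin : IsLocalMin (fun y ↦ gauge K y * supportFn K u - ⟪y, (u : En (m + 1))⟫_ℝ) x := by
    refine Filter.Eventually.of_forall fun y ↦ ?_
    simp only [hu, sub_self]
    linarith [hK.inner_le_gauge_mul y u]
  have hder : HasFDerivAt (fun y ↦ gauge K y * supportFn K u - ⟪y, (u : En (m + 1))⟫_ℝ)
      (supportFn K u • (InnerProductSpace.toDual ℝ (En (m + 1)) (gradient (gauge K) x)) -
        InnerProductSpace.toDual ℝ (En (m + 1)) (u : En (m + 1))) x := by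
    refine (hgrad.hasFDerivAt.mul_const _).sub ?_
    have := (InnerProductSpace.toDual ℝ (En (m + 1)) (u : En (m + 1))).hasFDerivAt (x := x)
    refine this.congr_of_eventuallyEq (Filter.Eventually.of_forall fun y ↦ ?_)
    simp [real_inner_comm]
  have hzero : supportFn K u • gradient (gauge K) x = u := by
    refine ext_inner_right ℝ fun z ↦ ?_
    have := DFunLike.congr_fun (hmin.hasFDerivAt_eq_zero hder) z
    simp only [sub_apply, smul_apply,
      InnerProductSpace.toDual_apply_apply, smul_eq_mul, zero_apply] at this
    rw [real_inner_smul_left]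
    linarith
  have hg0 : gradient (gauge K) x ≠ 0 := fun h ↦ hu0 (by rw [← hzero, h, smul_zero])
  apply Subtype.ext
  rw [gaussMap, dif_neg hg0]
  have hgn : supportFn K u * ‖gradient (gauge K) x‖ = 1 := by
    rw [← hun, ← hzero, norm_smul, Real.norm_of_nonneg hh.le]
    rw [hzero]
  have : ‖gradient (gauge K) x‖⁻¹ = supportFn K u :=
    (eq_inv_of_mul_eq_one_left hgn).symm
  change (u : En (m + 1)) = ‖gradient (gauge K) x‖⁻¹ • gradient (gauge K) x
  rw [this, hzero]

theorem inner_gaussMap (hK : IsBody K) {x : En (m + 1)} (hx : x ∈ regularSet K) :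
    ⟪x, (gaussMap K x : En (m + 1))⟫_ℝ = gauge K x * supportFn K (gaussMap K x) := by
  obtain ⟨u, hu⟩ := hK.exists_inner_eq hx.1
  rwa [← hK.eq_gaussMap hx hu]

theorem gaussMap_smul (hK : IsBody K) {x : En (m + 1)} (hx : x ∈ regularSet K) {s : ℝ}
    (hs : 0 < s) : gaussMap K (s • x) = gaussMap K x := by
  refine (hK.eq_gaussMap (smul_mem_regularSet hx hs) ?_).symm
  rw [real_inner_smul_left, hK.inner_gaussMap hx, gauge_smul_of_nonneg hs.le, smul_eq_mul,
    mul_assoc]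

end IsBody

end gaussMap

section cell

variable {m : ℕ} {K : Set (En (m + 1))}

/-- The map moving each point in direction `u`, homogeneously, so that the boundary of `K` is sent
to the supporting hyperplane of `K` with normal `u`. -/
def flatten (K : Set (En (m + 1))) (u x : En (m + 1)) : En (m + 1) :=
  x + (supportFn K u * gauge K x - ⟪x, u⟫_ℝ) • u

theorem inner_flatten {u : En (m + 1)} (hu : ‖u‖ = 1) (x : En (m + 1)) :
    ⟪flatten K u x, u⟫_ℝ = supportFn K u * gauge K x := by
  rw [flatten, inner_add_left, real_inner_smul_left, real_inner_self_eq_norm_sq, hu]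
  ring

theorem flatten_smul (u x : En (m + 1)) {s : ℝ} (hs : 0 ≤ s) :
    flatten K u (s • x) = s • flatten K u x := by
  rw [flatten, flatten, gauge_smul_of_nonneg hs, real_inner_smul_left, smul_add, smul_smul,
    smul_eq_mul]
  congr 2
  ring

namespace IsBody

theorem continuous_flatten (hK : IsBody K) (u : En (m + 1)) : Continuous (flatten K u) := by
  have := hK.continuous_gauge
  unfold flatten
  fun_prop

theorem defect_sub_le (hK : IsBody K) {r : ℝ≥0} {R ε : ℝ} (hr : 0 < r)
    (hrK : ball (0 : En (m + 1)) r ⊆ K) (hR : K ⊆ closedBall 0 R) {u₀ u x : En (m + 1)}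
    (hu : ‖u - u₀‖ ≤ ε) (hx : ⟪x, u⟫_ℝ = gauge K x * supportFn K u) (y : En (m + 1)) :
    (supportFn K u₀ * gauge K x - ⟪x, u₀⟫_ℝ) - (supportFn K u₀ * gauge K y - ⟪y, u₀⟫_ℝ) ≤
      (R / r + 1) * ε * ‖x - y‖ := by
  have hy := hK.inner_le_gauge_mul y u
  have hε : 0 ≤ ε := (norm_nonneg _).trans hu
  have hR0 : 0 ≤ R := by
    simpa using hR (interior_subset hK.zero_mem)
  have h1 : |supportFn K u₀ - supportFn K u| ≤ R * ε := by
    refine (abs_supportFn_sub_le hK.isCompact hK.nonempty hR _ _).trans ?_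
    rw [norm_sub_rev]
    gcongr
  have h2 : |gauge K x - gauge K y| ≤ (r : ℝ)⁻¹ * ‖x - y‖ := by
    have := (hK.convex.lipschitzWith_gauge hr hrK).dist_le_mul x y
    rwa [Real.dist_eq, dist_eq_norm, NNReal.coe_inv] at this
  have h3 : (supportFn K u₀ - supportFn K u) * (gauge K x - gauge K y) ≤
      (R * ε) * ((r : ℝ)⁻¹ * ‖x - y‖) := by
    refine (le_abs_self _).trans ?_
    rw [abs_mul]
    gcongr
  have h4 : ⟪x - y, u - u₀⟫_ℝ ≤ ‖x - y‖ * ε :=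
    (real_inner_le_norm _ _).trans (by gcongr)
  rw [inner_sub_left, inner_sub_right, inner_sub_right] at h4
  have h5 : (R / r + 1) * ε * ‖x - y‖ = (R * ε) * ((r : ℝ)⁻¹ * ‖x - y‖) + ‖x - y‖ * ε := by
    rw [div_eq_mul_inv]
    ring
  rw [h5]
  nlinarith

theorem exists_cell_radius (hK : IsBody K) {L : ℝ≥0} (hL : 1 < L) :
    ∃ ε : ℝ, 0 < ε ∧ ∀ u₀ : Sph (m + 1),
      (∀ x y : En (m + 1), ∀ u v : Sph (m + 1), ‖(u : En (m + 1)) - u₀‖ ≤ ε →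
        ‖(v : En (m + 1)) - u₀‖ ≤ ε → ⟪x, (u : En (m + 1))⟫_ℝ = gauge K x * supportFn K u →
        ⟪y, (v : En (m + 1))⟫_ℝ = gauge K y * supportFn K v →
        dist (flatten K u₀ x) (flatten K u₀ y) ≤ L * dist x y ∧
        dist x y ≤ L * dist (flatten K u₀ x) (flatten K u₀ y)) ∧
      ∀ u : Sph (m + 1), ‖(u : En (m + 1)) - u₀‖ ≤ ε →
        supportFn K u ≤ L * supportFn K u₀ ∧ supportFn K u₀ ≤ L * supportFn K u := by
  obtain ⟨r, hr, hrK⟩ := hK.exists_ball_subset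
  obtain ⟨R, hR⟩ := hK.isCompact.isBounded.subset_closedBall 0
  have hr' : (0 : ℝ) < r := hr
  have hR0 : 0 ≤ R := by simpa using hR (interior_subset hK.zero_mem)
  have hL' : (1 : ℝ) < L := hL
  have hC : 0 < R / r + 1 := by positivity
  set δ : ℝ := 1 - (L : ℝ)⁻¹ with hδ
  have hLinv : (L : ℝ)⁻¹ < 1 := inv_lt_one_of_one_lt₀ hL'
  have hδ0 : 0 < δ := by linarith
  have hLL : (L : ℝ) * (L : ℝ)⁻¹ = 1 := mul_inv_cancel₀ (by positivity)
  have hLδ : (L : ℝ) * (1 - δ) = 1 := by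
    rw [hδ]
    linarith
  have h1δ : 1 + δ ≤ L := by nlinarith
  refine ⟨δ / (R / r + 1), by positivity, fun u₀ ↦ ⟨?_, ?_⟩⟩
  · intro x y u v hu hv hx hy
    have hnu : ‖(u₀ : En (m + 1))‖ = 1 := by simp
    have h1 := hK.defect_sub_le hr hrK hR hu hx y
    have h2 := hK.defect_sub_le hr hrK hR hv hy x
    rw [mul_div_cancel₀ _ hC.ne'] at h1 h2
    rw [norm_sub_rev y x] at h2
    set q : En (m + 1) → ℝ := fun z ↦ supportFn K u₀ * gauge K z - ⟪z, (u₀ : En (m + 1))⟫_ℝ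
    have hq : ‖(q x - q y) • (u₀ : En (m + 1))‖ ≤ δ * ‖x - y‖ := by
      rw [norm_smul, hnu, mul_one, Real.norm_eq_abs, abs_le]
      constructor <;> linarith
    have hT : flatten K u₀ x - flatten K u₀ y = (x - y) + (q x - q y) • (u₀ : En (m + 1)) := by
      simp only [flatten, q, sub_smul]
      abel
    rw [dist_eq_norm, dist_eq_norm, hT]
    constructor
    · refine (norm_add_le _ _).trans ?_
      nlinarith [norm_nonneg (x - y)]
    · have h3 : ‖x - y‖ - ‖(q x - q y) • (u₀ : En (m + 1))‖ ≤
          ‖(x - y) + (q x - q y) • (u₀ : En (m + 1))‖ := by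
        have := norm_sub_le ((x - y) + (q x - q y) • (u₀ : En (m + 1)))
          ((q x - q y) • (u₀ : En (m + 1)))
        rw [add_sub_cancel_right] at this
        linarith
      calc ‖x - y‖ = L * ((1 - δ) * ‖x - y‖) := by rw [← mul_assoc, hLδ, one_mul]
        _ ≤ _ := by
          gcongr
          linarith
  · intro u hu
    have key : ∀ u v : Sph (m + 1), ‖(u : En (m + 1)) - v‖ ≤ δ / (R / r + 1) →
        supportFn K u ≤ L * supportFn K v := fun u v huv ↦ by
      have h1 := (abs_le.1 (abs_supportFn_sub_le hK.isCompact hK.nonempty hR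
        (u : En (m + 1)) v)).2
      have h2 := hK.mul_norm_le_supportFn hr' hrK (u : En (m + 1))
      rw [norm_eq_of_mem_sphere, mul_one] at h2
      have h3 : R * ‖(u : En (m + 1)) - v‖ ≤ δ * supportFn K u := by
        calc R * ‖(u : En (m + 1)) - v‖ ≤ R * (δ / (R / r + 1)) := by gcongr
          _ = δ * (R / (R / r + 1)) := by ring
          _ ≤ δ * r := by
            gcongr
            rw [div_le_iff₀ hC, mul_add, mul_div_cancel₀ _ hr'.ne']
            linarith
          _ ≤ _ := by gcongr
      calc supportFn K u = L * ((1 - δ) * supportFn K u) := by rw [← mul_assoc, hLδ, one_mul]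
        _ ≤ _ := by
          gcongr
          linarith
    exact ⟨key u u₀ hu, key u₀ u (by rwa [norm_sub_rev])⟩

/-- Comparison of the volume of a narrow cone over a part of the boundary of `K` with the
Hausdorff measure of its base. -/
theorem volume_cell (hK : IsBody K) {L : ℝ≥0} {ε : ℝ} {u₀ : Sph (m + 1)}
    (hL : ∀ x y : En (m + 1), ∀ u v : Sph (m + 1), ‖(u : En (m + 1)) - u₀‖ ≤ ε →
        ‖(v : En (m + 1)) - u₀‖ ≤ ε → ⟪x, (u : En (m + 1))⟫_ℝ = gauge K x * supportFn K u →
        ⟪y, (v : En (m + 1))⟫_ℝ = gauge K y * supportFn K v →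
        dist (flatten K u₀ x) (flatten K u₀ y) ≤ L * dist x y ∧
        dist x y ≤ L * dist (flatten K u₀ x) (flatten K u₀ y))
    {A : Set (En (m + 1))} (hA : MeasurableSet A) (hA0 : ∀ x ∈ A, x ≠ 0)
    (hAs : ∀ x ∈ A, ∀ s : ℝ, 0 < s → s • x ∈ A)
    (hAu : ∀ x ∈ A, ∃ u : Sph (m + 1), ‖(u : En (m + 1)) - u₀‖ ≤ ε ∧
      ⟪x, (u : En (m + 1))⟫_ℝ = gauge K x * supportFn K u) :
    volume (A ∩ K) ≤ (L : ℝ≥0∞) ^ (2 * m + 1) * (ENNReal.ofReal (supportFn K u₀ / (m + 1)) *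
        (hausdorffConst m * μH[(m : ℝ)] (A ∩ frontier K))) ∧
    ENNReal.ofReal (supportFn K u₀ / (m + 1)) *
        (hausdorffConst m * μH[(m : ℝ)] (A ∩ frontier K)) ≤
      (L : ℝ≥0∞) ^ (2 * m + 1) * volume (A ∩ K) := by
  have hnu : ‖(u₀ : En (m + 1))‖ = 1 := by simp
  have hu0 : (u₀ : En (m + 1)) ≠ 0 := fun h ↦ by simp [h] at hnu
  have hpos := hK.supportFn_pos hu0
  set T := flatten K (u₀ : En (m + 1)) with hT
  have hLip : ∀ x ∈ A, ∀ y ∈ A, dist (T x) (T y) ≤ L * dist x y ∧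
      dist x y ≤ L * dist (T x) (T y) := fun x hx y hy ↦ by
    obtain ⟨u, hu, hxu⟩ := hAu x hx
    obtain ⟨v, hv, hyv⟩ := hAu y hy
    exact hL x y u v hu hv hxu hyv
  have hinj : Set.InjOn T A := fun x hx y hy hxy ↦ by
    have := (hLip x hx y hy).2
    rw [hxy, dist_self, mul_zero] at this
    exact dist_le_zero.1 this
  have hTA : MeasurableSet (T '' A) :=
    hA.image_of_continuousOn_injOn (hK.continuous_flatten _).continuousOn hinj
  have hcone := volume_cone hnu hTA
    (by
      rintro _ ⟨x, hx, rfl⟩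
      rw [hT, inner_flatten hnu]
      exact mul_pos hpos (hK.gauge_pos_iff.2 (hA0 x hx)))
    (by
      rintro _ ⟨x, hx, rfl⟩ s hs
      exact ⟨s • x, hAs x hx s hs, flatten_smul _ _ hs.le⟩) hpos
  have him1 : T '' A ∩ {z | ⟪z, (u₀ : En (m + 1))⟫_ℝ ≤ supportFn K u₀} = T '' (A ∩ K) := by
    rw [← Set.image_inter_preimage]
    congr 2
    ext x
    simp only [Set.mem_preimage, Set.mem_ofPred_eq, hT, inner_flatten hnu]
    rw [← hK.gauge_le_one_iff, mul_le_iff_le_one_right hpos]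
  have him2 : T '' A ∩ {z | ⟪z, (u₀ : En (m + 1))⟫_ℝ = supportFn K u₀} =
      T '' (A ∩ frontier K) := by
    rw [← Set.image_inter_preimage]
    congr 2
    ext x
    simp only [Set.mem_preimage, Set.mem_ofPred_eq, hT, inner_flatten hnu]
    rw [← hK.gauge_eq_one_iff, mul_eq_left₀ hpos.ne']
  rw [him1, him2] at hcone
  have hl1 : LipschitzOnWith L T (A ∩ K) :=
    LipschitzOnWith.of_dist_le_mul fun x hx y hy ↦ (hLip x hx.1 y hy.1).1
  have hl2 : LipschitzOnWith L T (A ∩ frontier K) :=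
    LipschitzOnWith.of_dist_le_mul fun x hx y hy ↦ (hLip x hx.1 y hy.1).1
  have hv1 := volume_image_le_of_lipschitzOnWith hl1
  have hv2 := volume_le_of_dist_le (s := A ∩ K) fun x hx y hy ↦ (hLip x hx.1 y hy.1).2
  have hh1 := hl2.hausdorffMeasure_image_le (d := m) (by positivity)
  have hh2 := hausdorffMeasure_le_of_dist_le (s := A ∩ frontier K) (d := m)
    (fun x hx y hy ↦ (hLip x hx.1 y hy.1).2) (by positivity)
  rw [ENNReal.rpow_natCast] at hh1 hh2
  rw [hcone] at hv1 hv2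
  set a := ENNReal.ofReal (supportFn K u₀ / (m + 1))
  set c : ℝ≥0∞ := ((hausdorffConst m : ℝ≥0) : ℝ≥0∞)
  constructor
  · calc volume (A ∩ K) ≤ (L : ℝ≥0∞) ^ (m + 1) * (a * (c * μH[(m : ℝ)] (T '' (A ∩ frontier K)))) :=
        hv2
      _ ≤ (L : ℝ≥0∞) ^ (m + 1) * (a * (c * (L ^ m * μH[(m : ℝ)] (A ∩ frontier K)))) := by gcongr
      _ = _ := by ring
  · calc a * (c * μH[(m : ℝ)] (A ∩ frontier K))
        ≤ a * (c * (L ^ m * μH[(m : ℝ)] (T '' (A ∩ frontier K)))) := by gcongr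
      _ = L ^ m * (a * (c * μH[(m : ℝ)] (T '' (A ∩ frontier K)))) := by ring
      _ ≤ L ^ m * ((L : ℝ≥0∞) ^ (m + 1) * volume (A ∩ K)) := by gcongr
      _ = _ := by ring

end IsBody

end cell

theorem measure_le_of_forall_subset {X : Type*} [MeasurableSpace X] {μ ν : Measure X}
    {U : ℕ → Set X} (hU : ∀ i, MeasurableSet (U i)) (hcov : ⋃ i, U i = Set.univ)
    (h : ∀ i, ∀ ω ⊆ U i, MeasurableSet ω → μ ω ≤ ν ω) : μ ≤ ν := by
  refine Measure.le_iff.2 fun ω hω ↦ ?_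
  have hd : ∀ i, MeasurableSet (ω ∩ disjointed U i) := fun i ↦ hω.inter (.disjointed hU i)
  have hpd : Pairwise (Function.onFun Disjoint fun i ↦ ω ∩ disjointed U i) :=
    fun i j hij ↦ (disjoint_disjointed U hij).mono Set.inter_subset_right Set.inter_subset_right
  have hω' : ω = ⋃ i, ω ∩ disjointed U i := by
    rw [← Set.inter_iUnion, iUnion_disjointed, hcov, Set.inter_univ]
  rw [hω', measure_iUnion hpd hd, measure_iUnion hpd hd]
  exact ENNReal.tsum_le_tsum fun i ↦ h i _
    (Set.inter_subset_right.trans (disjointed_subset U i)) (hd i)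

theorem ENNReal.le_of_forall_one_lt_le_pow_mul {a b : ℝ≥0∞} (N : ℕ)
    (h : ∀ L : ℝ≥0, 1 < L → a ≤ (L : ℝ≥0∞) ^ N * b) : a ≤ b := by
  have ht : Tendsto (fun L : ℝ≥0 ↦ (L : ℝ≥0∞) ^ N * b) (𝓝[>] 1) (𝓝 (1 ^ N * b)) := by
    refine ENNReal.Tendsto.mul_const ?_ (Or.inl (by simp))
    refine (ENNReal.Tendsto.pow (n := N) ?_).mono_left nhdsWithin_le_nhds
    exact ENNReal.continuous_coe.tendsto 1
  rw [one_pow, one_mul] at ht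
  exact ge_of_tendsto ht (eventually_nhdsWithin_of_forall h)

section surfaceMeasure

variable {m : ℕ} {K : Set (En (m + 1))}

/-- The image under the Gauss map of the Hausdorff measure on the regular boundary points. -/
def surfaceMeasure (K : Set (En (m + 1))) : Measure (Sph (m + 1)) :=
  Measure.map (gaussMap K) ((μH[(m : ℝ)]).restrict (frontier K ∩ regularSet K))

/-- The image under the Gauss map of Lebesgue measure on `K`. -/
def coneMeasure (K : Set (En (m + 1))) : Measure (Sph (m + 1)) :=
  Measure.map (gaussMap K) (volume.restrict K)

/-- The density of the cone measure with respect to the surface measure. -/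
def coneDensity (K : Set (En (m + 1))) (u : Sph (m + 1)) : ℝ≥0∞ :=
  ENNReal.ofReal (supportFn K u / (m + 1)) * hausdorffConst m

theorem surfaceMeasure_apply (K : Set (En (m + 1))) {ω : Set (Sph (m + 1))}
    (hω : MeasurableSet ω) : surfaceMeasure K ω =
      μH[(m : ℝ)] ((regularSet K ∩ gaussMap K ⁻¹' ω) ∩ frontier K) := by
  rw [surfaceMeasure, Measure.map_apply (measurable_gaussMap K) hω,
    Measure.restrict_apply (measurable_gaussMap K hω)]
  congr 1
  ext x
  simp only [Set.mem_inter_iff]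
  tauto

theorem exists_countable_cover {ε : ℝ} (hε : 0 < ε) : ∃ c : ℕ → Sph (m + 1),
    ⋃ i, closedBall (c i) ε = Set.univ := by
  have : Nonempty (Sph (m + 1)) := ⟨⟨EuclideanSpace.single 0 1, by simp⟩⟩
  refine ⟨TopologicalSpace.denseSeq (Sph (m + 1)), Set.eq_univ_of_forall fun u ↦ ?_⟩
  obtain ⟨i, hi⟩ :=
    (TopologicalSpace.denseRange_denseSeq (Sph (m + 1))).exists_dist_lt u hε
  exact Set.mem_iUnion.2 ⟨i, hi.le⟩

namespace IsBody

theorem coneMeasure_apply (hK : IsBody K) {ω : Set (Sph (m + 1))}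
    (hω : MeasurableSet ω) : coneMeasure K ω =
      volume ((regularSet K ∩ gaussMap K ⁻¹' ω) ∩ K) := by
  rw [coneMeasure, Measure.map_apply (measurable_gaussMap K) hω,
    Measure.restrict_apply (measurable_gaussMap K hω)]
  refine measure_congr ?_
  filter_upwards [hK.ae_mem_regularSet] with x hx
  apply propext
  change (x ∈ gaussMap K ⁻¹' ω ∩ K) ↔ (x ∈ (regularSet K ∩ gaussMap K ⁻¹' ω) ∩ K)
  simp only [Set.mem_inter_iff]
  tauto

theorem measurable_coneDensity (hK : IsBody K) : Measurable (coneDensity K) := by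
  have := (continuous_supportFn hK.isCompact hK.nonempty).measurable
  unfold coneDensity
  fun_prop

theorem cone_comparison (hK : IsBody K) {L : ℝ≥0} (hL : 1 < L) :
    coneMeasure K ≤ (L : ℝ≥0∞) ^ (2 * m + 2) • (surfaceMeasure K).withDensity (coneDensity K) ∧
    (surfaceMeasure K).withDensity (coneDensity K) ≤ (L : ℝ≥0∞) ^ (2 * m + 2) • coneMeasure K := by
  obtain ⟨ε, hε, hcell⟩ := hK.exists_cell_radius hL
  obtain ⟨c, hc⟩ := exists_countable_cover (m := m) hε
  have main : ∀ i, ∀ ω ⊆ closedBall (c i) ε, MeasurableSet ω →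
      coneMeasure K ω ≤
        (L : ℝ≥0∞) ^ (2 * m + 2) * (surfaceMeasure K).withDensity (coneDensity K) ω ∧
      (surfaceMeasure K).withDensity (coneDensity K) ω ≤
        (L : ℝ≥0∞) ^ (2 * m + 2) * coneMeasure K ω := fun i ω hωc hω ↦ by
    have hdist : ∀ u ∈ ω, ‖(u : En (m + 1)) - c i‖ ≤ ε := fun u hu ↦ by
      rw [← dist_eq_norm]
      exact hωc hu
    obtain ⟨h1, h2⟩ := hK.volume_cell (hcell (c i)).1
      (A := regularSet K ∩ gaussMap K ⁻¹' ω)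
      ((measurableSet_regularSet K).inter (measurable_gaussMap K hω))
      (fun x hx ↦ hx.1.1)
      (fun x hx s hs ↦ ⟨smul_mem_regularSet hx.1 hs, by
        rw [Set.mem_preimage, hK.gaussMap_smul hx.1 hs]
        exact hx.2⟩)
      (fun x hx ↦ ⟨gaussMap K x, hdist _ hx.2, hK.inner_gaussMap hx.1⟩)
    rw [← hK.coneMeasure_apply hω, ← surfaceMeasure_apply K hω] at h1 h2
    have hassoc : ENNReal.ofReal (supportFn K (c i) / (m + 1)) *
        (hausdorffConst m * surfaceMeasure K ω) = coneDensity K (c i) * surfaceMeasure K ω :=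
      (mul_assoc _ _ _).symm
    rw [hassoc] at h1 h2
    have hdens : ∀ u ∈ ω, coneDensity K u ≤ L * coneDensity K (c i) ∧
        coneDensity K (c i) ≤ L * coneDensity K u := fun u hu ↦ by
      obtain ⟨h3, h4⟩ := (hcell (c i)).2 u (hdist u hu)
      unfold coneDensity
      rw [← ENNReal.ofReal_coe_nnreal (p := L), ← mul_assoc, ← mul_assoc,
        ← ENNReal.ofReal_mul (by positivity), ← ENNReal.ofReal_mul (by positivity)]
      constructor
      · gcongr
        rw [← mul_div_assoc]
        gcongr
      · gcongr
        rw [← mul_div_assoc]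
        gcongr
    rw [withDensity_apply _ hω]
    constructor
    · rw [show 2 * m + 2 = (2 * m + 1) + 1 from rfl, pow_succ _ (2 * m + 1), mul_assoc]
      refine h1.trans (mul_le_mul_right ?_ _)
      rw [← setLIntegral_const, ← lintegral_const_mul _ hK.measurable_coneDensity]
      exact setLIntegral_mono (hK.measurable_coneDensity.const_mul _) fun u hu ↦ (hdens u hu).2
    · calc ∫⁻ u in ω, coneDensity K u ∂surfaceMeasure K
          ≤ ∫⁻ u in ω, L * coneDensity K (c i) ∂surfaceMeasure K :=
            setLIntegral_mono measurable_const fun u hu ↦ (hdens u hu).1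
        _ = L * (coneDensity K (c i) * surfaceMeasure K ω) := by
            rw [setLIntegral_const, mul_assoc]
        _ ≤ L * ((L : ℝ≥0∞) ^ (2 * m + 1) * coneMeasure K ω) := by gcongr
        _ = _ := by ring
  exact ⟨measure_le_of_forall_subset (fun i ↦ isClosed_closedBall.measurableSet) hc
      fun i ω h hω ↦ (main i ω h hω).1,
    measure_le_of_forall_subset (fun i ↦ isClosed_closedBall.measurableSet) hc
      fun i ω h hω ↦ (main i ω h hω).2⟩

/-- The cone-volume formula. -/
theorem coneMeasure_eq (hK : IsBody K) :
    coneMeasure K = (surfaceMeasure K).withDensity (coneDensity K) := by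
  refine le_antisymm ?_ ?_ <;> refine Measure.le_iff'.2 fun ω ↦
    ENNReal.le_of_forall_one_lt_le_pow_mul (2 * m + 2) fun L hL ↦ ?_
  · exact Measure.le_iff'.1 (hK.cone_comparison hL).1 ω
  · exact Measure.le_iff'.1 (hK.cone_comparison hL).2 ω

theorem isClosed_setOf_exists_inner_eq (hK : IsBody K) {F : Set (Sph (m + 1))} (hF : IsClosed F) :
    IsClosed {x : En (m + 1) | ∃ u ∈ F, ⟪x, (u : En (m + 1))⟫_ℝ = gauge K x * supportFn K u} := by
  have h1 := hK.continuous_gauge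
  have h2 := continuous_supportFn hK.isCompact hK.nonempty
  have hc : IsClosed {p : En (m + 1) × Sph (m + 1) | p.2 ∈ F ∧
      ⟪p.1, (p.2 : En (m + 1))⟫_ℝ = gauge K p.1 * supportFn K p.2} :=
    (hF.preimage continuous_snd).inter (isClosed_eq (by fun_prop) (by fun_prop))
  have := isClosedMap_fst_of_compactSpace _ hc
  convert this using 1
  ext x
  simp

theorem hausdorffMeasure_frontier_diff_regularSet (hK : IsBody K) :
    μH[(m : ℝ)] (frontier K \ regularSet K) = 0 := by
  obtain ⟨ε, hε, hcell⟩ := hK.exists_cell_radius (one_lt_two : (1 : ℝ≥0) < 2)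
  obtain ⟨c, hc⟩ := exists_countable_cover (m := m) hε
  set A : ℕ → Set (En (m + 1)) := fun i ↦ ({0}ᶜ \ regularSet K) ∩
    {x | ∃ u ∈ closedBall (c i) ε, ⟪x, (u : En (m + 1))⟫_ℝ = gauge K x * supportFn K u} with hA
  have hsub : frontier K \ regularSet K ⊆ ⋃ i, A i ∩ frontier K := fun x hx ↦ by
    have hx0 : x ≠ 0 := by
      rintro rfl
      exact hx.1.2 hK.zero_mem
    obtain ⟨u, hu⟩ := hK.exists_inner_eq hx0
    obtain ⟨i, hi⟩ := Set.mem_iUnion.1 (hc.ge (Set.mem_univ u))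
    exact Set.mem_iUnion.2 ⟨i, ⟨⟨hx0, hx.2⟩, u, hi, hu⟩, hx.1⟩
  refine measure_mono_null hsub (measure_iUnion_null fun i ↦ ?_)
  obtain ⟨-, h⟩ := hK.volume_cell (hcell (c i)).1 (A := A i)
    (((measurableSet_singleton 0).compl.diff (measurableSet_regularSet K)).inter
      (hK.isClosed_setOf_exists_inner_eq isClosed_closedBall).measurableSet)
    (fun x hx ↦ hx.1.1)
    (by
      rintro x ⟨⟨hx0, hx⟩, u, hu, hxu⟩ s hs
      refine ⟨⟨smul_ne_zero hs.ne' hx0, fun h ↦ hx ?_⟩, u, hu, ?_⟩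
      · have := smul_mem_regularSet h (inv_pos.2 hs)
        rwa [inv_smul_smul₀ hs.ne'] at this
      · rw [real_inner_smul_left, hxu, gauge_smul_of_nonneg hs.le, smul_eq_mul, mul_assoc])
    (by
      rintro x ⟨-, u, hu, hxu⟩
      exact ⟨u, by rw [← dist_eq_norm]; exact hu, hxu⟩)
  have hnull : volume (A i ∩ K) = 0 := by
    refine measure_mono_null (fun x hx ↦ ?_) (ae_iff.1 hK.ae_mem_regularSet)
    exact hx.1.1.2
  rw [hnull, mul_zero, nonpos_iff_eq_zero, mul_eq_zero, mul_eq_zero] at h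
  have hu0 : ((c i : Sph (m + 1)) : En (m + 1)) ≠ 0 := fun h ↦ by
    have : ‖((c i : Sph (m + 1)) : En (m + 1))‖ = 1 := by simp
    simp [h] at this
  have hpos := hK.supportFn_pos hu0
  rcases h with h | h | h
  · rw [ENNReal.ofReal_eq_zero] at h
    have : 0 < supportFn K (c i) / (m + 1) := by positivity
    linarith
  · exact absurd (ENNReal.coe_eq_zero.1 h) (hausdorffConst_ne_zero m)
  · exact h

/-- The surface measure of a set of directions is the Hausdorff measure of its reverse spherical
image. -/
theorem surfaceMeasure_eq_hausdorffMeasure (hK : IsBody K) {ω : Set (Sph (m + 1))}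
    (hω : MeasurableSet ω) : surfaceMeasure K ω =
      μH[(m : ℝ)] {x ∈ frontier K | ∃ u ∈ ω, ∀ y ∈ K, ⟪y - x, (u : En (m + 1))⟫_ℝ ≤ 0} := by
  rw [surfaceMeasure_apply K hω]
  have hnormal : ∀ x ∈ frontier K, ∀ u : Sph (m + 1), (∀ y ∈ K, ⟪y - x, (u : En (m + 1))⟫_ℝ ≤ 0) ↔
      ⟪x, (u : En (m + 1))⟫_ℝ = gauge K x * supportFn K u := fun x hx u ↦ by
    rw [hK.isNormal_iff (hK.frontier_subset hx), hK.gauge_eq_one_iff.2 hx, one_mul]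
  refine le_antisymm (measure_mono ?_) ?_
  · rintro x ⟨⟨hx, hxω⟩, hxK⟩
    exact ⟨hxK, gaussMap K x, hxω, (hnormal x hxK _).2 (hK.inner_gaussMap hx)⟩
  · refine (measure_mono (t := ((regularSet K ∩ gaussMap K ⁻¹' ω) ∩ frontier K) ∪
      (frontier K \ regularSet K)) ?_).trans ((measure_union_le _ _).trans ?_)
    · rintro x ⟨hxK, u, hu, hxu⟩
      by_cases hx : x ∈ regularSet K
      · refine Or.inl ⟨⟨hx, ?_⟩, hxK⟩
        rw [Set.mem_preimage, ← hK.eq_gaussMap hx ((hnormal x hxK u).1 hxu)]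
        exact hu
      · exact Or.inr ⟨hxK, hx⟩
    · rw [hK.hausdorffMeasure_frontier_diff_regularSet, add_zero]

end IsBody

end surfaceMeasure

section moments

variable {n : ℕ}

theorem integrable_of_continuous_sphere (μ : Measure (Sph n)) [IsFiniteMeasure μ]
    {f : Sph n → ℝ} (hf : Continuous f) : Integrable f μ :=
  BoundedContinuousFunction.integrable μ (BoundedContinuousFunction.mkOfCompact ⟨f, hf⟩)

theorem integral_inner_eq_sum (μ : Measure (Sph n)) [IsFiniteMeasure μ] (v : En n) :
    ∫ u : Sph n, ⟪v, (u : En n)⟫_ℝ ∂μ = ∑ i, v i * ∫ u : Sph n, (u : En n) i ∂μ := by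
  simp_rw [PiLp.inner_apply, RCLike.inner_apply, conj_trivial]
  rw [integral_finsetSum _ fun i _ ↦ integrable_of_continuous_sphere μ (by fun_prop)]
  simp_rw [mul_comm _ (v _), integral_const_mul]

theorem star_dotProduct_secondMomentMatrix_mulVec (μ : Measure (Sph n)) [IsFiniteMeasure μ]
    (v : En n) : star (v : Fin n → ℝ) ⬝ᵥ (secondMomentMatrix μ).mulVec v =
      ∫ u : Sph n, ⟪v, (u : En n)⟫_ℝ ^ 2 ∂μ := by
  have h : ∀ u : Sph n, ⟪v, (u : En n)⟫_ℝ ^ 2 =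
      ∑ i, v i * ∑ j, ((u : En n) i * (u : En n) j) * v j := fun u ↦ by
    simp_rw [PiLp.inner_apply, RCLike.inner_apply, conj_trivial]
    rw [sq, Finset.sum_mul_sum]
    refine Finset.sum_congr rfl fun i _ ↦ ?_
    rw [Finset.mul_sum]
    exact Finset.sum_congr rfl fun j _ ↦ by ring
  simp_rw [h]
  rw [integral_finsetSum _ fun i _ ↦ integrable_of_continuous_sphere μ (by fun_prop)]
  refine Finset.sum_congr rfl fun i _ ↦ ?_
  rw [integral_const_mul, integral_finsetSum _ fun j _ ↦
    integrable_of_continuous_sphere μ (by fun_prop)]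
  simp only [integral_mul_const]
  rfl

theorem posDef_secondMomentMatrix_iff (μ : Measure (Sph n)) [IsFiniteMeasure μ] :
    (secondMomentMatrix μ).PosDef ↔
      ∀ v : En n, v ≠ 0 → 0 < ∫ u : Sph n, ⟪v, (u : En n)⟫_ℝ ^ 2 ∂μ := by
  rw [Matrix.posDef_iff_dotProduct_mulVec]
  constructor
  · intro h v hv
    rw [← star_dotProduct_secondMomentMatrix_mulVec]
    exact h.2 fun h0 ↦ hv (by ext i; exact congrFun h0 i)
  · refine fun h ↦ ⟨?_, fun v hv ↦ ?_⟩
    · ext i j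
      simp [secondMomentMatrix, mul_comm]
    · have := h (WithLp.toLp 2 v) fun h0 ↦ hv (by ext i; exact congrArg (fun w : En n ↦ w i) h0)
      rwa [← star_dotProduct_secondMomentMatrix_mulVec] at this

end moments

section translate

variable {m : ℕ} {K : Set (En (m + 1))}

/-- The boundary points of `K` admitting an outer normal in `ω`. -/
def reverseSphericalImage {n : ℕ} (K : Set (En n)) (ω : Set (Sph n)) : Set (En n) :=
  {x ∈ frontier K | ∃ u ∈ ω, ∀ y ∈ K, ⟪y - x, (u : En n)⟫_ℝ ≤ 0}

theorem isBody_translate {n : ℕ} {K : Set (En n)} (hconv : Convex ℝ K) (hK : IsCompact K)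
    {p : En n} (hp : p ∈ interior K) : IsBody ((· + p) ⁻¹' K) where
  convex := hconv.translate_preimage_left p
  isCompact := (Homeomorph.addRight p).isCompact_preimage.2 hK
  zero_mem := by
    have := (Homeomorph.addRight p).preimage_interior K
    simp only [Homeomorph.coe_addRight] at this
    rw [← this]
    simpa using hp

theorem supportFn_translate {n : ℕ} {K : Set (En n)} (hK : IsCompact K) (hne : K.Nonempty)
    (p u : En n) : supportFn ((· + p) ⁻¹' K) u = supportFn K u - ⟪p, u⟫_ℝ := by
  have hc : IsCompact ((· + p) ⁻¹' K) := (Homeomorph.addRight p).isCompact_preimage.2 hK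
  have hmem : ∀ x ∈ K, x - p ∈ (· + p) ⁻¹' K := fun x hx ↦ by simpa using hx
  obtain ⟨x₀, hx₀⟩ := hne
  refine le_antisymm (supportFn_le ⟨_, hmem x₀ hx₀⟩ fun x hx ↦ ?_) ?_
  · have := inner_le_supportFn (u := u) hK hx
    rw [inner_add_left] at this
    linarith
  · rw [sub_le_iff_le_add]
    refine supportFn_le ⟨x₀, hx₀⟩ fun x hx ↦ ?_
    have := inner_le_supportFn (u := u) hc (hmem x hx)
    rw [inner_sub_left] at this
    linarith

theorem reverseSphericalImage_translate {n : ℕ} (K : Set (En n)) (p : En n) (ω : Set (Sph n)) :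
    reverseSphericalImage ((· + p) ⁻¹' K) ω = (· + p) ⁻¹' reverseSphericalImage K ω := by
  have h := (Homeomorph.addRight p).preimage_frontier K
  simp only [Homeomorph.coe_addRight] at h
  ext x
  have h1 : x ∈ frontier ((· + p) ⁻¹' K) ↔ x + p ∈ frontier K := by
    rw [← h]
    rfl
  refine and_congr h1 (exists_congr fun u ↦ and_congr_right fun _ ↦ ⟨fun H y hy ↦ ?_,
    fun H y hy ↦ ?_⟩)
  · have := H (y - p) (by simpa using hy)
    rwa [sub_sub, add_comm p x] at this
  · have := H (y + p) hy
    rwa [add_sub_add_right_eq_sub] at this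

theorem surfaceMeasure_translate (hconv : Convex ℝ K) (hK : IsCompact K) {p : En (m + 1)}
    (hp : p ∈ interior K) {ω : Set (Sph (m + 1))} (hω : MeasurableSet ω) :
    surfaceMeasure ((· + p) ⁻¹' K) ω = μH[(m : ℝ)] (reverseSphericalImage K ω) := by
  rw [(isBody_translate hconv hK hp).surfaceMeasure_eq_hausdorffMeasure hω]
  change μH[(m : ℝ)] (reverseSphericalImage ((· + p) ⁻¹' K) ω) = _
  rw [reverseSphericalImage_translate]
  exact (IsometryEquiv.addRight p).hausdorffMeasure_preimage _ _

theorem IsBody.volume_toReal_eq (hK : IsBody K) [IsFiniteMeasure (surfaceMeasure K)] :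
    (volume K).toReal =
      (∫ u : Sph (m + 1), supportFn K u ∂surfaceMeasure K) * (hausdorffConst m / (m + 1)) := by
  have h := congrArg (fun ν ↦ ν Set.univ) hK.coneMeasure_eq
  have hc := continuous_supportFn hK.isCompact hK.nonempty
  have h0 : ∀ u : Sph (m + 1), 0 ≤ supportFn K u := fun u ↦
    (hK.supportFn_pos fun h ↦ by simpa [h] using norm_eq_of_mem_sphere u).le
  simp only [coneMeasure, withDensity_apply _ MeasurableSet.univ, coneDensity,
    Measure.restrict_univ] at h
  rw [Measure.map_apply (measurable_gaussMap K) .univ, Set.preimage_univ,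
    Measure.restrict_apply_univ, lintegral_mul_const' _ _ ENNReal.coe_ne_top,
    ← ofReal_integral_eq_lintegral_ofReal (integrable_of_continuous_sphere _ (by fun_prop))
      (ae_of_all _ fun u ↦ div_nonneg (h0 u) (by positivity)), integral_div] at h
  rw [h, ENNReal.toReal_mul, ENNReal.toReal_ofReal
    (div_nonneg (integral_nonneg h0) (by positivity)), ENNReal.coe_toReal]
  ring

theorem integral_inner_eq_zero_of_eq_surfaceMeasure (hconv : Convex ℝ K) (hK : IsCompact K)
    (hint : (interior K).Nonempty) (μ : Measure (Sph (m + 1))) [IsFiniteMeasure μ]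
    (hμ : ∀ ω, MeasurableSet ω → μ ω = μH[(m : ℝ)] (reverseSphericalImage K ω))
    (v : En (m + 1)) : ∫ u : Sph (m + 1), ⟪v, (u : En (m + 1))⟫_ℝ ∂μ = 0 := by
  have key : ∀ p ∈ interior K, (volume K).toReal = (∫ u : Sph (m + 1), supportFn K u ∂μ -
      ∫ u : Sph (m + 1), ⟪p, (u : En (m + 1))⟫_ℝ ∂μ) * (hausdorffConst m / (m + 1)) := fun p hp ↦ by
    have hs : surfaceMeasure ((· + p) ⁻¹' K) = μ := Measure.ext fun ω hω ↦ by
      rw [surfaceMeasure_translate hconv hK hp hω, hμ ω hω]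
    have hne := hint.mono interior_subset
    have hc := continuous_supportFn hK hne
    have : IsFiniteMeasure (surfaceMeasure ((· + p) ⁻¹' K)) := hs ▸ inferInstance
    have h := (isBody_translate hconv hK hp).volume_toReal_eq
    rw [hs, measure_preimage_add_right] at h
    simp_rw [supportFn_translate hK hne] at h
    rw [h, integral_sub (integrable_of_continuous_sphere _ (by fun_prop))
      (integrable_of_continuous_sphere _ (by fun_prop))]
  obtain ⟨p, hp⟩ := hint
  have hcont : Continuous fun t : ℝ ↦ p + t • v := by fun_prop
  have hev : ∀ᶠ t in 𝓝 (0 : ℝ), p + t • v ∈ interior K :=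
    hcont.continuousAt.eventually (isOpen_interior.mem_nhds (by simpa using hp))
  obtain ⟨t, ht, ht0⟩ := ((hev.filter_mono nhdsWithin_le_nhds).and self_mem_nhdsWithin :
    ∀ᶠ t in 𝓝[≠] (0 : ℝ), p + t • v ∈ interior K ∧ t ∈ ({0}ᶜ : Set ℝ)).exists
  have h := (key p hp).symm.trans (key _ ht)
  have hcpos : (0 : ℝ) < hausdorffConst m / (m + 1) := by
    have : (0 : ℝ) < hausdorffConst m :=
      NNReal.coe_pos.2 (pos_iff_ne_zero.2 (hausdorffConst_ne_zero m))
    positivity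
  have h2 := mul_right_cancel₀ hcpos.ne' h
  simp_rw [inner_add_left, real_inner_smul_left] at h2
  rw [integral_add (integrable_of_continuous_sphere _ (by fun_prop))
    (integrable_of_continuous_sphere _ (by fun_prop)), integral_const_mul] at h2
  have h3 : t * ∫ u : Sph (m + 1), ⟪v, (u : En (m + 1))⟫_ℝ ∂μ = 0 := by linarith
  exact (mul_eq_zero.1 h3).resolve_left ht0

theorem IsBody.integral_inner_sq_pos (hK : IsBody K) [IsFiniteMeasure (surfaceMeasure K)]
    {v : En (m + 1)} (hv : v ≠ 0) :
    0 < ∫ u : Sph (m + 1), ⟪v, (u : En (m + 1))⟫_ℝ ^ 2 ∂surfaceMeasure K := by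
  rw [integral_pos_iff_support_of_nonneg (fun u ↦ sq_nonneg _)
    (integrable_of_continuous_sphere _ (.pow (by fun_prop) 2)), pos_iff_ne_zero]
  intro h0
  set ω : Set (Sph (m + 1)) := Function.support fun u ↦ (⟪v, (u : En (m + 1))⟫_ℝ : ℝ) ^ 2 with hω
  have hωm : MeasurableSet ω := by
    have : Continuous fun u : Sph (m + 1) ↦ (⟪v, (u : En (m + 1))⟫_ℝ : ℝ) ^ 2 := by fun_prop
    exact this.isOpen_support.measurableSet
  have hcone : coneMeasure K ω = 0 := by
    rw [hK.coneMeasure_eq]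
    exact withDensity_absolutelyContinuous _ _ h0
  rw [hK.coneMeasure_apply hωm] at hcone
  obtain ⟨r, hr, hrK⟩ := hK.exists_ball_subset
  have hr' : (0 : ℝ) < r := hr
  have hg := hK.continuous_gauge
  set U : Set (En (m + 1)) := {x | ‖v - x‖ < r * gauge K x} with hU
  have hUo : IsOpen U := isOpen_lt (by fun_prop) (by fun_prop)
  have hvU : v ∈ U := by
    have := hK.gauge_pos_iff.2 hv
    simp only [hU, Set.mem_ofPred_eq, sub_self, norm_zero]
    positivity
  have hUcone : ∀ x ∈ regularSet K, x ∈ U → gaussMap K x ∈ ω := fun x hx hxU ↦ by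
    have h1 := hK.inner_gaussMap hx
    have hn : ‖(gaussMap K x : En (m + 1))‖ = 1 := norm_eq_of_mem_sphere _
    have h2 := hK.mul_norm_le_supportFn hr' hrK (gaussMap K x : En (m + 1))
    rw [hn, mul_one] at h2
    have h3 := mul_le_mul_of_nonneg_left h2 (gauge_nonneg (s := K) x)
    have h4 := abs_real_inner_le_norm (v - x) (gaussMap K x : En (m + 1))
    rw [hn, mul_one, inner_sub_left] at h4
    have h5 := (abs_le.1 h4).1
    have h6 : ‖v - x‖ < r * gauge K x := hxU
    have : 0 < ⟪v, (gaussMap K x : En (m + 1))⟫_ℝ := by nlinarith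
    simp only [hω, Function.mem_support]
    positivity
  obtain ⟨t, ht, htK⟩ : ∃ t : ℝ, 0 < t ∧ t • v ∈ interior K := by
    have hcont : Continuous fun t : ℝ ↦ t • v := by fun_prop
    have hev : ∀ᶠ t in 𝓝 (0 : ℝ), t • v ∈ interior K :=
      hcont.continuousAt.eventually (isOpen_interior.mem_nhds (by simpa using hK.zero_mem))
    obtain ⟨t, h1, h2⟩ := ((hev.filter_mono nhdsWithin_le_nhds).and self_mem_nhdsWithin :
      ∀ᶠ t in 𝓝[>] (0 : ℝ), t • v ∈ interior K ∧ t ∈ Set.Ioi (0 : ℝ)).exists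
    exact ⟨t, h2, h1⟩
  have hopen : IsOpen ((t⁻¹ • · : En (m + 1) → En (m + 1)) ⁻¹' U ∩ interior K) :=
    (hUo.preimage (by fun_prop)).inter isOpen_interior
  have hpos : 0 < volume ((t⁻¹ • · : En (m + 1) → En (m + 1)) ⁻¹' U ∩ interior K) :=
    hopen.measure_pos _ ⟨t • v, by simpa [inv_smul_smul₀ ht.ne'] using hvU, htK⟩
  refine hpos.ne' (measure_mono_null (fun x hx ↦ ?_ : _ ⊆
    ((regularSet K ∩ gaussMap K ⁻¹' ω) ∩ K) ∪ (regularSet K)ᶜ) (measure_union_null hcone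
      (ae_iff.1 hK.ae_mem_regularSet)))
  by_cases hxr : x ∈ regularSet K
  · refine Or.inl ⟨⟨hxr, ?_⟩, interior_subset hx.2⟩
    have := hUcone _ (smul_mem_regularSet hxr (inv_pos.2 ht)) hx.1
    rwa [hK.gaussMap_smul hxr (inv_pos.2 ht)] at this
  · exact Or.inr hxr

end translate

section wulff

variable {n : ℕ} {f g : Sph n → ℝ}

/-- The Wulff shape of a function on the sphere. -/
def wulffShape (f : Sph n → ℝ) : Set (En n) := {x | ∀ u : Sph n, ⟪x, (u : En n)⟫_ℝ ≤ f u}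

theorem convex_wulffShape (f : Sph n → ℝ) : Convex ℝ (wulffShape f) := by
  intro x hx y hy a b ha hb hab u
  have h1 := mul_le_mul_of_nonneg_left (hx u) ha
  have h2 := mul_le_mul_of_nonneg_left (hy u) hb
  rw [inner_add_left, real_inner_smul_left, real_inner_smul_left]
  calc _ ≤ a * f u + b * f u := add_le_add h1 h2
    _ = f u := by rw [← add_mul, hab, one_mul]

theorem isClosed_wulffShape (f : Sph n → ℝ) : IsClosed (wulffShape f) := by
  have : wulffShape f = ⋂ u : Sph n, {x | ⟪x, (u : En n)⟫_ℝ ≤ f u} := by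
    ext x
    simp [wulffShape]
  rw [this]
  exact isClosed_iInter fun u ↦ isClosed_le (by fun_prop) continuous_const

theorem wulffShape_subset_closedBall {C : ℝ} (hC : 0 ≤ C) (hf : ∀ u, f u ≤ C) :
    wulffShape f ⊆ closedBall 0 C := fun x hx ↦ by
  rw [mem_closedBall_zero_iff]
  rcases eq_or_ne x 0 with rfl | hx0
  · simpa using hC
  have hn : ‖x‖ ≠ 0 := norm_ne_zero_iff.2 hx0
  have h := (hx ⟨‖x‖⁻¹ • x, by simp [norm_smul, hn]⟩).trans (hf _)
  rwa [real_inner_smul_right, real_inner_self_eq_norm_sq, sq, inv_mul_cancel_left₀ hn] at h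

theorem isCompact_wulffShape (hf : Continuous f) : IsCompact (wulffShape f) := by
  obtain ⟨C, hC⟩ := (isCompact_range hf).bddAbove
  exact (isCompact_closedBall (0 : En n) (max C 0)).of_isClosed_subset (isClosed_wulffShape f)
    (wulffShape_subset_closedBall (le_max_right _ _) fun u ↦
      (hC (Set.mem_range_self u)).trans (le_max_left _ _))

theorem wulffShape_mono (h : ∀ u, f u ≤ g u) : wulffShape f ⊆ wulffShape g :=
  fun _ hx u ↦ (hx u).trans (h u)

theorem isBody_wulffShape (hf : Continuous f) (hpos : ∀ u, 0 < f u) : IsBody (wulffShape f) where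
  convex := convex_wulffShape f
  isCompact := isCompact_wulffShape hf
  zero_mem := by
    obtain ⟨r, hr, hrf⟩ : ∃ r > 0, ∀ u, r ≤ f u := by
      rcases isEmpty_or_nonempty (Sph n) with h | h
      · exact ⟨1, one_pos, fun u ↦ h.elim u⟩
      · obtain ⟨u, -, hu⟩ := isCompact_univ.exists_isMinOn Set.univ_nonempty hf.continuousOn
        exact ⟨f u, hpos u, fun v ↦ hu (Set.mem_univ v)⟩
    refine mem_interior_iff_mem_nhds.2 (mem_of_superset (ball_mem_nhds 0 hr) fun x hx u ↦ ?_)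
    refine (real_inner_le_norm _ _).trans ?_
    rw [norm_eq_of_mem_sphere, mul_one]
    exact (mem_ball_zero_iff.1 hx).le.trans (hrf u)

theorem subset_wulffShape_supportFn {L : Set (En n)} (hL : IsCompact L) :
    L ⊆ wulffShape fun u ↦ supportFn L u := fun _ hx _ ↦ inner_le_supportFn hL hx

theorem supportFn_wulffShape_le (hne : (wulffShape f).Nonempty) (u : Sph n) :
    supportFn (wulffShape f) u ≤ f u := supportFn_le hne fun _ hx ↦ hx u

theorem IsBody.wulffShape_supportFn {K : Set (En n)} (hK : IsBody K) :
    wulffShape (fun u ↦ supportFn K u) = K := by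
  refine (subset_wulffShape_supportFn hK.isCompact).antisymm' fun x hx ↦ ?_
  rcases eq_or_ne x 0 with rfl | hx0
  · exact interior_subset hK.zero_mem
  obtain ⟨u, hu⟩ := hK.exists_inner_eq hx0
  have h := hx u
  have hu0 : (u : En n) ≠ 0 := fun h ↦ by simpa [h] using norm_eq_of_mem_sphere u
  rw [hu, mul_le_iff_le_one_left (hK.supportFn_pos hu0)] at h
  exact hK.gauge_le_one_iff.1 h

theorem volume_wulffShape_lt {f : Sph n → ℝ} (hf : Continuous f) {c : ℝ≥0∞}
    (hc : volume (wulffShape f) < c) :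
    ∃ ε > 0, ∀ g : Sph n → ℝ, (∀ u, g u ≤ f u + ε) → volume (wulffShape g) < c := by
  have h : Tendsto (volume ∘ fun ε : ℝ ↦ wulffShape fun u ↦ f u + ε) (𝓝[>] 0)
      (𝓝 (volume (⋂ ε > (0 : ℝ), wulffShape fun u ↦ f u + ε))) := by
    refine tendsto_measure_biInter_gt
      (fun r _ ↦ (isClosed_wulffShape _).measurableSet.nullMeasurableSet)
      (fun i j _ hij ↦ wulffShape_mono fun u ↦ by gcongr) ⟨1, one_pos, ?_⟩
    exact (isCompact_wulffShape (by fun_prop)).measure_lt_top.ne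
  have heq : ⋂ ε > (0 : ℝ), wulffShape (fun u ↦ f u + ε) = wulffShape f := by
    ext x
    simp only [Set.mem_iInter]
    exact ⟨fun H u ↦ le_of_forall_pos_le_add fun ε hε ↦ H ε hε u,
      fun H ε hε u ↦ (H u).trans (by linarith)⟩
  rw [heq] at h
  obtain ⟨ε, h1, h2⟩ := ((h.eventually (gt_mem_nhds hc)).and self_mem_nhdsWithin).exists
  exact ⟨ε, h2, fun g hg ↦ (measure_mono (wulffShape_mono hg)).trans_lt h1⟩

end wulff

section maximizer

theorem continuous_integral_boundedContinuousFunction {X : Type*} [TopologicalSpace X]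
    [MeasurableSpace X] [OpensMeasurableSpace X] (μ : Measure X) [IsFiniteMeasure μ] :
    Continuous fun f : BoundedContinuousFunction X ℝ ↦ ∫ x, f x ∂μ := by
  refine (LipschitzWith.of_dist_le_mul (K := (μ.real Set.univ).toNNReal) fun f g ↦ ?_).continuous
  rw [dist_eq_norm, dist_eq_norm, Real.coe_toNNReal _ measureReal_nonneg,
    ← integral_sub (f.integrable μ) (g.integrable μ)]
  exact (f - g).norm_integral_le_mul_norm μ

variable {n : ℕ} (μ : Measure (Sph n)) [IsFiniteMeasure μ]

theorem exists_radius [Nonempty (Sph n)] (h1 : ∀ v : En n, ∫ u : Sph n, ⟪v, (u : En n)⟫_ℝ ∂μ = 0)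
    (h2 : ∀ v : En n, v ≠ 0 → 0 < ∫ u : Sph n, ⟪v, (u : En n)⟫_ℝ ^ 2 ∂μ) :
    ∃ R > 0, ∀ L : Set (En n), IsCompact L → 0 ∈ L → ∫ u : Sph n, supportFn L u ∂μ ≤ 1 →
      L ⊆ closedBall 0 R := by
  have hcont : Continuous fun v : Sph n ↦ ∫ u : Sph n, ⟪(v : En n), (u : En n)⟫_ℝ ^ 2 ∂μ := by
    have := continuous_parametric_integral_of_continuous (μ := μ)
      (f := fun (v : Sph n) (u : Sph n) ↦ (⟪(v : En n), (u : En n)⟫_ℝ : ℝ) ^ 2)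
      (by unfold Function.uncurry; fun_prop) isCompact_univ
    simpa using this
  obtain ⟨v₀, -, hv₀⟩ := isCompact_univ.exists_isMinOn Set.univ_nonempty hcont.continuousOn
  set c := ∫ u : Sph n, ⟪(v₀ : En n), (u : En n)⟫_ℝ ^ 2 ∂μ with hc
  have hcpos : 0 < c := h2 _ fun h ↦ by simpa [h] using norm_eq_of_mem_sphere v₀
  refine ⟨2 / c, by positivity, fun L hL h0 hLint x hx ↦ ?_⟩
  rw [mem_closedBall_zero_iff]
  rcases eq_or_ne x 0 with rfl | hx0
  · rw [norm_zero]
    positivity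
  have hn : 0 < ‖x‖ := norm_pos_iff.2 hx0
  have hlow : c * ‖x‖ ^ 2 ≤ ∫ u : Sph n, ⟪x, (u : En n)⟫_ℝ ^ 2 ∂μ := by
    have h := hv₀ (Set.mem_univ (⟨‖x‖⁻¹ • x, by simp [norm_smul, hn.ne']⟩ : Sph n))
    simp only [Set.mem_ofPred_eq, real_inner_smul_left, mul_pow, integral_const_mul] at h
    rw [← hc, inv_pow, ← div_eq_inv_mul, le_div_iff₀ (by positivity)] at h
    exact h
  have hcs := continuous_supportFn hL ⟨x, hx⟩
  have hup : ∫ u : Sph n, ⟪x, (u : En n)⟫_ℝ ^ 2 ∂μ ≤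
      ∫ u : Sph n, ‖x‖ * (2 * supportFn L u - ⟪x, (u : En n)⟫_ℝ) ∂μ := by
    refine integral_mono (integrable_of_continuous_sphere _ (.pow (by fun_prop) 2))
      (integrable_of_continuous_sphere _ (by fun_prop)) fun u ↦ ?_
    have e1 := abs_real_inner_le_norm x (u : En n)
    rw [norm_eq_of_mem_sphere, mul_one] at e1
    have e2 := inner_le_supportFn (u := (u : En n)) hL hx
    have e3 : 0 ≤ supportFn L u := by simpa using inner_le_supportFn (u := (u : En n)) hL h0
    have e4 : |⟪x, (u : En n)⟫_ℝ| ≤ 2 * supportFn L u - ⟪x, (u : En n)⟫_ℝ := by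
      rw [abs_le]
      constructor <;> linarith
    calc ⟪x, (u : En n)⟫_ℝ ^ 2 = |⟪x, (u : En n)⟫_ℝ| * |⟪x, (u : En n)⟫_ℝ| := by
          rw [← sq, sq_abs]
      _ ≤ _ := by gcongr
  rw [integral_const_mul, integral_sub (integrable_of_continuous_sphere _ (by fun_prop))
    (integrable_of_continuous_sphere _ (by fun_prop)), h1 x, integral_const_mul] at hup
  rw [le_div_iff₀ hcpos]
  have h3 : ‖x‖ * (c * ‖x‖) ≤ ‖x‖ * 2 := by nlinarith
  have := le_of_mul_le_mul_left h3 hn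
  linarith

theorem exists_volume_maximizer [Nonempty (Sph n)]
    (h1 : ∀ v : En n, ∫ u : Sph n, ⟪v, (u : En n)⟫_ℝ ∂μ = 0)
    (h2 : ∀ v : En n, v ≠ 0 → 0 < ∫ u : Sph n, ⟪v, (u : En n)⟫_ℝ ^ 2 ∂μ) :
    ∃ K : Set (En n), Convex ℝ K ∧ IsCompact K ∧ K.Nonempty ∧ ∫ u : Sph n, supportFn K u ∂μ ≤ 1 ∧
      ∀ L : Set (En n), IsCompact L → L.Nonempty → ∫ u : Sph n, supportFn L u ∂μ ≤ 1 →
        volume L ≤ volume K := by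
  obtain ⟨R, hR, hRL⟩ := exists_radius μ h1 h2
  set A : Set (BoundedContinuousFunction (Sph n) ℝ) := {f | LipschitzWith R.toNNReal f ∧
    (∀ u, f u ∈ Set.Icc 0 R) ∧ ∫ u, f u ∂μ ≤ 1} with hA
  have hAclosed : IsClosed A := by
    have e1 : IsClosed {f : BoundedContinuousFunction (Sph n) ℝ | LipschitzWith R.toNNReal f} := by
      have : {f : BoundedContinuousFunction (Sph n) ℝ | LipschitzWith R.toNNReal f} =
          ⋂ u, ⋂ v, {f | dist (f u) (f v) ≤ R.toNNReal * dist u v} := by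
        ext f
        simp [lipschitzWith_iff_dist_le_mul]
      rw [this]
      exact isClosed_iInter fun u ↦ isClosed_iInter fun v ↦ isClosed_le
        ((continuous_eval_const u).dist (continuous_eval_const v)) continuous_const
    have e2 : IsClosed {f : BoundedContinuousFunction (Sph n) ℝ | ∀ u, f u ∈ Set.Icc 0 R} := by
      simp only [Set.ofPred_forall]
      exact isClosed_iInter fun u ↦ isClosed_Icc.preimage (continuous_eval_const u)
    have e3 : IsClosed {f : BoundedContinuousFunction (Sph n) ℝ | ∫ u, f u ∂μ ≤ 1} :=
      isClosed_le (continuous_integral_boundedContinuousFunction μ) continuous_const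
    exact e1.inter (e2.inter e3)
  have hAcomp : IsCompact A := by
    refine BoundedContinuousFunction.arzela_ascoli₂ (Set.Icc 0 R) isCompact_Icc A hAclosed
      (fun f u hf ↦ hf.2.1 u) ?_
    exact (LipschitzWith.uniformEquicontinuous _ R.toNNReal fun f ↦ f.2.1).equicontinuous
  have hAne : A.Nonempty := ⟨0, LipschitzWith.const' (0 : ℝ), by simp [hR.le], by simp⟩
  have husc : UpperSemicontinuousOn
      (fun f : BoundedContinuousFunction (Sph n) ℝ ↦ volume (wulffShape f)) A := by
    intro f hf c hc
    obtain ⟨ε, hε, h⟩ := volume_wulffShape_lt f.continuous hc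
    refine nhdsWithin_le_nhds ?_
    filter_upwards [Metric.ball_mem_nhds f hε] with g hg
    refine h g fun u ↦ ?_
    have := (BoundedContinuousFunction.dist_coe_le_dist (f := g) (g := f) u).trans_lt hg
    rw [Real.dist_eq] at this
    linarith [(abs_lt.1 this).2]
  obtain ⟨f, hfA, hmax⟩ := husc.exists_isMaxOn hAne hAcomp
  have hne : (wulffShape f).Nonempty := ⟨0, fun u ↦ by simpa using (hfA.2.1 u).1⟩
  have hcomp := isCompact_wulffShape f.continuous
  refine ⟨wulffShape f, convex_wulffShape f, hcomp, hne, ?_, fun L hL hLne hLint ↦ ?_⟩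
  · have := continuous_supportFn hcomp hne
    exact (integral_mono (integrable_of_continuous_sphere _ (by fun_prop))
      (f.integrable μ) fun u ↦ supportFn_wulffShape_le hne u).trans hfA.2.2
  · obtain ⟨p, hp⟩ := hLne
    set L' := (· + p) ⁻¹' L with hL'
    have hL'c : IsCompact L' := (Homeomorph.addRight p).isCompact_preimage.2 hL
    have h0 : (0 : En n) ∈ L' := by simpa [hL'] using hp
    have hcs := continuous_supportFn hL ⟨p, hp⟩
    have hcs' := continuous_supportFn hL'c ⟨0, h0⟩
    have hint : ∫ u : Sph n, supportFn L' u ∂μ ≤ 1 := by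
      simp_rw [hL', supportFn_translate hL ⟨p, hp⟩]
      rwa [integral_sub (integrable_of_continuous_sphere _ (by fun_prop))
        (integrable_of_continuous_sphere _ (by fun_prop)), h1, sub_zero]
    have hball := hRL L' hL'c h0 hint
    set g : BoundedContinuousFunction (Sph n) ℝ := BoundedContinuousFunction.mkOfCompact
      ⟨fun u ↦ supportFn L' u, by fun_prop⟩ with hg
    have hgA : g ∈ A := by
      refine ⟨LipschitzWith.of_dist_le_mul fun u v ↦ ?_, fun u ↦ ⟨?_, ?_⟩, hint⟩
      · rw [Real.dist_eq, Subtype.dist_eq, dist_eq_norm, Real.coe_toNNReal _ hR.le]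
        exact abs_supportFn_sub_le hL'c ⟨0, h0⟩ hball u v
      · have := inner_le_supportFn (u := (u : En n)) hL'c h0
        rwa [inner_zero_left] at this
      · refine supportFn_le ⟨0, h0⟩ fun x hx ↦ (real_inner_le_norm _ _).trans ?_
        rw [norm_eq_of_mem_sphere, mul_one]
        exact mem_closedBall_zero_iff.1 (hball hx)
    calc volume L = volume L' := (measure_preimage_add_right _ _ _).symm
      _ ≤ volume (wulffShape g) := measure_mono (subset_wulffShape_supportFn hL'c)
      _ ≤ volume (wulffShape f) := hmax hgA

theorem exists_body_maximizer [Nonempty (Sph n)]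
    (h1 : ∀ v : En n, ∫ u : Sph n, ⟪v, (u : En n)⟫_ℝ ∂μ = 0)
    (h2 : ∀ v : En n, v ≠ 0 → 0 < ∫ u : Sph n, ⟪v, (u : En n)⟫_ℝ ^ 2 ∂μ) :
    ∃ K : Set (En n), IsBody K ∧ ∫ u : Sph n, supportFn K u ∂μ ≤ 1 ∧
      ∀ L : Set (En n), IsCompact L → L.Nonempty → ∫ u : Sph n, supportFn L u ∂μ ≤ 1 →
        volume L ≤ volume K := by
  obtain ⟨K, hconv, hcomp, hne, hint, hmax⟩ := exists_volume_maximizer μ h1 h2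
  have hpos : 0 < volume K := by
    set ε : ℝ := (1 + μ.real Set.univ)⁻¹ with hε
    have hμ : 0 ≤ μ.real Set.univ := measureReal_nonneg
    have hε0 : 0 < ε := by positivity
    refine (measure_closedBall_pos volume (0 : En n) hε0).trans_le
      (hmax _ (isCompact_closedBall _ _) ⟨0, by simp [hε0.le]⟩ ?_)
    have hne' : (closedBall (0 : En n) ε).Nonempty := ⟨0, by simp [hε0.le]⟩
    have hcs := continuous_supportFn (isCompact_closedBall (0 : En n) ε) hne'
    calc ∫ u : Sph n, supportFn (closedBall (0 : En n) ε) u ∂μ ≤ ∫ _u : Sph n, ε ∂μ := by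
          refine integral_mono (integrable_of_continuous_sphere _ (by fun_prop))
            (integrable_const _) fun u ↦ supportFn_le hne' fun x hx ↦
              (real_inner_le_norm _ _).trans ?_
          rw [norm_eq_of_mem_sphere, mul_one]
          exact mem_closedBall_zero_iff.1 hx
      _ ≤ 1 := by
          rw [integral_const, smul_eq_mul, hε, ← div_eq_mul_inv, div_le_one (by positivity)]
          linarith
  have hintr : (interior K).Nonempty := by
    rw [Set.nonempty_iff_ne_empty]
    intro h
    have : frontier K = K := by rw [hcomp.isClosed.frontier_eq, h, Set.sdiff_empty]
    have h0 := hconv.addHaar_frontier volume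
    rw [this] at h0
    exact hpos.ne' h0
  obtain ⟨p, hp⟩ := hintr
  refine ⟨(· + p) ⁻¹' K, isBody_translate hconv hcomp hp, ?_, fun L hL hLne hLint ↦ ?_⟩
  · have hcs := continuous_supportFn hcomp hne
    simp_rw [supportFn_translate hcomp hne]
    rwa [integral_sub (integrable_of_continuous_sphere _ (by fun_prop))
      (integrable_of_continuous_sphere _ (by fun_prop)), h1, sub_zero]
  · rw [measure_preimage_add_right]
    exact hmax L hL hLne hLint

end maximizer

section gaugeWulff

variable {n : ℕ} {f g : Sph n → ℝ}

theorem inner_le_gauge_wulffShape (hf : Continuous f) (hpos : ∀ u, 0 < f u) (x : En n)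
    (u : Sph n) : ⟪x, (u : En n)⟫_ℝ ≤ gauge (wulffShape f) x * f u := by
  have h := isBody_wulffShape hf hpos
  exact (h.inner_le_gauge_mul x u).trans
    (mul_le_mul_of_nonneg_left (supportFn_wulffShape_le h.nonempty u) (gauge_nonneg x))

theorem exists_inner_eq_gauge_wulffShape (hf : Continuous f) (hpos : ∀ u, 0 < f u) {x : En n}
    (hx : x ≠ 0) : ∃ u : Sph n, ⟪x, (u : En n)⟫_ℝ = gauge (wulffShape f) x * f u := by
  have hn : 0 < ‖x‖ := norm_pos_iff.2 hx
  set v : Sph n := ⟨‖x‖⁻¹ • x, by simp [norm_smul, hn.ne']⟩ with hv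
  have hcont : Continuous fun u : Sph n ↦ ⟪x, (u : En n)⟫_ℝ / f u :=
    Continuous.div (by fun_prop) hf fun u ↦ (hpos u).ne'
  obtain ⟨u, -, hu⟩ := isCompact_univ.exists_isMaxOn ⟨v, Set.mem_univ v⟩ hcont.continuousOn
  refine ⟨u, le_antisymm (inner_le_gauge_wulffShape hf hpos x u) ?_⟩
  rw [← le_div_iff₀ (hpos u)]
  set s := ⟪x, (u : En n)⟫_ℝ / f u with hs
  have hle : ∀ w : Sph n, ⟪x, (w : En n)⟫_ℝ / f w ≤ s := fun w ↦ hu (Set.mem_univ w)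
  have hspos : 0 < s := by
    refine lt_of_lt_of_le (div_pos ?_ (hpos v)) (hle v)
    rw [hv, real_inner_smul_right, real_inner_self_eq_norm_sq]
    positivity
  refine gauge_le_of_mem hspos.le (Set.mem_smul_set.2 ⟨s⁻¹ • x, fun w ↦ ?_, ?_⟩)
  · rw [real_inner_smul_left, ← div_eq_inv_mul, div_le_comm₀ hspos (hpos w)]
    exact hle w
  · rw [smul_inv_smul₀ hspos.ne']

theorem log_gauge_wulffShape_le (hf : Continuous f) (hfpos : ∀ u, 0 < f u) (hg : Continuous g)
    (hgpos : ∀ u, 0 < g u) {c : ℝ} (h : ∀ u, f u ≤ exp c * g u) {x : En n} (hx : x ≠ 0) :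
    log (gauge (wulffShape g) x) ≤ log (gauge (wulffShape f) x) + c := by
  obtain ⟨u, hu⟩ := exists_inner_eq_gauge_wulffShape hg hgpos hx
  have h1 := inner_le_gauge_wulffShape hf hfpos x u
  have hf0 := (isBody_wulffShape hf hfpos).gauge_pos_iff.2 hx
  have hg0 := (isBody_wulffShape hg hgpos).gauge_pos_iff.2 hx
  rw [hu] at h1
  have h2 : gauge (wulffShape g) x * g u ≤ gauge (wulffShape f) x * exp c * g u :=
    h1.trans (by rw [mul_assoc]; exact mul_le_mul_of_nonneg_left (h u) hf0.le)
  have h3 := log_le_log hg0 (le_of_mul_le_mul_right h2 (hgpos u))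
  rwa [log_mul hf0.ne' (exp_pos c).ne', log_exp] at h3

end gaugeWulff

namespace IsBody

variable {m : ℕ} {K : Set (En (m + 1))}

theorem neg_log_gauge_nonneg (K : Set (En (m + 1))) :
    0 ≤ᵐ[volume] fun x ↦ max (-log (gauge K x)) 0 :=
  ae_of_all _ fun _ ↦ le_max_right _ _

theorem lintegral_neg_log_gauge (hK : IsBody K) :
    ∫⁻ x, ENNReal.ofReal (max (-log (gauge K x)) 0) = ENNReal.ofReal (1 / (m + 1)) * volume K := by
  have hmeas : Measurable fun x ↦ max (-log (gauge K x)) 0 :=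
    (measurable_log.comp hK.continuous_gauge.measurable).neg.max measurable_const
  rw [lintegral_eq_lintegral_meas_le _ (neg_log_gauge_nonneg K) hmeas.aemeasurable]
  have hset : ∀ t ∈ Set.Ioi (0 : ℝ), volume {x | t ≤ max (-log (gauge K x)) 0} =
      ENNReal.ofReal (exp (-(m + 1 : ℝ) * t)) * volume K := fun t ht ↦ by
    have h1 : volume {x | t ≤ max (-log (gauge K x)) 0} = volume (exp (-t) • K) := by
      refine measure_congr ?_
      filter_upwards [compl_mem_ae_iff.2 (measure_singleton (0 : En (m + 1)))] with x hx
      have hg := hK.gauge_pos_iff.2 hx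
      apply propext
      change t ≤ max (-log (gauge K x)) 0 ↔ x ∈ exp (-t) • K
      rw [Set.mem_smul_set_iff_inv_smul_mem₀ (exp_pos _).ne', ← hK.gauge_le_one_iff,
        gauge_smul_of_nonneg (inv_nonneg.2 (exp_pos _).le), smul_eq_mul, ← div_eq_inv_mul,
        div_le_one (exp_pos _), ← log_le_iff_le_exp hg, le_max_iff]
      have : ¬ t ≤ 0 := not_le.2 ht
      simp only [this, or_false]
      exact le_neg
    rw [h1, Measure.addHaar_smul, finrank_euclideanSpace_fin, abs_of_pos (by positivity),
      ← exp_nat_mul]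
    congr 3
    push_cast
    ring
  rw [setLIntegral_congr_fun measurableSet_Ioi hset, lintegral_mul_const _ (by fun_prop)]
  congr 1
  have hneg : -(m + 1 : ℝ) < 0 := by linarith [m.cast_nonneg (α := ℝ)]
  rw [← ofReal_integral_eq_lintegral_ofReal (integrableOn_exp_mul_Ioi hneg 0)
    (ae_of_all _ fun t ↦ (exp_pos _).le), integral_exp_mul_Ioi hneg, mul_zero, exp_zero,
    neg_div_neg_eq]

theorem integrable_neg_log_gauge (hK : IsBody K) :
    Integrable fun x ↦ max (-log (gauge K x)) 0 := by
  refine ⟨((measurable_log.comp hK.continuous_gauge.measurable).neg.max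
    measurable_const).aestronglyMeasurable, ?_⟩
  rw [hasFiniteIntegral_iff_ofReal (neg_log_gauge_nonneg K),
    hK.lintegral_neg_log_gauge]
  exact ENNReal.mul_lt_top ENNReal.ofReal_lt_top hK.isCompact.measure_lt_top

theorem integral_neg_log_gauge (hK : IsBody K) :
    ∫ x, max (-log (gauge K x)) 0 = (volume K).toReal / (m + 1) := by
  rw [integral_eq_lintegral_of_nonneg_ae (neg_log_gauge_nonneg K)
    hK.integrable_neg_log_gauge.1, hK.lintegral_neg_log_gauge, ENNReal.toReal_mul,
    ENNReal.toReal_ofReal (by positivity)]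
  ring

end IsBody

section variation

variable {m : ℕ} {K : Set (En (m + 1))} {φ : Sph (m + 1) → ℝ} {C : ℝ}

/-- The support function of `K` multiplied by `exp (t * φ)`. -/
def expPerturb (K : Set (En (m + 1))) (φ : Sph (m + 1) → ℝ) (t : ℝ) (u : Sph (m + 1)) : ℝ :=
  supportFn K u * exp (t * φ u)

namespace IsBody

theorem supportFn_sphere_pos {n : ℕ} {K : Set (En n)} (hK : IsBody K) (u : Sph n) :
    0 < supportFn K u :=
  hK.supportFn_pos fun h ↦ by simpa [h] using norm_eq_of_mem_sphere u

theorem continuous_expPerturb (hK : IsBody K) (hφ : Continuous φ) (t : ℝ) :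
    Continuous (expPerturb K φ t) := by
  have := continuous_supportFn hK.isCompact hK.nonempty
  unfold expPerturb
  fun_prop

theorem expPerturb_pos (hK : IsBody K) (t : ℝ) (u : Sph (m + 1)) : 0 < expPerturb K φ t u :=
  mul_pos (hK.supportFn_sphere_pos u) (exp_pos _)

theorem isBody_wulffShape_expPerturb (hK : IsBody K) (hφ : Continuous φ) (t : ℝ) :
    IsBody (wulffShape (expPerturb K φ t)) :=
  isBody_wulffShape (hK.continuous_expPerturb hφ t) (hK.expPerturb_pos t)

theorem wulffShape_expPerturb_zero (hK : IsBody K) : wulffShape (expPerturb K φ 0) = K := by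
  convert hK.wulffShape_supportFn using 2
  funext u
  simp [expPerturb]

theorem abs_log_gauge_expPerturb_sub_le (hK : IsBody K) (hφ : Continuous φ) (hC : ∀ u, |φ u| ≤ C)
    {x : En (m + 1)} (hx : x ≠ 0) (s t : ℝ) :
    |log (gauge (wulffShape (expPerturb K φ s)) x) -
      log (gauge (wulffShape (expPerturb K φ t)) x)| ≤ C * |s - t| := by
  have key : ∀ s t, log (gauge (wulffShape (expPerturb K φ s)) x) ≤
      log (gauge (wulffShape (expPerturb K φ t)) x) + C * |s - t| := fun s t ↦ by
    refine log_gauge_wulffShape_le (hK.continuous_expPerturb hφ t) (hK.expPerturb_pos t)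
      (hK.continuous_expPerturb hφ s) (hK.expPerturb_pos s) (fun u ↦ ?_) hx
    have h : t * φ u ≤ C * |s - t| + s * φ u := by
      have h1 : (t - s) * φ u ≤ |t - s| * |φ u| := by
        rw [← abs_mul]
        exact le_abs_self _
      have h2 : |t - s| * |φ u| ≤ |t - s| * C := by gcongr; exact hC u
      rw [abs_sub_comm s t]
      linarith
    unfold expPerturb
    calc supportFn K u * exp (t * φ u) ≤ supportFn K u * exp (C * |s - t| + s * φ u) := by
          have := hK.supportFn_sphere_pos u
          gcongr
      _ = _ := by
          rw [exp_add]
          ring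
  rw [abs_le]
  constructor
  · have := key t s
    rw [abs_sub_comm] at this
    linarith
  · linarith [key s t]

theorem hasDerivAt_log_gauge_expPerturb (hK : IsBody K) (hφ : Continuous φ) {x : En (m + 1)}
    (hx : x ∈ regularSet K) :
    HasDerivAt (fun t ↦ log (gauge (wulffShape (expPerturb K φ t)) x))
      (-φ (gaussMap K x)) 0 := by
  have hx0 : x ≠ 0 := hx.1
  obtain ⟨C, hC⟩ : ∃ C, ∀ u, |φ u| ≤ C := by
    obtain ⟨C, hC⟩ := (isCompact_range hφ.abs).bddAbove
    exact ⟨C, fun u ↦ hC (Set.mem_range_self u)⟩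
  have hh := continuous_supportFn hK.isCompact hK.nonempty
  have hg := hK.gauge_pos_iff.2 hx0
  choose U hU using fun t ↦ exists_inner_eq_gauge_wulffShape (hK.continuous_expPerturb hφ t)
    (hK.expPerturb_pos (φ := φ) t) hx0
  have hgt : ∀ t, 0 < gauge (wulffShape (expPerturb K φ t)) x := fun t ↦
    (hK.isBody_wulffShape_expPerturb hφ t).gauge_pos_iff.2 hx0
  have hlow : ∀ t, log (gauge K x) - t * φ (gaussMap K x) ≤
      log (gauge (wulffShape (expPerturb K φ t)) x) := fun t ↦ by
    have h1 := inner_le_gauge_wulffShape (hK.continuous_expPerturb hφ t) (hK.expPerturb_pos t) x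
      (gaussMap K x)
    rw [hK.inner_gaussMap hx, expPerturb, mul_comm (supportFn K _) (exp _), ← mul_assoc] at h1
    have h2 := log_le_log hg (le_of_mul_le_mul_right h1 (hK.supportFn_sphere_pos _))
    rw [log_mul (hgt t).ne' (exp_pos _).ne', log_exp] at h2
    linarith
  have hup : ∀ t, log (gauge (wulffShape (expPerturb K φ t)) x) ≤
      log (gauge K x) - t * φ (U t) := fun t ↦ by
    have h1 := hK.inner_le_gauge_mul x (U t)
    rw [hU t, expPerturb, mul_comm (supportFn K _) (exp _), ← mul_assoc] at h1
    have h2 := log_le_log (mul_pos (hgt t) (exp_pos _))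
      (le_of_mul_le_mul_right h1 (hK.supportFn_sphere_pos _))
    rw [log_mul (hgt t).ne' (exp_pos _).ne', log_exp] at h2
    linarith
  have hUt : Tendsto U (𝓝 0) (𝓝 (gaussMap K x)) := by
    refine tendsto_nhds_of_unique_mapClusterPt fun u hu ↦ hK.eq_gaussMap hx ?_
    set ψ : Sph (m + 1) → ℝ := fun u ↦ ⟪x, (u : En (m + 1))⟫_ℝ - gauge K x * supportFn K u with hψ
    have hψc : Continuous ψ := by fun_prop
    obtain ⟨H, hH⟩ := (isCompact_range
      (by fun_prop : Continuous fun u : Sph (m + 1) ↦ supportFn K u)).bddAbove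
    have hlim : Tendsto (ψ ∘ U) (𝓝 0) (𝓝 0) := by
      have hb : Tendsto (fun t : ℝ ↦ gauge K x * (exp (-(2 * C * |t|)) - 1) * H) (𝓝 0) (𝓝 0) := by
        have : Continuous fun t : ℝ ↦ gauge K x * (exp (-(2 * C * |t|)) - 1) * H := by fun_prop
        simpa using this.tendsto 0
      refine tendsto_of_tendsto_of_tendsto_of_le_of_le hb tendsto_const_nhds (fun t ↦ ?_)
        fun t ↦ sub_nonpos.2 (hK.inner_le_gauge_mul x (U t))
      have hC0 : 0 ≤ C := (abs_nonneg _).trans (hC (U t))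
      have e1 : exp (-(2 * C * |t|)) - 1 ≤ 0 := by
        rw [sub_nonpos, exp_le_one_iff]
        have := abs_nonneg t
        nlinarith
      have e2 : gauge K x * exp (-(2 * C * |t|)) ≤
          gauge (wulffShape (expPerturb K φ t)) x * exp (t * φ (U t)) := by
        rw [← log_le_log_iff (by positivity) (mul_pos (hgt t) (exp_pos _)),
          log_mul hg.ne' (exp_pos _).ne', log_mul (hgt t).ne' (exp_pos _).ne', log_exp, log_exp]
        have b : ∀ u, |t * φ u| ≤ C * |t| := fun u ↦ by
          rw [abs_mul, mul_comm]
          gcongr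
          exact hC u
        have := hlow t
        have b1 := (abs_le.1 (b (gaussMap K x))).2
        have b2 := (abs_le.1 (b (U t))).1
        linarith
      have e3 := mul_le_mul_of_nonneg_right e2 (hK.supportFn_sphere_pos (U t)).le
      have e4 : supportFn K (U t) ≤ H := hH (Set.mem_range_self (U t))
      have e5 : ψ (U t) = gauge (wulffShape (expPerturb K φ t)) x * exp (t * φ (U t)) *
          supportFn K (U t) - gauge K x * supportFn K (U t) := by
        rw [hψ]
        simp only [hU t, expPerturb]
        ring
      change _ ≤ ψ (U t)
      calc gauge K x * (exp (-(2 * C * |t|)) - 1) * H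
          ≤ gauge K x * (exp (-(2 * C * |t|)) - 1) * supportFn K (U t) :=
            mul_le_mul_of_nonpos_left e4 (mul_nonpos_of_nonneg_of_nonpos hg.le e1)
        _ ≤ ψ (U t) := by
            rw [e5]
            linarith
    have hcl : ClusterPt (ψ u) (𝓝 (0 : ℝ)) :=
      ClusterPt.mono (hu.continuousAt_comp hψc.continuousAt) hlim
    have : ψ u = 0 := eq_of_nhds_neBot hcl
    exact sub_eq_zero.1 this
  rw [hasDerivAt_iff_isLittleO, Asymptotics.isLittleO_iff]
  intro c hc
  have hev := (hφ.tendsto _).comp hUt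
  filter_upwards [Metric.tendsto_nhds.1 hev c hc] with t ht
  simp only [Function.comp_apply, Real.dist_eq] at ht
  rw [hK.wulffShape_expPerturb_zero, Real.norm_eq_abs, Real.norm_eq_abs, sub_zero, smul_eq_mul]
  have h1 := hlow t
  have h2 := hup t
  have h3 : |t * (φ (U t) - φ (gaussMap K x))| ≤ c * |t| := by
    rw [abs_mul, mul_comm]
    gcongr
  have h4 := (abs_le.1 h3).1
  rw [abs_le]
  constructor
  · have : 0 ≤ c * |t| := by positivity
    linarith
  · linarith

end IsBody

end variation

section eulerLagrange

variable {m : ℕ} {K : Set (En (m + 1))} {φ : Sph (m + 1) → ℝ}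

theorem exists_abs_le_of_continuous {n : ℕ} {φ : Sph n → ℝ} (hφ : Continuous φ) :
    ∃ C, 0 ≤ C ∧ ∀ u, |φ u| ≤ C := by
  obtain ⟨C, hC⟩ := (isCompact_range hφ.abs).bddAbove
  exact ⟨max C 0, le_max_right _ _, fun u ↦ (hC (Set.mem_range_self u)).trans (le_max_left _ _)⟩

namespace IsBody

theorem hasDerivAt_volume_expPerturb (hK : IsBody K) (hφ : Continuous φ) :
    HasDerivAt (fun t ↦ (volume (wulffShape (expPerturb K φ t))).toReal / (m + 1))
      (∫ x in K, φ (gaussMap K x)) 0 := by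
  obtain ⟨C, hC0, hC⟩ := exists_abs_le_of_continuous hφ
  have hKm : MeasurableSet K := hK.isCompact.isClosed.measurableSet
  have hcompact : IsCompact (exp C • K) := hK.isCompact.smul _
  have hmeas : MeasurableSet (exp C • K) := hcompact.isClosed.measurableSet
  have hne0 : ∀ᵐ x : En (m + 1), x ≠ 0 :=
    compl_mem_ae_iff.2 (measure_singleton (0 : En (m + 1)))
  simp_rw [← (hK.isBody_wulffShape_expPerturb hφ _).integral_neg_log_gauge]
  rw [← integral_indicator hKm]
  refine (hasDerivAt_integral_of_dominated_loc_of_lip (s := Metric.closedBall 0 1)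
    (bound := (exp C • K).indicator fun _ ↦ C) (Metric.closedBall_mem_nhds 0 one_pos)
    (Eventually.of_forall fun t ↦
      (hK.isBody_wulffShape_expPerturb hφ t).integrable_neg_log_gauge.1)
    (hK.isBody_wulffShape_expPerturb hφ 0).integrable_neg_log_gauge ?_ ?_ ?_ ?_).2
  · exact ((hφ.measurable.comp (measurable_gaussMap K)).indicator hKm).aestronglyMeasurable
  · filter_upwards [hne0] with x hx
    refine LipschitzOnWith.of_dist_le_mul fun s hs t ht ↦ ?_
    rw [Real.dist_eq, Real.dist_eq, Real.coe_nnabs]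
    by_cases hxK : x ∈ exp C • K
    · rw [Set.indicator_of_mem hxK, abs_of_nonneg hC0]
      refine (abs_max_sub_max_le_abs _ _ _).trans ?_
      rw [neg_sub_neg, abs_sub_comm]
      exact hK.abs_log_gauge_expPerturb_sub_le hφ hC hx s t
    · have hzero : ∀ t ∈ Metric.closedBall (0 : ℝ) 1,
          max (-log (gauge (wulffShape (expPerturb K φ t)) x)) 0 = 0 := fun t ht ↦ by
        rw [max_eq_right_iff, neg_nonpos]
        have h1 := hK.abs_log_gauge_expPerturb_sub_le hφ hC hx t 0
        rw [hK.wulffShape_expPerturb_zero, sub_zero] at h1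
        have h2 : |t| ≤ 1 := by simpa using ht
        have h3 : C * |t| ≤ C := mul_le_of_le_one_right hC0 h2
        have h4 : C ≤ log (gauge K x) := by
          rw [le_log_iff_exp_le (hK.gauge_pos_iff.2 hx)]
          rw [Set.mem_smul_set_iff_inv_smul_mem₀ (exp_pos _).ne', ← hK.gauge_le_one_iff,
            gauge_smul_of_nonneg (inv_nonneg.2 (exp_pos _).le), smul_eq_mul, ← div_eq_inv_mul,
            div_le_one (exp_pos _)] at hxK
          exact (not_le.1 hxK).le
        linarith [(abs_le.1 h1).1]
      rw [hzero s hs, hzero t ht, sub_self, abs_zero]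
      positivity
  · exact (integrableOn_const hcompact.measure_lt_top.ne).integrable_indicator hmeas
  · filter_upwards [hK.ae_mem_regularSet, compl_mem_ae_iff.2 (hK.convex.addHaar_frontier volume)]
      with x hx hxf
    have hd := hK.hasDerivAt_log_gauge_expPerturb hφ hx
    have hg := hK.gauge_pos_iff.2 hx.1
    have hc := hd.continuousAt.tendsto
    rw [hK.wulffShape_expPerturb_zero] at hc
    by_cases hxK : x ∈ K
    · rw [Set.indicator_of_mem hxK]
      have hlt : log (gauge K x) < 0 := log_neg hg (lt_of_le_of_ne (hK.gauge_le_one_iff.2 hxK)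
        fun h ↦ hxf (hK.gauge_eq_one_iff.1 h))
      have h := hd.neg
      rw [neg_neg] at h
      refine h.congr_of_eventuallyEq ?_
      filter_upwards [hc.eventually (gt_mem_nhds hlt)] with t ht
      exact max_eq_left (by linarith)
    · rw [Set.indicator_of_notMem hxK]
      have hlt : 0 < log (gauge K x) := log_pos (not_le.1 fun h ↦ hxK (hK.gauge_le_one_iff.1 h))
      refine (hasDerivAt_const (0 : ℝ) (0 : ℝ)).congr_of_eventuallyEq ?_
      filter_upwards [hc.eventually (lt_mem_nhds hlt)] with t ht
      exact max_eq_right (by linarith)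

theorem hasDerivAt_integral_expPerturb (hK : IsBody K) (hφ : Continuous φ)
    (μ : Measure (Sph (m + 1))) [IsFiniteMeasure μ] :
    HasDerivAt (fun t ↦ ∫ u, expPerturb K φ t u ∂μ) (∫ u : Sph (m + 1), supportFn K u * φ u ∂μ)
      0 := by
  have hh := continuous_supportFn hK.isCompact hK.nonempty
  obtain ⟨C, hC0, hC⟩ := exists_abs_le_of_continuous hφ
  have h := (hasDerivAt_integral_of_dominated_loc_of_deriv_le (μ := μ)
    (s := Metric.closedBall (0 : ℝ) 1) (F := fun t u ↦ expPerturb K φ t u)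
    (F' := fun t u ↦ supportFn K u * (exp (t * φ u) * φ u))
    (bound := fun u ↦ supportFn K u * (exp C * C)) (Metric.closedBall_mem_nhds 0 one_pos)
    (Eventually.of_forall fun t ↦ (integrable_of_continuous_sphere μ
      (hK.continuous_expPerturb hφ t)).1)
    (integrable_of_continuous_sphere μ (hK.continuous_expPerturb hφ 0))
    (integrable_of_continuous_sphere μ (by fun_prop)).1
    (ae_of_all _ fun u t ht ↦ ?_)
    (integrable_of_continuous_sphere μ (by fun_prop)) (ae_of_all _ fun u t ht ↦ ?_)).2
  · simpa using h
  · have hpos := hK.supportFn_sphere_pos u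
    rw [norm_mul, norm_mul, Real.norm_of_nonneg hpos.le, Real.norm_of_nonneg (exp_pos _).le,
      Real.norm_eq_abs]
    have h2 : |t| ≤ 1 := by simpa using ht
    have h3 : t * φ u ≤ C := (le_abs_self _).trans (by
      rw [abs_mul]
      calc |t| * |φ u| ≤ 1 * C := mul_le_mul h2 (hC u) (abs_nonneg _) zero_le_one
        _ = C := one_mul C)
    gcongr
    exact hC u
  · have h1 : HasDerivAt (fun t : ℝ ↦ t * φ u) (φ u) t := hasDerivAt_mul_const _
    exact h1.exp.const_mul _

end IsBody

/-- `K` maximizes volume among the compact sets whose support function has `μ`-integral at most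
one. -/
structure IsVolumeMaximizer (μ : Measure (Sph (m + 1))) (K : Set (En (m + 1))) : Prop where
  isBody : IsBody K
  integral_le : ∫ u : Sph (m + 1), supportFn K u ∂μ ≤ 1
  volume_le : ∀ L : Set (En (m + 1)), IsCompact L → L.Nonempty →
    ∫ u : Sph (m + 1), supportFn L u ∂μ ≤ 1 → volume L ≤ volume K

theorem integral_pos_of_continuous_sphere {n : ℕ} (μ : Measure (Sph n)) [IsFiniteMeasure μ]
    (hμ : 0 < μ Set.univ) {f : Sph n → ℝ} (hf : Continuous f) (hpos : ∀ u, 0 < f u) :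
    0 < ∫ u, f u ∂μ := by
  rw [integral_pos_iff_support_of_nonneg (fun u ↦ (hpos u).le)
    (integrable_of_continuous_sphere μ hf)]
  convert hμ
  exact Set.eq_univ_of_forall fun u ↦ (hpos u).ne'

namespace IsVolumeMaximizer

theorem volume_toReal_pos {μ : Measure (Sph (m + 1))} (hK : IsVolumeMaximizer μ K) :
    0 < (volume K).toReal :=
  ENNReal.toReal_pos ((isOpen_interior.measure_pos volume ⟨0, hK.isBody.zero_mem⟩).trans_le
    (measure_mono interior_subset)).ne' hK.isBody.isCompact.measure_lt_top.ne

variable {μ : Measure (Sph (m + 1))} [IsFiniteMeasure μ]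

theorem volume_wulffShape_le (hK : IsVolumeMaximizer μ K) (hμ : 0 < μ Set.univ)
    {f : Sph (m + 1) → ℝ} (hf : Continuous f) (hpos : ∀ u, 0 < f u) :
    (volume (wulffShape f)).toReal ≤ (volume K).toReal * (∫ u, f u ∂μ) ^ (m + 1) := by
  set a := ∫ u, f u ∂μ with ha
  have ha0 : 0 < a := integral_pos_of_continuous_sphere μ hμ hf hpos
  have hW := isBody_wulffShape hf hpos
  have hLc : IsCompact (a⁻¹ • wulffShape f) := hW.isCompact.smul _
  have hLne : (a⁻¹ • wulffShape f).Nonempty := hW.nonempty.smul_set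
  have hLs := continuous_supportFn hLc hLne
  have h := hK.volume_le _ hLc hLne (by
    calc ∫ u : Sph (m + 1), supportFn (a⁻¹ • wulffShape f) u ∂μ ≤ ∫ u, a⁻¹ * f u ∂μ := by
          refine integral_mono (integrable_of_continuous_sphere μ (by fun_prop))
            (integrable_of_continuous_sphere μ (by fun_prop)) fun u ↦ supportFn_le hLne ?_
          rintro _ ⟨x, hx, rfl⟩
          simp only [real_inner_smul_left]
          gcongr
          exact hx u
      _ ≤ 1 := by rw [integral_const_mul, ← ha, inv_mul_cancel₀ ha0.ne'])
  rw [Measure.addHaar_smul, finrank_euclideanSpace_fin, abs_of_pos (by positivity)] at h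
  have h2 := ENNReal.toReal_mono hK.isBody.isCompact.measure_lt_top.ne h
  rw [ENNReal.toReal_mul, ENNReal.toReal_ofReal (by positivity), inv_pow, ← div_eq_inv_mul,
    div_le_iff₀ (by positivity)] at h2
  exact h2

theorem integral_eq_one (hK : IsVolumeMaximizer μ K) (hμ : 0 < μ Set.univ) :
    ∫ u : Sph (m + 1), supportFn K u ∂μ = 1 := by
  have hh := continuous_supportFn hK.isBody.isCompact hK.isBody.nonempty
  refine le_antisymm hK.integral_le ?_
  have h := hK.volume_wulffShape_le hμ (f := fun u ↦ supportFn K u) (by fun_prop)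
    hK.isBody.supportFn_sphere_pos
  rw [hK.isBody.wulffShape_supportFn, le_mul_iff_one_le_right hK.volume_toReal_pos] at h
  exact (one_le_pow_iff_of_nonneg (integral_nonneg fun u ↦
    (hK.isBody.supportFn_sphere_pos u).le) m.succ_ne_zero).1 h

/-- The Euler-Lagrange equation. -/
theorem setIntegral_gaussMap (hK : IsVolumeMaximizer μ K) (hμ : 0 < μ Set.univ)
    (hφ : Continuous φ) : ∫ x in K, φ (gaussMap K x) =
      (volume K).toReal * ∫ u : Sph (m + 1), supportFn K u * φ u ∂μ := by
  have hB := hK.isBody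
  have h1 : ∫ u, expPerturb K φ 0 u ∂μ = 1 := by
    simpa [expPerturb] using hK.integral_eq_one hμ
  have hd := (hB.hasDerivAt_volume_expPerturb hφ).sub
    (((hB.hasDerivAt_integral_expPerturb hφ μ).pow (m + 1)).const_mul
      ((volume K).toReal / (m + 1)))
  have hmax : IsLocalMax ((fun t ↦ (volume (wulffShape (expPerturb K φ t))).toReal / (m + 1)) -
      fun t ↦ (volume K).toReal / (m + 1) * (∫ u, expPerturb K φ t u ∂μ) ^ (m + 1)) 0 := by
    refine Eventually.of_forall fun t ↦ ?_
    simp only [Pi.sub_apply]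
    rw [h1, hB.wulffShape_expPerturb_zero, one_pow, mul_one, sub_self, sub_nonpos,
      div_mul_eq_mul_div]
    gcongr
    exact hK.volume_wulffShape_le hμ (hB.continuous_expPerturb hφ t) (hB.expPerturb_pos t)
  have h := hmax.hasDerivAt_eq_zero hd
  rw [h1, one_pow, mul_one, ← mul_assoc] at h
  have hm : (m + 1 : ℝ) ≠ 0 := by positivity
  push_cast at h
  rw [div_mul_cancel₀ _ hm] at h
  linarith

theorem coneMeasure_eq_withDensity (hK : IsVolumeMaximizer μ K) (hμ : 0 < μ Set.univ) :
    coneMeasure K = μ.withDensity fun u ↦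
      ENNReal.ofReal ((volume K).toReal * supportFn K u) := by
  have hh := continuous_supportFn hK.isBody.isCompact hK.isBody.nonempty
  have hpos := hK.volume_toReal_pos
  have : IsFiniteMeasure (coneMeasure K) := by
    have : IsFiniteMeasure (volume.restrict K) :=
      ⟨by simpa using hK.isBody.isCompact.measure_lt_top⟩
    unfold coneMeasure
    infer_instance
  have : IsFiniteMeasure (μ.withDensity fun u ↦
      ENNReal.ofReal ((volume K).toReal * supportFn K u)) :=
    isFiniteMeasure_withDensity_ofReal
      (integrable_of_continuous_sphere μ (by fun_prop)).2
  refine ext_of_forall_integral_eq_of_IsFiniteMeasure fun φ ↦ ?_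
  rw [coneMeasure, integral_map (measurable_gaussMap K).aemeasurable
    φ.continuous.measurable.aestronglyMeasurable, hK.setIntegral_gaussMap hμ φ.continuous,
    integral_withDensity_eq_integral_toReal_smul (by fun_prop)
      (ae_of_all _ fun _ ↦ ENNReal.ofReal_lt_top), ← integral_const_mul]
  refine integral_congr_ae (ae_of_all _ fun u ↦ ?_)
  have := hK.isBody.supportFn_sphere_pos u
  simp only [smul_eq_mul]
  rw [ENNReal.toReal_ofReal (by positivity), mul_assoc]

end IsVolumeMaximizer

end eulerLagrange

section existence

variable {m : ℕ} {K : Set (En (m + 1))}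

theorem withDensity_right_cancel {α : Type*} [MeasurableSpace α] {μ ν : Measure α}
    {f : α → ℝ≥0∞} (hf : Measurable f) (h0 : ∀ a, f a ≠ 0) (htop : ∀ a, f a ≠ ∞)
    (h : μ.withDensity f = ν.withDensity f) : μ = ν := by
  rw [← withDensity_inv_same₀ hf.aemeasurable (μ := μ) (ae_of_all _ h0) (ae_of_all _ htop), h,
    withDensity_inv_same₀ hf.aemeasurable (ae_of_all _ h0) (ae_of_all _ htop)]

theorem IsVolumeMaximizer.exists_eq_smul_surfaceMeasure {μ : Measure (Sph (m + 1))}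
    [IsFiniteMeasure μ] (hK : IsVolumeMaximizer μ K) (hμ : 0 < μ Set.univ) :
    ∃ κ : ℝ≥0, 0 < κ ∧ μ = κ • surfaceMeasure K := by
  have hV := hK.volume_toReal_pos
  have hh := (continuous_supportFn hK.isBody.isCompact hK.isBody.nonempty).comp
    (continuous_subtype_val (p := (· ∈ Sph (m + 1))))
  set q : Sph (m + 1) → ℝ≥0∞ := fun u ↦ ENNReal.ofReal ((volume K).toReal * supportFn K u)
    with hq
  have hqm : Measurable q := (hh.const_mul _).measurable.ennreal_ofReal
  set κ : ℝ≥0 := ((m + 1) * (volume K).toReal)⁻¹.toNNReal * hausdorffConst m with hκ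
  have hκ0 : 0 < κ := mul_pos (Real.toNNReal_pos.2 (by positivity))
    (pos_iff_ne_zero.2 (hausdorffConst_ne_zero m))
  refine ⟨κ, hκ0, withDensity_right_cancel hqm
    (fun u ↦ (ENNReal.ofReal_pos.2 (mul_pos hV (hK.isBody.supportFn_sphere_pos u))).ne')
    (fun _ ↦ ENNReal.ofReal_ne_top) ?_⟩
  rw [← hK.coneMeasure_eq_withDensity hμ, hK.isBody.coneMeasure_eq]
  have hD : coneDensity K = (κ : ℝ≥0∞) • q := by
    ext u
    rw [coneDensity, Pi.smul_apply, smul_eq_mul, hq, hκ, ENNReal.coe_mul, mul_right_comm]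
    congr 1
    change _ = ENNReal.ofReal _ * _
    rw [← ENNReal.ofReal_mul (by positivity)]
    congr 1
    field_simp
  rw [hD, withDensity_smul _ hqm, ← withDensity_smul_measure]
  rfl

theorem reverseSphericalImage_smul {n : ℕ} (K : Set (En n)) {s : ℝ} (hs : 0 < s)
    (ω : Set (Sph n)) : reverseSphericalImage (s • K) ω = s • reverseSphericalImage K ω := by
  have hf : frontier (s • K) = s • frontier K := by
    rw [frontier, frontier, closure_smul₀, interior_smul₀ hs.ne', Set.smul_set_sdiff₀ hs.ne']
  ext x
  rw [Set.mem_smul_set_iff_inv_smul_mem₀ hs.ne']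
  refine and_congr (by rw [hf, Set.mem_smul_set_iff_inv_smul_mem₀ hs.ne'])
    (exists_congr fun u ↦ and_congr_right fun _ ↦ ?_)
  rw [← Set.image_smul, Set.forall_mem_image]
  refine forall₂_congr fun y _ ↦ ?_
  have h : s • y - x = s • (y - s⁻¹ • x) := by rw [smul_sub, smul_inv_smul₀ hs.ne']
  rw [h, real_inner_smul_left]
  exact ⟨fun h ↦ by nlinarith, fun h ↦ by nlinarith⟩

theorem hausdorffMeasure_reverseSphericalImage_smul {n : ℕ} (K : Set (En n)) {s : ℝ≥0}
    (hs : 0 < s) (m : ℕ) (ω : Set (Sph n)) :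
    μH[(m : ℝ)] (reverseSphericalImage ((s : ℝ) • K) ω) =
      (s ^ m : ℝ≥0) • μH[(m : ℝ)] (reverseSphericalImage K ω) := by
  rw [reverseSphericalImage_smul K (NNReal.coe_pos.2 hs),
    Measure.hausdorffMeasure_smul₀ m.cast_nonneg (NNReal.coe_pos.2 hs).ne',
    NNReal.nnnorm_eq, NNReal.rpow_natCast]

/-- The existence half of Minkowski's theorem. -/
theorem exists_body_eq_reverseSphericalImage (hm : m ≠ 0) (μ : Measure (Sph (m + 1)))
    [IsFiniteMeasure μ] (hμ : 0 < μ Set.univ)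
    (h1 : ∀ v : En (m + 1), ∫ u : Sph (m + 1), ⟪v, (u : En (m + 1))⟫_ℝ ∂μ = 0)
    (h2 : ∀ v : En (m + 1), v ≠ 0 → 0 < ∫ u : Sph (m + 1), ⟪v, (u : En (m + 1))⟫_ℝ ^ 2 ∂μ) :
    ∃ K : Set (En (m + 1)), Convex ℝ K ∧ IsCompact K ∧ (interior K).Nonempty ∧
      ∀ ω, MeasurableSet ω → μ ω = μH[(m : ℝ)] (reverseSphericalImage K ω) := by
  have : Nonempty (Sph (m + 1)) := ⟨⟨EuclideanSpace.single 0 1, by simp⟩⟩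
  obtain ⟨K, hK, hle, hmax⟩ := exists_body_maximizer μ h1 h2
  obtain ⟨κ, hκ, hμK⟩ :=
    (IsVolumeMaximizer.mk hK hle hmax).exists_eq_smul_surfaceMeasure hμ
  set s : ℝ≥0 := κ ^ (m : ℝ)⁻¹
  have hs : 0 < s := NNReal.rpow_pos hκ
  refine ⟨(s : ℝ) • K, hK.convex.smul _, hK.isCompact.smul _, ?_, fun ω hω ↦ ?_⟩
  · rw [interior_smul₀ (NNReal.coe_pos.2 hs).ne']
    exact Set.Nonempty.smul_set ⟨0, hK.zero_mem⟩
  · rw [hausdorffMeasure_reverseSphericalImage_smul K hs, NNReal.rpow_inv_natCast_pow _ hm, hμK,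
      Measure.smul_apply, hK.surfaceMeasure_eq_hausdorffMeasure hω]
    rfl

end existence

end

/-- a finite Borel measure `μ` on `S^{n-1}` with `μ(S^{n-1}) > 0`
is the surface area measure of a convex body with nonempty interior iff its
first order moments vanish and its second moment matrix is positive
definite. -/
theorem stmt6 {n : ℕ} (hn : 2 ≤ n) (μ : Measure (Sph n)) [IsFiniteMeasure μ]
    (hpos : 0 < μ Set.univ) :
    (∃ K : Set (En n), Convex ℝ K ∧ IsCompact K ∧ (interior K).Nonempty ∧
      IsSurfaceAreaMeasure K μ) ↔
    ((∀ i, ∫ u, (u : En n) i ∂μ = 0) ∧ (secondMomentMatrix μ).PosDef) := by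
  obtain ⟨m, rfl⟩ : ∃ m, n = m + 1 := ⟨n - 1, by omega⟩
  have hdim : ((m + 1 : ℕ) : ℝ) - 1 = m := by push_cast; ring
  constructor
  · rintro ⟨K, hconv, hK, hint, hS | hS⟩
    · have hμ : ∀ ω, MeasurableSet ω → μ ω = μH[(m : ℝ)] (reverseSphericalImage K ω) :=
        fun ω hω ↦ hdim ▸ hS.2 ω hω
      refine ⟨fun i ↦ ?_, (posDef_secondMomentMatrix_iff μ).2 fun v hv ↦ ?_⟩
      · have h := integral_inner_eq_zero_of_eq_surfaceMeasure hconv hK hint μ hμ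
          (EuclideanSpace.single i 1)
        simpa [EuclideanSpace.inner_single_left] using h
      · obtain ⟨p, hp⟩ := hint
        have hμ' : surfaceMeasure ((· + p) ⁻¹' K) = μ := Measure.ext fun ω hω ↦ by
          rw [surfaceMeasure_translate hconv hK hp hω, hμ ω hω]
        subst hμ'
        exact (isBody_translate hconv hK hp).integral_inner_sq_pos hv
    · exact absurd hS.1 hint.ne_empty
  · rintro ⟨h1, h2⟩
    obtain ⟨K, hconv, hK, hint, hμ⟩ := exists_body_eq_reverseSphericalImage (by omega) μ hpos
      (fun v ↦ by simp [integral_inner_eq_sum, h1]) ((posDef_secondMomentMatrix_iff μ).1 h2)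
    exact ⟨K, hconv, hK, hint, Or.inl ⟨hint, fun ω hω ↦ hdim.symm ▸ hμ ω hω⟩⟩
end
end

section
/- Let K, L be convex bodies in R^n contained in a ball of radius R, let s_0 ∈ N, 0 < ε < 1, δ > 0. If √(ω_n m_{s_0}) ||ψ^{s_0}(K) − ψ^{s_0}(L)|| ≤ δ, where ψ^{s_0} denotes the vector of harmonic intrinsic volumes up to degree s_0, then the Dudley distance between the surface area measures satisfies d_D(S_{n-1}(K,·), S_{n-1}(L,·)) ≤ c(n, R, ε) s_0^{(ε−1)/2} + δ for a constant c > 0 depending only on n, R, ε. -/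
open MeasureTheory Metric Real Filter
open scoped InnerProductSpace ENNReal NNReal Topology

noncomputable section

/-- The spherical Lebesgue (surface) measure on `S^{n-1}`. -/
def sphLebesgue (n : ℕ) : Measure (Sph n) := μH[((n : ℝ) - 1)]

/-- `ω_n`, the surface area of the unit sphere `S^{n-1}`. -/
def omegaN (n : ℕ) : ℝ := (sphLebesgue n Set.univ).toReal

/-- `f : S^{n-1} → ℝ` is a spherical harmonic of degree `k`: the restriction to
the sphere of a harmonic polynomial on `ℝⁿ` that is homogeneous of degree `k`. -/
def IsSphHarmonic {n : ℕ} (k : ℕ) (f : Sph n → ℝ) : Prop :=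
  ∃ P : MvPolynomial (Fin n) ℝ, P.IsHomogeneous k ∧
    (∑ i, MvPolynomial.pderiv i (MvPolynomial.pderiv i P)) = 0 ∧
    ∀ u : Sph n, f u = MvPolynomial.eval (fun i => (u : En n) i) P

/-- `H k 0, …, H k (N k - 1)` is, for every degree `k`, an orthonormal basis
(w.r.t. the spherical Lebesgue measure) of the space of spherical harmonics of
degree `k` on `S^{n-1}`. -/
def IsHarmonicBasis {n : ℕ} (N : ℕ → ℕ) (H : (k : ℕ) → Fin (N k) → Sph n → ℝ) : Prop :=
  (∀ k j, IsSphHarmonic k (H k j)) ∧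
  (∀ k, ∀ j j' : Fin (N k),
    ∫ u, H k j u * H k j' u ∂(sphLebesgue n) = if j = j' then 1 else 0) ∧
  (∀ k (f : Sph n → ℝ), IsSphHarmonic k f →
    ∃ c : Fin (N k) → ℝ, ∀ u, f u = ∑ j, c j * H k j u)

namespace SphericalStability

open MvPolynomial

variable {n : ℕ}

/-- The restriction of a polynomial to the sphere. -/
def restr (P : MvPolynomial (Fin n) ℝ) (u : Sph n) : ℝ :=
  eval (fun i => (u : En n) i) P

lemma continuous_restr (P : MvPolynomial (Fin n) ℝ) : Continuous (restr P) :=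
  (MvPolynomial.continuous_eval P).comp (by fun_prop)

lemma integrable_of_continuous {μ : Measure (Sph n)} [IsFiniteMeasure μ] {f : Sph n → ℝ}
    (hf : Continuous f) : Integrable f μ :=
  hf.integrable_of_hasCompactSupport (HasCompactSupport.of_compactSpace f)

lemma integrable_restr {μ : Measure (Sph n)} [IsFiniteMeasure μ] (P : MvPolynomial (Fin n) ℝ) :
    Integrable (restr P) μ :=
  integrable_of_continuous (continuous_restr P)

lemma sum_coord_sq (u : Sph n) : ∑ i, (u : En n) i ^ 2 = 1 := by
  have h := EuclideanSpace.real_norm_sq_eq (u : En n)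
  rw [norm_eq_of_mem_sphere u] at h
  simpa using h.symm

lemma hasDerivAt_eval (P : MvPolynomial (Fin n) ℝ) {x : ℝ → Fin n → ℝ} {x' : Fin n → ℝ} {t : ℝ}
    (hx : ∀ i, HasDerivAt (fun s => x s i) (x' i) t) :
    HasDerivAt (fun s => eval (x s) P) (∑ i, x' i * eval (x t) (pderiv i P)) t := by
  classical
  induction P using MvPolynomial.induction_on with
  | C a => simpa using hasDerivAt_const t a
  | add p q hp hq =>
    simp only [map_add, mul_add, Finset.sum_add_distrib]
    exact hp.add hq
  | mul_X p i hp =>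
    have h := hp.mul (hx i)
    simp only [map_mul, eval_X]
    refine h.congr_deriv ?_
    simp only [pderiv_mul, pderiv_X, map_add, map_mul, eval_X, mul_add, Finset.sum_add_distrib,
      Finset.sum_mul]
    congr 1
    · exact Finset.sum_congr rfl fun k _ => by ring
    · rw [Finset.sum_eq_single i]
      · simp [mul_comm]
      · intro k _ hk
        simp [hk.symm]
      · simp

/-- The rotation by the angle `t` in the plane of the coordinates `i` and `j`. -/
def planeRot (i j : Fin n) (t : ℝ) (x : En n) : En n :=
  WithLp.toLp 2 fun k =>
    if k = i then cos t * x i - sin t * x j else if k = j then sin t * x i + cos t * x j else x k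

lemma planeRot_sub (i j : Fin n) (t : ℝ) (x y : En n) :
    planeRot i j t (x - y) = planeRot i j t x - planeRot i j t y := by
  ext k
  simp only [planeRot, PiLp.sub_apply]
  split_ifs <;> ring

lemma norm_planeRot {i j : Fin n} (hij : i ≠ j) (t : ℝ) (x : En n) :
    ‖planeRot i j t x‖ = ‖x‖ := by
  have h : ‖planeRot i j t x‖ ^ 2 = ‖x‖ ^ 2 := by
    rw [EuclideanSpace.real_norm_sq_eq, EuclideanSpace.real_norm_sq_eq, ← sub_eq_zero,
      ← Finset.sum_sub_distrib, Fintype.sum_eq_add i j hij]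
    · simp only [planeRot, if_true, if_neg hij.symm]
      linear_combination (x i ^ 2 + x j ^ 2) * sin_sq_add_cos_sq t
    · rintro k ⟨hi, hj⟩
      simp [planeRot, hi, hj]
  exact (sq_eq_sq₀ (norm_nonneg _) (norm_nonneg _)).1 h

lemma planeRot_neg_planeRot {i j : Fin n} (hij : i ≠ j) (t : ℝ) (x : En n) :
    planeRot i j (-t) (planeRot i j t x) = x := by
  ext k
  simp only [planeRot, if_true, if_neg hij.symm, cos_neg, sin_neg]
  split_ifs with h1 h2
  · subst h1
    linear_combination x k * sin_sq_add_cos_sq t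
  · subst h2
    linear_combination x k * sin_sq_add_cos_sq t
  · rfl

/-- Plane rotations as isometries of the sphere. -/
def sphRot {i j : Fin n} (hij : i ≠ j) (t : ℝ) : Sph n ≃ᵢ Sph n where
  toFun u := ⟨planeRot i j t u, by simp [norm_planeRot hij]⟩
  invFun u := ⟨planeRot i j (-t) u, by simp [norm_planeRot hij]⟩
  left_inv u := Subtype.ext (planeRot_neg_planeRot hij t u)
  right_inv u := Subtype.ext (by simpa using planeRot_neg_planeRot hij (-t) u)
  isometry_toFun := Isometry.of_dist_eq fun u v => by
    simp only [Subtype.dist_eq, dist_eq_norm, ← planeRot_sub, norm_planeRot hij]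

/-- The infinitesimal rotation `x_i ∂_j - x_j ∂_i`. -/
def rotGen (i j : Fin n) (P : MvPolynomial (Fin n) ℝ) : MvPolynomial (Fin n) ℝ :=
  X i * pderiv j P - X j * pderiv i P

lemma hasDerivAt_restr_sphRot {i j : Fin n} (hij : i ≠ j) (P : MvPolynomial (Fin n) ℝ) (u : Sph n)
    (t : ℝ) : HasDerivAt (fun s => restr P (sphRot hij s u)) (restr (rotGen i j P) (sphRot hij t u))
      t := by
  have hx : ∀ k, HasDerivAt (fun s => (sphRot hij s u : En n) k)
      (if k = i then -(sphRot hij t u : En n) j else if k = j then (sphRot hij t u : En n) i else 0)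
      t := by
    intro k
    simp only [sphRot, IsometryEquiv.coe_mk, Equiv.coe_fn_mk, planeRot, if_true, if_neg hij.symm]
    split_ifs with h1 h2
    · refine (((hasDerivAt_cos t).mul_const _).sub ((hasDerivAt_sin t).mul_const _)).congr_deriv ?_
      ring
    · refine (((hasDerivAt_sin t).mul_const _).add ((hasDerivAt_cos t).mul_const _)).congr_deriv ?_
      ring
    · exact hasDerivAt_const _ _
  refine (hasDerivAt_eval P hx).congr_deriv ?_
  rw [Fintype.sum_eq_add i j hij]
  · simp only [if_true, if_neg hij.symm, restr, rotGen, map_sub, map_mul, eval_X]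
    ring
  · rintro k ⟨hi, hj⟩
    simp [hi, hj]

lemma integral_sphRot {i j : Fin n} (hij : i ≠ j) (t : ℝ) (f : Sph n → ℝ) :
    ∫ u, f (sphRot hij t u) ∂(sphLebesgue n) = ∫ u, f u ∂(sphLebesgue n) :=
  ((sphRot hij t).measurePreserving_hausdorffMeasure _).integral_comp
    (sphRot hij t).toHomeomorph.measurableEmbedding _

lemma integral_rotGen [IsFiniteMeasure (sphLebesgue n)] (i j : Fin n)
    (P : MvPolynomial (Fin n) ℝ) : ∫ u, restr (rotGen i j P) u ∂(sphLebesgue n) = 0 := by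
  rcases eq_or_ne i j with rfl | hij
  · simp [rotGen, restr]
  obtain ⟨C, hC⟩ := (isCompact_range (continuous_restr (rotGen i j P))).isBounded.exists_norm_le
  have hd := (hasDerivAt_integral_of_dominated_loc_of_deriv_le (μ := sphLebesgue n)
    (F := fun t u => restr P (sphRot hij t u))
    (F' := fun t u => restr (rotGen i j P) (sphRot hij t u)) (x₀ := 0) (bound := fun _ => C)
    (s := Set.univ) Filter.univ_mem
    (Filter.Eventually.of_forall fun t =>
      ((continuous_restr P).comp (sphRot hij t).continuous).aestronglyMeasurable)
    (integrable_of_continuous ((continuous_restr P).comp (sphRot hij 0).continuous))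
    ((continuous_restr _).comp (sphRot hij 0).continuous).aestronglyMeasurable
    (Filter.Eventually.of_forall fun u t _ => hC _ ⟨_, rfl⟩)
    (integrable_const C)
    (Filter.Eventually.of_forall fun u t _ => hasDerivAt_restr_sphRot hij P u t)).2
  simp only [integral_sphRot] at hd
  exact hd.unique (hasDerivAt_const _ _)

/-- The divergence theorem for the tangential part of a polynomial vector field on the sphere. -/
lemma integral_tangential_divergence [IsFiniteMeasure (sphLebesgue n)]
    (A : Fin n → MvPolynomial (Fin n) ℝ) :
    ∫ u, (((n : ℝ) - 1) * ∑ i, (u : En n) i * restr (A i) u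
      + ∑ i, (u : En n) i * ∑ j, (u : En n) j * restr (pderiv j (A i)) u
      - ∑ i, restr (pderiv i (A i)) u) ∂(sphLebesgue n) = 0 := by
  classical
  have hsum : ∫ u, ∑ i, ∑ j, restr (rotGen i j (X j * A i)) u ∂(sphLebesgue n) = 0 := by
    rw [integral_finsetSum _ fun i _ => integrable_finsetSum _ fun j _ => integrable_restr _]
    refine Finset.sum_eq_zero fun i _ => ?_
    rw [integral_finsetSum _ fun j _ => integrable_restr _]
    exact Finset.sum_eq_zero fun j _ => integral_rotGen i j _
  rw [← hsum]
  congr 1 with u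
  have h1 : ∀ i j, restr (rotGen i j (X j * A i)) u = (u : En n) i * restr (A i) u
      + (u : En n) i * ((u : En n) j * restr (pderiv j (A i)) u)
      - (if i = j then (u : En n) j * restr (A i) u else 0)
      - (u : En n) j ^ 2 * restr (pderiv i (A i)) u := by
    intro i j
    have : eval (fun i => (u : En n) i) (Pi.single (M := fun _ => MvPolynomial (Fin n) ℝ) i 1 j)
        = if i = j then 1 else 0 := by
      rcases eq_or_ne i j with rfl | h
      · simp
      · simp [h, h.symm]
    simp only [restr, rotGen, pderiv_mul, pderiv_X, map_sub, map_mul, map_add, eval_X,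
      Pi.single_eq_same, this, map_one]
    split_ifs <;> ring
  simp only [h1, Finset.sum_add_distrib, Finset.sum_sub_distrib, ← Finset.sum_mul,
    ← Finset.mul_sum, sum_coord_sq, Finset.sum_ite_eq, Finset.mem_univ, if_true, Finset.sum_const,
    Finset.card_univ, Fintype.card_fin, nsmul_eq_mul, one_mul]
  simp only [mul_assoc, ← Finset.mul_sum]
  ring

lemma euler_pderiv {P : MvPolynomial (Fin n) ℝ} {k : ℕ} (hP : P.IsHomogeneous k) (i : Fin n) :
    ∑ j, X j * pderiv j (pderiv i P) = C ((k : ℝ) - 1) * pderiv i P := by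
  rw [hP.pderiv.sum_X_mul_pderiv]
  rcases k with _ | k
  · have h0 : pderiv i P = 0 := by
      rw [totalDegree_eq_zero_iff_eq_C.1 (Nat.le_zero.1 hP.totalDegree_le), pderiv_C]
    simp [h0]
  · simp [nsmul_eq_mul]

lemma integral_harmonic_mul_harmonic [IsFiniteMeasure (sphLebesgue n)] (hn : 2 ≤ n)
    {P Q : MvPolynomial (Fin n) ℝ} {k l : ℕ} (hP : P.IsHomogeneous k) (hQ : Q.IsHomogeneous l)
    (hP0 : ∑ i, pderiv i (pderiv i P) = 0) (hQ0 : ∑ i, pderiv i (pderiv i Q) = 0) (hkl : k ≠ l) :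
    ∫ u, restr P u * restr Q u ∂(sphLebesgue n) = 0 := by
  have h := integral_tangential_divergence fun i => Q * pderiv i P - P * pderiv i Q
  have hpt : ∀ u : Sph n, ((n : ℝ) - 1) * ∑ i, (u : En n) i * restr (Q * pderiv i P - P * pderiv i Q) u
      + ∑ i, (u : En n) i * ∑ j, (u : En n) j * restr (pderiv j (Q * pderiv i P - P * pderiv i Q)) u
      - ∑ i, restr (pderiv i (Q * pderiv i P - P * pderiv i Q)) u
      = (((k : ℝ) + l + n - 2) * (k - l)) * (restr P u * restr Q u) := by
    intro u
    have eP : ∑ i, (u : En n) i * restr (pderiv i P) u = k * restr P u := by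
      simpa [restr, nsmul_eq_mul] using
        congrArg (eval fun i => (u : En n) i) hP.sum_X_mul_pderiv
    have eQ : ∑ i, (u : En n) i * restr (pderiv i Q) u = l * restr Q u := by
      simpa [restr, nsmul_eq_mul] using
        congrArg (eval fun i => (u : En n) i) hQ.sum_X_mul_pderiv
    have eP2 : ∀ i, ∑ j, (u : En n) j * restr (pderiv j (pderiv i P)) u
        = (k - 1) * restr (pderiv i P) u := fun i => by
      simpa [restr] using congrArg (eval fun i => (u : En n) i) (euler_pderiv hP i)
    have eQ2 : ∀ i, ∑ j, (u : En n) j * restr (pderiv j (pderiv i Q)) u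
        = (l - 1) * restr (pderiv i Q) u := fun i => by
      simpa [restr] using congrArg (eval fun i => (u : En n) i) (euler_pderiv hQ i)
    have lP : ∑ i, restr (pderiv i (pderiv i P)) u = 0 := by
      simpa [restr] using congrArg (eval fun i => (u : En n) i) hP0
    have lQ : ∑ i, restr (pderiv i (pderiv i Q)) u = 0 := by
      simpa [restr] using congrArg (eval fun i => (u : En n) i) hQ0
    have hA : ∀ i, restr (Q * pderiv i P - P * pderiv i Q) u
        = restr Q u * restr (pderiv i P) u - restr P u * restr (pderiv i Q) u := fun i => by
      simp [restr]
    have hdA : ∀ i j, restr (pderiv j (Q * pderiv i P - P * pderiv i Q)) u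
        = restr (pderiv j Q) u * restr (pderiv i P) u + restr Q u * restr (pderiv j (pderiv i P)) u
          - restr (pderiv j P) u * restr (pderiv i Q) u
          - restr P u * restr (pderiv j (pderiv i Q)) u := fun i j => by
      simp [restr]
      ring
    have h1 : ∑ i, (u : En n) i * restr (Q * pderiv i P - P * pderiv i Q) u
        = (k - l) * (restr P u * restr Q u) := by
      calc _ = restr Q u * ∑ i, (u : En n) i * restr (pderiv i P) u
            - restr P u * ∑ i, (u : En n) i * restr (pderiv i Q) u := by
            simp only [hA, Finset.mul_sum, ← Finset.sum_sub_distrib]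
            exact Finset.sum_congr rfl fun i _ => by ring
        _ = _ := by rw [eP, eQ]; ring
    have h2 : ∀ i, ∑ j, (u : En n) j * restr (pderiv j (Q * pderiv i P - P * pderiv i Q)) u
        = (k + l - 1) * restr (Q * pderiv i P - P * pderiv i Q) u := by
      intro i
      calc _ = restr (pderiv i P) u * ∑ j, (u : En n) j * restr (pderiv j Q) u
            + restr Q u * ∑ j, (u : En n) j * restr (pderiv j (pderiv i P)) u
            - restr (pderiv i Q) u * ∑ j, (u : En n) j * restr (pderiv j P) u
            - restr P u * ∑ j, (u : En n) j * restr (pderiv j (pderiv i Q)) u := by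
            simp only [hdA, Finset.mul_sum, ← Finset.sum_sub_distrib, ← Finset.sum_add_distrib]
            exact Finset.sum_congr rfl fun i _ => by ring
        _ = _ := by rw [eP, eQ, eP2, eQ2, hA]; ring
    have h3 : ∑ i, restr (pderiv i (Q * pderiv i P - P * pderiv i Q)) u = 0 := by
      calc _ = restr Q u * ∑ i, restr (pderiv i (pderiv i P)) u
            - restr P u * ∑ i, restr (pderiv i (pderiv i Q)) u := by
            simp only [hdA, Finset.mul_sum, ← Finset.sum_sub_distrib]
            exact Finset.sum_congr rfl fun i _ => by ring
        _ = _ := by rw [lP, lQ]; ring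
    have h4 : ∀ i, (u : En n) i * ((k + l - 1) * restr (Q * pderiv i P - P * pderiv i Q) u)
        = (k + l - 1) * ((u : En n) i * restr (Q * pderiv i P - P * pderiv i Q) u) :=
      fun i => by ring
    simp only [h2, h3, h4, ← Finset.mul_sum, h1]
    ring
  simp only [hpt, integral_const_mul] at h
  refine (mul_eq_zero.1 h).resolve_left (mul_ne_zero ?_ ?_)
  · have h1 : (1 : ℝ) ≤ k + l := by
      exact_mod_cast (show 1 ≤ k + l by omega)
    have h2 : (2 : ℝ) ≤ n := by exact_mod_cast hn
    linarith
  · exact sub_ne_zero.2 (by exact_mod_cast hkl)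

/-- The zonal kernel `1 + ⟨u, v⟩`. -/
def zonal (u v : Sph n) : ℝ := 1 + ∑ i, (u : En n) i * (v : En n) i

lemma dist_sq_eq (u v : Sph n) : dist u v ^ 2 = 2 * (2 - zonal u v) := by
  rw [Subtype.dist_eq, EuclideanSpace.dist_eq, Real.sq_sqrt (by positivity)]
  have h : ∀ i, dist ((u : En n) i) ((v : En n) i) ^ 2
      = (u : En n) i ^ 2 + (v : En n) i ^ 2 - 2 * ((u : En n) i * (v : En n) i) := fun i => by
    rw [Real.dist_eq, sq_abs]; ring
  simp only [h, Finset.sum_sub_distrib, Finset.sum_add_distrib, sum_coord_sq, ← Finset.mul_sum,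
    zonal]
  ring

lemma zonal_nonneg (u v : Sph n) : 0 ≤ zonal u v := by
  have h : 0 ≤ ∑ i, ((u : En n) i + (v : En n) i) ^ 2 := by positivity
  have e : ∀ i, ((u : En n) i + (v : En n) i) ^ 2
      = (u : En n) i ^ 2 + (v : En n) i ^ 2 + 2 * ((u : En n) i * (v : En n) i) := fun i => by ring
  simp only [e, Finset.sum_add_distrib, sum_coord_sq, ← Finset.mul_sum] at h
  unfold zonal
  linarith

lemma continuous_zonal (u : Sph n) : Continuous (zonal u) := by
  unfold zonal
  fun_prop

lemma integral_zonal_pow_succ [IsFiniteMeasure (sphLebesgue n)] (u : Sph n) (s : ℕ) :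
    ((s : ℝ) + n - 1) * ∫ v, zonal u v ^ (s + 1) ∂(sphLebesgue n)
      = (2 * s + n - 1) * ∫ v, zonal u v ^ s ∂(sphLebesgue n) := by
  classical
  set T : MvPolynomial (Fin n) ℝ := 1 + ∑ i, C ((u : En n) i) * X i with hT
  have hTe : ∀ v, restr T v = zonal u v := fun v => by simp [restr, hT, zonal]
  have hdT : ∀ j, pderiv j T = C ((u : En n) j) := fun j => by
    simp [hT, pderiv_X, Pi.single_apply]
  have h := integral_tangential_divergence fun i => C ((u : En n) i) * T ^ s
  have hpt : ∀ v : Sph n, ((n : ℝ) - 1) * ∑ i, (v : En n) i * restr (C ((u : En n) i) * T ^ s) v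
      + ∑ i, (v : En n) i * ∑ j, (v : En n) j * restr (pderiv j (C ((u : En n) i) * T ^ s)) v
      - ∑ i, restr (pderiv i (C ((u : En n) i) * T ^ s)) v
      = ((s : ℝ) + n - 1) * zonal u v ^ (s + 1) - (2 * s + n - 1) * zonal u v ^ s := by
    intro v
    have h0 : ∑ i, (u : En n) i * (v : En n) i = zonal u v - 1 := by simp [zonal]
    have hA : ∀ i, restr (C ((u : En n) i) * T ^ s) v = (u : En n) i * zonal u v ^ s := fun i => by
      rw [← hTe]; simp [restr]
    have hdA : ∀ i j, restr (pderiv j (C ((u : En n) i) * T ^ s)) v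
        = (u : En n) i * (u : En n) j * (s * zonal u v ^ (s - 1)) := fun i j => by
      rw [← hTe, pderiv_C_mul, pderiv_pow, hdT]
      simp [restr]
      ring
    have h1 : ∑ i, (v : En n) i * ((u : En n) i * zonal u v ^ s)
        = (zonal u v - 1) * zonal u v ^ s := by
      rw [← h0, Finset.sum_mul]
      exact Finset.sum_congr rfl fun i _ => by ring
    have h2 : ∑ i, (v : En n) i * ∑ j, (v : En n) j *
        ((u : En n) i * (u : En n) j * (s * zonal u v ^ (s - 1)))
        = (zonal u v - 1) ^ 2 * (s * zonal u v ^ (s - 1)) := by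
      rw [← h0, sq, Finset.sum_mul_sum, Finset.sum_mul]
      refine Finset.sum_congr rfl fun i _ => ?_
      rw [Finset.mul_sum, Finset.sum_mul]
      exact Finset.sum_congr rfl fun j _ => by ring
    have h3 : ∑ i, (u : En n) i * (u : En n) i * (s * zonal u v ^ (s - 1))
        = s * zonal u v ^ (s - 1) := by
      simp only [← Finset.sum_mul, ← sq, sum_coord_sq, one_mul]
    simp only [hA, hdA, h1, h2, h3]
    rcases s with _ | s
    · simp; ring
    · simp only [Nat.add_sub_cancel]; push_cast; ring
  simp only [hpt] at h
  have hi : ∀ m : ℕ, Integrable (fun v => zonal u v ^ m) (sphLebesgue n) := fun m =>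
    integrable_of_continuous ((continuous_zonal u).pow m)
  rw [integral_sub ((hi _).const_mul _) ((hi _).const_mul _), integral_const_mul,
    integral_const_mul] at h
  linarith

/-- The total mass of the kernel `(1 + ⟨u, v⟩) ^ s`. -/
def zonalMass (n s : ℕ) : ℝ := omegaN n * ∏ k ∈ Finset.range s, (2 * (k : ℝ) + n - 1) / (k + n - 1)

lemma integral_zonal_pow [IsFiniteMeasure (sphLebesgue n)] (hn : 2 ≤ n) (u : Sph n) (s : ℕ) :
    ∫ v, zonal u v ^ s ∂(sphLebesgue n) = zonalMass n s := by
  have h2 : (2 : ℝ) ≤ n := by exact_mod_cast hn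
  induction s with
  | zero => simp [zonalMass, omegaN, Measure.real]
  | succ s ih =>
    have h := integral_zonal_pow_succ u s
    have hs : (s : ℝ) + n - 1 ≠ 0 := by
      have : (0 : ℝ) ≤ s := s.cast_nonneg
      linarith
    rw [ih] at h
    rw [eq_div_of_mul_eq hs ((mul_comm _ _).trans h), zonalMass, zonalMass, Finset.prod_range_succ]
    field_simp

lemma zonalMass_pos (hn : 2 ≤ n) (h : 0 < omegaN n) (s : ℕ) : 0 < zonalMass n s := by
  have h2 : (2 : ℝ) ≤ n := by exact_mod_cast hn
  refine mul_pos h (Finset.prod_pos fun k _ => div_pos ?_ ?_) <;>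
  · have : (0 : ℝ) ≤ k := k.cast_nonneg
    linarith

lemma integral_zonal_pow_mul_dist_le [IsFiniteMeasure (sphLebesgue n)] (hn : 2 ≤ n)
    (h : 0 < omegaN n) (u : Sph n) {s : ℕ} (hs : 1 ≤ s) :
    ∫ v, zonal u v ^ s * dist u v ∂(sphLebesgue n)
      ≤ (n + 1) / √s * zonalMass n s := by
  have h2 : (2 : ℝ) ≤ n := by exact_mod_cast hn
  have hs1 : (1 : ℝ) ≤ s := by exact_mod_cast hs
  have hr : 0 < √(s : ℝ) := Real.sqrt_pos.2 (by linarith)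
  have hi : ∀ m : ℕ, Integrable (fun v => zonal u v ^ m) (sphLebesgue n) := fun m =>
    integrable_of_continuous ((continuous_zonal u).pow m)
  have hle : ∀ v, zonal u v ^ s * dist u v
      ≤ (1 / (2 * √s) + 2 * √s) * zonal u v ^ s - √s * zonal u v ^ (s + 1) := by
    intro v
    have hd : dist u v ≤ 1 / (2 * √s) + √s * (2 - zonal u v) := by
      have e : 1 / (2 * √s) + √s * (2 - zonal u v) - dist u v
          = (1 - √s * dist u v) ^ 2 / (2 * √s) := by
        have := dist_sq_eq u v
        field_simp
        linear_combination (-(√(s:ℝ)) ^ 2) * this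
      have : 0 ≤ (1 - √s * dist u v) ^ 2 / (2 * √s) := by positivity
      linarith
    calc _ ≤ zonal u v ^ s * (1 / (2 * √s) + √s * (2 - zonal u v)) :=
          mul_le_mul_of_nonneg_left hd (pow_nonneg (zonal_nonneg u v) s)
      _ = _ := by ring
  have hint := integral_mono (μ := sphLebesgue n)
    (integrable_of_continuous (((continuous_zonal u).pow s).mul (by fun_prop)))
    (((hi s).const_mul _).sub ((hi (s + 1)).const_mul _)) hle
  refine hint.trans ?_
  simp only [Pi.sub_apply]
  rw [integral_sub ((hi _).const_mul _) ((hi _).const_mul _), integral_const_mul,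
    integral_const_mul]
  have hrec := integral_zonal_pow_succ u s
  simp only [integral_zonal_pow hn] at hrec ⊢
  have hM := zonalMass_pos hn h s
  have hsn : 0 < (s : ℝ) + n - 1 := by linarith
  have e : zonalMass n (s + 1) = (2 * s + n - 1) / (s + n - 1) * zonalMass n s := by
    field_simp
    linarith
  rw [e]
  have key : 1 / (2 * √(s : ℝ)) + 2 * √s - √s * ((2 * s + n - 1) / (s + n - 1)) ≤ (n + 1) / √s := by
    have hsq : √(s : ℝ) * √s = s := Real.mul_self_sqrt (by linarith)
    have e1 : 2 * √(s : ℝ) - √s * ((2 * s + n - 1) / (s + n - 1))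
        = √s * ((n - 1) / (s + n - 1)) := by
      field_simp
      ring
    have e2 : √(s : ℝ) * ((n - 1) / (s + n - 1)) ≤ (n - 1) / √s := by
      rw [le_div_iff₀ hr, mul_right_comm, hsq, ← mul_div_assoc, div_le_iff₀ hsn]
      nlinarith
    have e3 : 1 / (2 * √(s : ℝ)) ≤ 1 / √s := by
      apply one_div_le_one_div_of_le hr
      linarith
    have e4 : ((n : ℝ) + 1) / √s = (n - 1) / √s + 1 / √s + 1 / √s := by
      field_simp
      ring
    have : 0 < 1 / √(s : ℝ) := by positivity
    linarith
  calc _ = (1 / (2 * √(s : ℝ)) + 2 * √s - √s * ((2 * s + n - 1) / (s + n - 1))) * zonalMass n s := by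
        ring
    _ ≤ _ := mul_le_mul_of_nonneg_right key hM.le

/-- The Laplacian on polynomials. -/
def laplacian : MvPolynomial (Fin n) ℝ →ₗ[ℝ] MvPolynomial (Fin n) ℝ :=
  ∑ i, (pderiv i).toLinearMap ∘ₗ (pderiv i).toLinearMap

lemma laplacian_apply (P : MvPolynomial (Fin n) ℝ) :
    laplacian P = ∑ i, pderiv i (pderiv i P) := by
  simp [laplacian]

lemma isHomogeneous_laplacian {P : MvPolynomial (Fin n) ℝ} {d : ℕ} (hP : P.IsHomogeneous d) :
    (laplacian P).IsHomogeneous (d - 2) := by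
  rw [laplacian_apply]
  exact IsHomogeneous.sum _ _ _ fun i _ => hP.pderiv.pderiv

lemma laplacian_eq_zero_of_lt_two {P : MvPolynomial (Fin n) ℝ} {d : ℕ} (hP : P.IsHomogeneous d)
    (hd : d < 2) : laplacian P = 0 := by
  rw [laplacian_apply]
  refine Finset.sum_eq_zero fun i _ => ?_
  have h : (pderiv i P).totalDegree = 0 := by
    have := (hP.pderiv (i := i)).totalDegree_le
    omega
  rw [totalDegree_eq_zero_iff_eq_C.1 h, pderiv_C]

/-- The polynomial `|x| ^ 2`. -/
def normSqPoly (n : ℕ) : MvPolynomial (Fin n) ℝ := ∑ i, X i ^ 2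

lemma isHomogeneous_normSqPoly : (normSqPoly n).IsHomogeneous 2 :=
  IsHomogeneous.sum _ _ _ fun i _ => isHomogeneous_X_pow i 2

lemma restr_normSqPoly (u : Sph n) : restr (normSqPoly n) u = 1 := by
  simpa [restr, normSqPoly] using sum_coord_sq u

lemma laplacian_normSqPoly_mul {Q : MvPolynomial (Fin n) ℝ} {d : ℕ} (hQ : Q.IsHomogeneous d) :
    laplacian (normSqPoly n * Q) = normSqPoly n * laplacian Q + (2 * n + 4 * d : ℝ) • Q := by
  classical
  have hr : ∀ i, pderiv i (normSqPoly n) = 2 * X i := fun i => by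
    simp [normSqPoly, pderiv_X, Pi.single_apply]
  have h : ∀ i, pderiv i (pderiv i (normSqPoly n * Q))
      = normSqPoly n * pderiv i (pderiv i Q) + 2 * Q + 4 * (X i * pderiv i Q) := fun i => by
    have h2 : pderiv i (2 : MvPolynomial (Fin n) ℝ) = 0 := by
      rw [← map_ofNat C 2, pderiv_C]
    simp only [pderiv_mul, hr, map_add, pderiv_X_self, h2]
    ring
  simp only [laplacian_apply, h, Finset.sum_add_distrib, ← Finset.mul_sum, hQ.sum_X_mul_pderiv,
    Finset.sum_const, Finset.card_univ, Fintype.card_fin, nsmul_eq_mul, smul_eq_C_mul, map_add,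
    map_mul, map_natCast, map_ofNat]
  ring

lemma laplacian_normSqPoly_pow_mul {Q : MvPolynomial (Fin n) ℝ} {d : ℕ} (hQ : Q.IsHomogeneous d)
    (i : ℕ) : laplacian (normSqPoly n ^ (i + 1) * Q) = normSqPoly n ^ (i + 1) * laplacian Q
      + (2 * (i + 1) * (n + 2 * d + 2 * i) : ℝ) • (normSqPoly n ^ i * Q) := by
  induction i with
  | zero =>
    simp only [zero_add, pow_one, laplacian_normSqPoly_mul hQ, pow_zero, one_mul]
    congr 2
    push_cast
    ring
  | succ i ih =>
    have h := laplacian_normSqPoly_mul ((isHomogeneous_normSqPoly.pow (i + 1)).mul hQ)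
    rw [ih] at h
    rw [pow_succ', mul_assoc, h]
    simp only [smul_eq_C_mul, map_mul, map_add, map_natCast, map_ofNat, map_one, Nat.cast_add,
      Nat.cast_mul, Nat.cast_ofNat, Nat.cast_one]
    ring

lemma exists_laplacian_normSqPoly_mul_eq (hn : 0 < n) (d : ℕ) :
    ∀ Q : MvPolynomial (Fin n) ℝ, Q.IsHomogeneous d → ∀ i : ℕ, ∃ S : MvPolynomial (Fin n) ℝ,
      S.IsHomogeneous (d + 2 * i) ∧ laplacian (normSqPoly n * S) = normSqPoly n ^ i * Q := by
  induction d using Nat.strong_induction_on with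
  | _ d ih =>
    intro Q hQ i
    obtain ⟨S, hS, hlap⟩ : ∃ S : MvPolynomial (Fin n) ℝ, S.IsHomogeneous (d + 2 * i) ∧
        laplacian (normSqPoly n * S) = normSqPoly n ^ (i + 1) * laplacian Q := by
      rcases lt_or_ge d 2 with hd | hd
      · exact ⟨0, isHomogeneous_zero _ _ _, by simp [laplacian_eq_zero_of_lt_two hQ hd]⟩
      · obtain ⟨S, hS, h⟩ := ih (d - 2) (by omega) _ (isHomogeneous_laplacian hQ) (i + 1)
        exact ⟨S, by convert hS using 1; omega, h⟩
    have hα : (2 * (i + 1) * (n + 2 * d + 2 * i) : ℝ) ≠ 0 := by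
      have : (0 : ℝ) < n := by exact_mod_cast hn
      positivity
    refine ⟨(2 * (i + 1) * (n + 2 * d + 2 * i) : ℝ)⁻¹ • (normSqPoly n ^ i * Q - S), ?_, ?_⟩
    · rw [smul_eq_C_mul, ← zero_add (d + 2 * i)]
      refine (isHomogeneous_C _ _).mul (IsHomogeneous.sub ?_ hS)
      rw [add_comm]
      exact (isHomogeneous_normSqPoly.pow i).mul hQ
    · rw [mul_smul_comm, map_smul, mul_sub, map_sub, hlap, ← mul_assoc, ← pow_succ',
        laplacian_normSqPoly_pow_mul hQ, add_sub_cancel_left, smul_smul, inv_mul_cancel₀ hα,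
        one_smul]

lemma restr_mem_of_isHomogeneous (hn : 0 < n) {W : Submodule ℝ (Sph n → ℝ)} {s : ℕ}
    (hW : ∀ k ≤ s, ∀ P : MvPolynomial (Fin n) ℝ, P.IsHomogeneous k → laplacian P = 0 → restr P ∈ W)
    (k : ℕ) : k ≤ s → ∀ P : MvPolynomial (Fin n) ℝ, P.IsHomogeneous k → restr P ∈ W := by
  induction k using Nat.strong_induction_on with
  | _ k ih =>
    intro hk P hP
    rcases lt_or_ge k 2 with h2 | h2
    · exact hW k hk P hP (laplacian_eq_zero_of_lt_two hP h2)
    · obtain ⟨S, hS, hlap⟩ :=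
        exists_laplacian_normSqPoly_mul_eq hn (k - 2) _ (isHomogeneous_laplacian hP) 0
      have e : restr P = restr (P - normSqPoly n * S) + restr S := by
        funext u
        have := restr_normSqPoly u
        simp only [restr] at this
        simp [restr, this]
      rw [e]
      refine W.add_mem (hW k hk _ ?_ ?_) (ih (k - 2) (by omega) (by omega) S hS)
      · refine hP.sub ?_
        have h := isHomogeneous_normSqPoly.mul hS
        rwa [show 2 + (k - 2 + 2 * 0) = k by omega] at h
      · rw [map_sub, hlap, pow_zero, one_mul, sub_self]

lemma restr_mem_of_totalDegree_le (hn : 0 < n) {W : Submodule ℝ (Sph n → ℝ)} {s : ℕ}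
    (hW : ∀ k ≤ s, ∀ P : MvPolynomial (Fin n) ℝ, P.IsHomogeneous k → laplacian P = 0 → restr P ∈ W)
    {P : MvPolynomial (Fin n) ℝ} (hP : P.totalDegree ≤ s) : restr P ∈ W := by
  have e : restr P = ∑ i ∈ Finset.range (P.totalDegree + 1), restr (homogeneousComponent i P) := by
    funext u
    conv_lhs => rw [← sum_homogeneousComponent P]
    simp [restr]
  rw [e]
  refine W.sum_mem fun i hi => restr_mem_of_isHomogeneous hn hW i ?_ _
    (homogeneousComponent_isHomogeneous i P)
  have := Finset.mem_range.1 hi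
  omega

lemma exists_restr_eq_integral_zonal_pow [IsFiniteMeasure (sphLebesgue n)] (s : ℕ) :
    ∀ f : Sph n → ℝ, Continuous f → ∃ P : MvPolynomial (Fin n) ℝ, P.totalDegree ≤ s ∧
      ∀ u, restr P u = ∫ v, zonal u v ^ s * f v ∂(sphLebesgue n) := by
  induction s with
  | zero =>
    intro f _
    exact ⟨C (∫ v, f v ∂(sphLebesgue n)), by simp, fun u => by simp [restr]⟩
  | succ s ih =>
    intro f hf
    obtain ⟨P, hP, hPe⟩ := ih f hf
    choose Q hQ hQe using fun i : Fin n => ih (fun v => (v : En n) i * f v) (by fun_prop)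
    refine ⟨P + ∑ i, X i * Q i, ?_, fun u => ?_⟩
    · refine (totalDegree_add _ _).trans (max_le (hP.trans s.le_succ) ?_)
      refine totalDegree_finsetSum_le fun i _ => (totalDegree_mul _ _).trans ?_
      rw [totalDegree_X, add_comm]
      exact Nat.succ_le_succ (hQ i)
    · have e : ∀ v, zonal u v ^ (s + 1) * f v = zonal u v ^ s * f v
          + ∑ i, (u : En n) i * (zonal u v ^ s * ((v : En n) i * f v)) := fun v => by
        rw [pow_succ, show zonal u v ^ s * zonal u v * f v
          = zonal u v ^ s * f v + (∑ i, (u : En n) i * (v : En n) i) * (zonal u v ^ s * f v) by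
            simp only [zonal]; ring, Finset.sum_mul]
        congr 1
        exact Finset.sum_congr rfl fun i _ => by ring
      have hc : Continuous fun v => zonal u v ^ s := (continuous_zonal u).pow s
      have h1 : Integrable (fun v => zonal u v ^ s * f v) (sphLebesgue n) :=
        integrable_of_continuous (hc.mul hf)
      have h2 : ∀ i, Integrable (fun v => (u : En n) i * (zonal u v ^ s * ((v : En n) i * f v)))
          (sphLebesgue n) := fun i => integrable_of_continuous (by fun_prop)
      simp only [e]
      rw [integral_add h1 (integrable_finsetSum _ fun i _ => h2 i),
        integral_finsetSum _ fun i _ => h2 i]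
      simp only [integral_const_mul, ← hQe, ← hPe]
      simp [restr]

lemma exists_restr_approx [IsFiniteMeasure (sphLebesgue n)] (hn : 2 ≤ n) (hω : 0 < omegaN n)
    {f : Sph n → ℝ} (hf : Continuous f) (hf1 : ∀ u, |f u| ≤ 1)
    (hfL : ∀ u v, |f u - f v| ≤ dist u v) {s : ℕ} (hs : 1 ≤ s) :
    ∃ P : MvPolynomial (Fin n) ℝ, P.totalDegree ≤ s ∧ (∀ u, |restr P u| ≤ 1) ∧
      ∀ u, |f u - restr P u| ≤ (n + 1) / √s := by
  obtain ⟨P, hP, hPe⟩ := exists_restr_eq_integral_zonal_pow s f hf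
  have hM := zonalMass_pos hn hω s
  have hi : ∀ u (g : Sph n → ℝ), Continuous g →
      Integrable (fun v => zonal u v ^ s * g v) (sphLebesgue n) := fun u g hg =>
    integrable_of_continuous (((continuous_zonal u).pow s).mul hg)
  have hk : ∀ u v : Sph n, 0 ≤ zonal u v ^ s := fun u v => pow_nonneg (zonal_nonneg u v) s
  have hQe : ∀ u, restr (C (zonalMass n s)⁻¹ * P) u = (zonalMass n s)⁻¹ * restr P u := fun u => by
    simp [restr]
  refine ⟨C (zonalMass n s)⁻¹ * P, ?_, fun u => ?_, fun u => ?_⟩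
  · exact (totalDegree_mul _ _).trans (by simpa using hP)
  · rw [hQe, abs_mul, abs_inv, abs_of_pos hM, inv_mul_le_iff₀ hM, mul_one, hPe]
    refine abs_integral_le_integral_abs.trans ?_
    rw [← integral_zonal_pow hn u s]
    refine integral_mono (hi u f hf).abs (by simpa using hi u (fun _ => 1) continuous_const)
      fun v => ?_
    simpa only [abs_mul, abs_of_nonneg (hk u v)] using mul_le_of_le_one_right (hk u v) (hf1 v)
  · have e : f u - restr (C (zonalMass n s)⁻¹ * P) u
        = (zonalMass n s)⁻¹ * ∫ v, zonal u v ^ s * (f u - f v) ∂(sphLebesgue n) := by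
      have h1 := hi u (fun _ => f u) continuous_const
      simp only [mul_sub]
      rw [integral_sub h1 (hi u f hf), integral_mul_const, integral_zonal_pow hn, hQe, hPe]
      field_simp
    rw [e, abs_mul, abs_inv, abs_of_pos hM, inv_mul_le_iff₀ hM, mul_comm]
    refine (abs_integral_le_integral_abs.trans ?_).trans (integral_zonal_pow_mul_dist_le hn hω u hs)
    refine integral_mono (hi u _ (continuous_const.sub hf)).abs (hi u _ (by fun_prop)) fun v => ?_
    simpa only [abs_mul, abs_of_nonneg (hk u v)] using mul_le_mul_of_nonneg_left (hfL u v) (hk u v)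

section Basis

variable {N : ℕ → ℕ} {H : (k : ℕ) → Fin (N k) → Sph n → ℝ}

lemma continuous_harmonic (hH : IsHarmonicBasis N H) (k : ℕ) (j : Fin (N k)) :
    Continuous (H k j) := by
  obtain ⟨P, -, -, hP⟩ := hH.1 k j
  exact (funext hP : H k j = restr P) ▸ continuous_restr P

lemma nonempty_sphere (hn : 2 ≤ n) : Nonempty (Sph n) :=
  ⟨⟨EuclideanSpace.single ⟨0, by omega⟩ 1, by simp⟩⟩

lemma dim_zero_pos (hn : 2 ≤ n) (hH : IsHarmonicBasis N H) : 0 < N 0 := by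
  obtain ⟨c, hc⟩ := hH.2.2 0 (fun _ => 1) ⟨1, isHomogeneous_one _ _, by simp, by simp⟩
  obtain ⟨u⟩ := nonempty_sphere hn
  rcases Nat.eq_zero_or_pos (N 0) with h | h
  · have : IsEmpty (Fin (N 0)) := by rw [h]; infer_instance
    simpa using hc u
  · exact h

lemma omegaN_pos (hn : 2 ≤ n) (hH : IsHarmonicBasis N H) : 0 < omegaN n := by
  have hj := dim_zero_pos hn hH
  have h1 := hH.2.1 0 ⟨0, hj⟩ ⟨0, hj⟩
  obtain ⟨P, hP, -, hPe⟩ := hH.1 0 ⟨0, hj⟩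
  rw [totalDegree_eq_zero_iff_eq_C.1 (Nat.le_zero.1 hP.totalDegree_le)] at hPe
  simp only [hPe, eval_C, integral_const, if_true, smul_eq_mul] at h1
  refine lt_of_le_of_ne ENNReal.toReal_nonneg fun h0 => ?_
  rw [Measure.real, ← omegaN, ← h0, zero_mul] at h1
  exact zero_ne_one h1

lemma isFiniteMeasure_sphLebesgue (h : 0 < omegaN n) : IsFiniteMeasure (sphLebesgue n) := by
  refine ⟨lt_top_iff_ne_top.2 fun htop => ?_⟩
  simp [omegaN, htop] at h

lemma integral_basis_mul_basis (hn : 2 ≤ n) (hH : IsHarmonicBasis N H) {s : ℕ}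
    (p q : Σ k : Fin s, Fin (N k)) :
    ∫ u, H p.1 p.2 u * H q.1 q.2 u ∂(sphLebesgue n) = if p = q then 1 else 0 := by
  have := isFiniteMeasure_sphLebesgue (omegaN_pos hn hH)
  obtain ⟨k, j⟩ := p
  obtain ⟨l, i⟩ := q
  rcases eq_or_ne k l with rfl | hkl
  · simpa using hH.2.1 k j i
  · rw [if_neg fun h => hkl (congrArg Sigma.fst h)]
    obtain ⟨P, hP, hP0, hPe⟩ := hH.1 k j
    obtain ⟨Q, hQ, hQ0, hQe⟩ := hH.1 l i
    simp only [hPe, hQe]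
    exact integral_harmonic_mul_harmonic hn hP hQ hP0 hQ0 fun h => hkl (Fin.ext h)

lemma exists_coeff_of_totalDegree_le (hn : 2 ≤ n) (hH : IsHarmonicBasis N H)
    {P : MvPolynomial (Fin n) ℝ} {s : ℕ} (hP : P.totalDegree ≤ s) (hP1 : ∀ u, |restr P u| ≤ 1) :
    ∃ b : (Σ k : Fin (s + 1), Fin (N k)) → ℝ, (∀ u, restr P u = ∑ p, b p * H p.1 p.2 u) ∧
      ∑ p, b p ^ 2 ≤ omegaN n := by
  have := isFiniteMeasure_sphLebesgue (omegaN_pos hn hH)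
  have hmem : restr P ∈ Submodule.span ℝ
      (Set.range fun p : Σ k : Fin (s + 1), Fin (N k) => H p.1 p.2) := by
    refine restr_mem_of_totalDegree_le (by omega) (fun k hk Q hQ hQ0 => ?_) hP
    rw [laplacian_apply] at hQ0
    obtain ⟨c, hc⟩ := hH.2.2 k (restr Q) ⟨Q, hQ, hQ0, fun _ => rfl⟩
    have e : restr Q = ∑ j, c j • H k j := by
      funext u
      simp [hc]
    rw [e]
    exact Submodule.sum_mem _ fun j _ => Submodule.smul_mem _ _
      (Submodule.subset_span ⟨⟨⟨k, Nat.lt_succ_of_le hk⟩, j⟩, rfl⟩)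
  obtain ⟨b, hb⟩ := (Submodule.mem_span_range_iff_exists_fun ℝ).1 hmem
  have hbe : ∀ u, restr P u = ∑ p, b p * H p.1 p.2 u := fun u => by
    rw [← hb]
    simp
  refine ⟨b, hbe, ?_⟩
  have hc : ∀ p : Σ k : Fin (s + 1), Fin (N k), Continuous (H p.1 p.2) := fun p =>
    continuous_harmonic hH _ _
  have hi : ∀ p q : Σ k : Fin (s + 1), Fin (N k),
      Integrable (fun u => b p * b q * (H p.1 p.2 u * H q.1 q.2 u)) (sphLebesgue n) := fun p q =>
    integrable_of_continuous (continuous_const.mul ((hc p).mul (hc q)))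
  have hpars : ∫ u, restr P u ^ 2 ∂(sphLebesgue n) = ∑ p, b p ^ 2 := by
    have e : ∀ u, restr P u ^ 2 = ∑ p, ∑ q, b p * b q * (H p.1 p.2 u * H q.1 q.2 u) := fun u => by
      rw [hbe, sq, Finset.sum_mul_sum]
      exact Finset.sum_congr rfl fun p _ => Finset.sum_congr rfl fun q _ => by ring
    simp only [e]
    rw [integral_finsetSum _ fun p _ => integrable_finsetSum _ fun q _ => hi p q]
    refine Finset.sum_congr rfl fun p _ => ?_
    rw [integral_finsetSum _ fun q _ => hi p q]
    simp only [integral_const_mul, integral_basis_mul_basis hn hH]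
    simp [sq]
  rw [← hpars]
  calc ∫ u, restr P u ^ 2 ∂(sphLebesgue n) ≤ ∫ _, 1 ∂(sphLebesgue n) :=
        integral_mono (integrable_of_continuous ((continuous_restr P).pow 2)) (integrable_const _)
          fun u => (sq_le_one_iff_abs_le_one _).2 (hP1 u)
    _ = omegaN n := by simp [omegaN, Measure.real]

end Basis

lemma exists_add_smul_mem_sphere {E : Type*} [NormedAddCommGroup E] [InnerProductSpace ℝ E]
    {x u : E} {R : ℝ} (hx : ‖x‖ ≤ R) (hu : ‖u‖ = 1) : ∃ t : ℝ, 0 ≤ t ∧ ‖x + t • u‖ = R := by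
  have hR : 0 ≤ R := (norm_nonneg x).trans hx
  have hD : 0 ≤ R ^ 2 - ‖x‖ ^ 2 := by nlinarith [norm_nonneg x]
  set a := ⟪x, u⟫_ℝ with ha
  have hs := Real.sq_sqrt (show 0 ≤ a ^ 2 + (R ^ 2 - ‖x‖ ^ 2) by positivity)
  refine ⟨-a + √(a ^ 2 + (R ^ 2 - ‖x‖ ^ 2)), ?_, ?_⟩
  · have : a ≤ √(a ^ 2 + (R ^ 2 - ‖x‖ ^ 2)) := Real.le_sqrt_of_sq_le (by linarith)
    linarith
  · rw [← sq_eq_sq₀ (norm_nonneg _) hR, norm_add_sq_real, inner_smul_right, norm_smul, hu, mul_one,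
      Real.norm_eq_abs, sq_abs, ← ha]
    linear_combination hs

/-- The boundary points of `K` admitting an outer unit normal vector. -/
def normalBoundary (K : Set (En n)) : Set (En n) :=
  {x ∈ frontier K | ∃ u : Sph n, ∀ y ∈ K, ⟪y - x, (u : En n)⟫_ℝ ≤ 0}

lemma hausdorffMeasure_normalBoundary_le (hn : 2 ≤ n) {K : Set (En n)} (hK : IsClosed K) {R : ℝ}
    (hR : 0 < R) (hKR : K ⊆ Metric.closedBall 0 R) :
    μH[(n : ℝ) - 1] (normalBoundary K)
      ≤ (R.toNNReal : ℝ≥0∞) ^ ((n : ℝ) - 1) * sphLebesgue n Set.univ := by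
  have hd : (0 : ℝ) ≤ (n : ℝ) - 1 := by
    have : (2 : ℝ) ≤ n := by exact_mod_cast hn
    linarith
  have hsub : ∀ x ∈ normalBoundary K, x ∈ K := fun x hx => hK.frontier_subset hx.1
  choose u hu using fun x : normalBoundary K => x.2.2
  choose t ht htR using fun x : normalBoundary K =>
    exists_add_smul_mem_sphere (mem_closedBall_zero_iff.1 (hKR (hsub x x.2)))
      (norm_eq_of_mem_sphere (u x))
  let g : normalBoundary K → Sph n := fun x =>
    ⟨R⁻¹ • ((x : En n) + t x • (u x : En n)), by
      rw [mem_sphere_zero_iff_norm, norm_smul, htR, norm_inv, Real.norm_of_nonneg hR.le,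
        inv_mul_cancel₀ hR.ne']⟩
  have hg : AntilipschitzWith R.toNNReal g := by
    refine AntilipschitzWith.of_le_mul_dist fun x y => ?_
    rw [Real.coe_toNNReal _ hR.le, Subtype.dist_eq, Subtype.dist_eq, dist_eq_norm, dist_eq_norm,
      ← smul_sub, norm_smul, norm_inv, Real.norm_of_nonneg hR.le, mul_inv_cancel_left₀ hR.ne']
    set w := (x : En n) - y with hw
    have h1 : ⟪(x : En n) + t x • (u x : En n) - (y + t y • (u y : En n)), w⟫_ℝ
        = ‖w‖ ^ 2 + t x * ⟪(u x : En n), w⟫_ℝ - t y * ⟪(u y : En n), w⟫_ℝ := by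
      rw [show (x : En n) + t x • (u x : En n) - (y + t y • (u y : En n))
        = w + t x • (u x : En n) - t y • (u y : En n) by rw [hw]; abel, inner_sub_left,
        inner_add_left, inner_smul_left, inner_smul_left, real_inner_self_eq_norm_sq]
      simp
    have h2 : 0 ≤ ⟪(u x : En n), w⟫_ℝ := by
      have := hu x y (hsub y y.2)
      rw [real_inner_comm, ← neg_sub, inner_neg_right] at this
      linarith
    have h3 : ⟪(u y : En n), w⟫_ℝ ≤ 0 := by
      rw [real_inner_comm]
      exact hu y x (hsub x x.2)
    have h4 := real_inner_le_norm ((x : En n) + t x • (u x : En n) - (y + t y • (u y : En n))) w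
    have h5 := mul_nonneg (ht x) h2
    have h6 := mul_nonneg (ht y) (neg_nonneg.2 h3)
    rcases (norm_nonneg w).eq_or_lt' with h0 | h0
    · rw [h0]; exact norm_nonneg _
    · refine le_of_mul_le_mul_right ?_ h0
      nlinarith
  calc μH[(n : ℝ) - 1] (normalBoundary K)
      = μH[(n : ℝ) - 1] (Set.univ : Set (normalBoundary K)) := by
        have h := (isometry_subtype_coe (s := normalBoundary K)).hausdorffMeasure_image
          (Or.inl hd) Set.univ
        rwa [Set.image_univ, Subtype.range_coe] at h
    _ ≤ (R.toNNReal : ℝ≥0∞) ^ ((n : ℝ) - 1) * μH[(n : ℝ) - 1] (g '' Set.univ) :=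
        hg.le_hausdorffMeasure_image hd _
    _ ≤ _ := by
        exact mul_le_mul' le_rfl (measure_mono (μ := sphLebesgue n) (Set.subset_univ _))

lemma surfaceAreaMeasure_univ_le (hn : 2 ≤ n) {K : Set (En n)} (hK : IsClosed K) {R : ℝ}
    (hR : 0 < R) (hKR : K ⊆ Metric.closedBall 0 R) {μ : Measure (Sph n)}
    (hμ : IsSurfaceAreaMeasure K μ) :
    μ Set.univ ≤ (R.toNNReal : ℝ≥0∞) ^ ((n : ℝ) - 1) * sphLebesgue n Set.univ * 2 := by
  have h := hausdorffMeasure_normalBoundary_le hn hK hR hKR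
  rcases hμ with ⟨-, hμ⟩ | ⟨hint, u, u', -, ⟨c, hc⟩, rfl⟩
  · rw [hμ _ MeasurableSet.univ]
    simp only [Set.mem_univ, true_and]
    refine h.trans ?_
    rw [mul_two]
    exact le_self_add
  · have hsub : K ⊆ normalBoundary K := fun x hx => by
      refine ⟨?_, u, fun y hy => ?_⟩
      · rw [hK.frontier_eq, hint]
        simpa using hx
      · rw [inner_sub_left, hc y hy, hc x hx, sub_self]
    rw [Measure.smul_apply, Measure.add_apply, measure_univ, measure_univ, one_add_one_eq_two,
      smul_eq_mul]
    gcongr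
    exact (measure_mono hsub).trans h

lemma isFiniteMeasure_surfaceAreaMeasure [IsFiniteMeasure (sphLebesgue n)] (hn : 2 ≤ n)
    {K : Set (En n)} (hK : IsClosed K) {R : ℝ} (hR : 0 < R) (hKR : K ⊆ Metric.closedBall 0 R)
    {μ : Measure (Sph n)} (hμ : IsSurfaceAreaMeasure K μ) : IsFiniteMeasure μ := by
  have hd : (0 : ℝ) ≤ (n : ℝ) - 1 := by
    have : (2 : ℝ) ≤ n := by exact_mod_cast hn
    linarith
  exact ⟨(surfaceAreaMeasure_univ_le hn hK hR hKR hμ).trans_lt <| ENNReal.mul_lt_top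
    (ENNReal.mul_lt_top (ENNReal.rpow_lt_top_of_nonneg hd ENNReal.coe_ne_top) (measure_lt_top _ _))
    (by simp)⟩

lemma surfaceAreaMeasure_real_univ_le [IsFiniteMeasure (sphLebesgue n)] (hn : 2 ≤ n)
    {K : Set (En n)} (hK : IsClosed K) {R : ℝ} (hR : 0 < R) (hKR : K ⊆ Metric.closedBall 0 R)
    {μ : Measure (Sph n)} (hμ : IsSurfaceAreaMeasure K μ) :
    μ.real Set.univ ≤ R ^ ((n : ℝ) - 1) * omegaN n * 2 := by
  have hd : (0 : ℝ) ≤ (n : ℝ) - 1 := by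
    have : (2 : ℝ) ≤ n := by exact_mod_cast hn
    linarith
  have h := ENNReal.toReal_mono (ENNReal.mul_ne_top (ENNReal.mul_ne_top
    (ENNReal.rpow_ne_top_of_nonneg hd ENNReal.coe_ne_top) (measure_ne_top _ _)) (by simp))
    (surfaceAreaMeasure_univ_le hn hK hR hKR hμ)
  rwa [ENNReal.toReal_mul, ENNReal.toReal_mul, ← ENNReal.toReal_rpow, ENNReal.coe_toReal,
    Real.coe_toNNReal _ hR.le, ENNReal.toReal_ofNat] at h

lemma abs_integral_sub_integral_le {μ : Measure (Sph n)} [IsFiniteMeasure μ] {f g : Sph n → ℝ}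
    (hf : Continuous f) (hg : Continuous g) {E : ℝ} (h : ∀ u, |f u - g u| ≤ E) :
    |∫ u, f u ∂μ - ∫ u, g u ∂μ| ≤ E * μ.real Set.univ := by
  rw [← integral_sub (integrable_of_continuous hf) (integrable_of_continuous hg)]
  exact norm_integral_le_of_norm_le_const (f := fun u => f u - g u) (Filter.Eventually.of_forall h)

lemma abs_integral_restr_sub_integral_restr_le {N : ℕ → ℕ} {H : (k : ℕ) → Fin (N k) → Sph n → ℝ}
    (hn : 2 ≤ n) (hH : IsHarmonicBasis N H) {P : MvPolynomial (Fin n) ℝ} {s : ℕ}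
    (hP : P.totalDegree ≤ s) (hP1 : ∀ u, |restr P u| ≤ 1) (μ ν : Measure (Sph n))
    [IsFiniteMeasure μ] [IsFiniteMeasure ν] :
    |∫ u, restr P u ∂μ - ∫ u, restr P u ∂ν|
      ≤ √(omegaN n * (∑ k ∈ Finset.range (s + 1), N k : ℕ)) *
        √(∑ k ∈ Finset.range (s + 1), ∑ j : Fin (N k), (∫ u, H k j u ∂μ - ∫ u, H k j u ∂ν) ^ 2) := by
  obtain ⟨b, hb, hb2⟩ := exists_coeff_of_totalDegree_le hn hH hP hP1
  have hi : ∀ (ρ : Measure (Sph n)) [IsFiniteMeasure ρ], ∫ u, restr P u ∂ρ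
      = ∑ p, b p * ∫ u, H p.1 p.2 u ∂ρ := fun ρ _ => by
    simp only [hb]
    rw [integral_finsetSum _ fun p _ =>
      (integrable_of_continuous (continuous_harmonic hH _ _)).const_mul _]
    simp only [integral_const_mul]
  have hN : 1 ≤ ∑ k ∈ Finset.range (s + 1), N k :=
    (dim_zero_pos hn hH).trans_le
      (Finset.single_le_sum (fun _ _ => Nat.zero_le _) (Finset.mem_range.2 s.succ_pos))
  rw [← Real.sqrt_mul (by have := omegaN_pos hn hH; positivity)]
  refine Real.abs_le_sqrt ?_
  rw [hi μ, hi ν, ← Finset.sum_sub_distrib]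
  simp only [← mul_sub]
  refine (Finset.sum_mul_sq_le_sq_mul_sq _ _ _).trans ?_
  rw [Finset.sum_range fun k => ∑ j : Fin (N k), (∫ u, H k j u ∂μ - ∫ u, H k j u ∂ν) ^ 2,
    Fintype.sum_sigma fun p : Σ k : Fin (s + 1), Fin (N k) =>
      (∫ u, H p.1 p.2 u ∂μ - ∫ u, H p.1 p.2 u ∂ν) ^ 2]
  refine mul_le_mul_of_nonneg_right (hb2.trans ?_) (by positivity)
  exact le_mul_of_one_le_right (omegaN_pos hn hH).le (by exact_mod_cast hN)

end SphericalStability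


/-- there is a constant `c = c(n, R, ε) > 0` such that for all
convex bodies `K, L` contained in a ball of radius `R`, all `s₀ ∈ ℕ` and
`δ > 0`: if `√(ω_n m_{s₀}) ‖ψ^{s₀}(K) - ψ^{s₀}(L)‖ ≤ δ`, where `ψ^{s₀}` is the
vector of harmonic intrinsic volumes up to degree `s₀` and
`m_{s₀} = ∑_{k ≤ s₀} N(n,k)`, then the Dudley distance between the surface area
measures is at most `c s₀^{(ε-1)/2} + δ`; the Dudley distance bound is phrased
as a bound for `|∫ f dS_{n-1}(K,·) - ∫ f dS_{n-1}(L,·)|` over all `f` with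
`‖f‖_∞ + L(f) ≤ 1`. -/
theorem stmt11 {n : ℕ} (hn : 2 ≤ n) (R : ℝ) (hR : 0 < R)
    (ε : ℝ) (hε0 : 0 < ε) (hε1 : ε < 1) :
    ∃ c : ℝ, 0 < c ∧
      ∀ (N : ℕ → ℕ) (H : (k : ℕ) → Fin (N k) → Sph n → ℝ),
        IsHarmonicBasis N H →
      ∀ K L : Set (En n),
        Convex ℝ K → IsCompact K → K.Nonempty → K ⊆ Metric.closedBall 0 R →
        Convex ℝ L → IsCompact L → L.Nonempty → L ⊆ Metric.closedBall 0 R →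
      ∀ μK μL : Measure (Sph n),
        IsSurfaceAreaMeasure K μK → IsSurfaceAreaMeasure L μL →
      ∀ s₀ : ℕ, 1 ≤ s₀ → ∀ δ : ℝ, 0 < δ →
        Real.sqrt (omegaN n * (∑ k ∈ Finset.range (s₀ + 1), N k)) *
          Real.sqrt (∑ k ∈ Finset.range (s₀ + 1), ∑ j : Fin (N k),
            (∫ u, H k j u ∂μK - ∫ u, H k j u ∂μL) ^ 2) ≤ δ →
      ∀ (f : Sph n → ℝ) (bf Lf : ℝ),
        (∀ u, |f u| ≤ bf) → (∀ u v, |f u - f v| ≤ Lf * dist u v) →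
        bf + Lf ≤ 1 →
        |∫ u, f u ∂μK - ∫ u, f u ∂μL| ≤ c * (s₀ : ℝ) ^ ((ε - 1) / 2) + δ := by
  obtain ⟨hω0, hn2⟩ : 0 ≤ omegaN n ∧ (2 : ℝ) ≤ n :=
    ⟨ENNReal.toReal_nonneg, by exact_mod_cast hn⟩
  refine ⟨4 * (R ^ ((n : ℝ) - 1) * omegaN n) * (n + 1) + 1, by positivity, ?_⟩
  intro N H hH K L _ hKc _ hKR _ hLc _ hLR μK μL hμK hμL s hs δ _ hδ f bf Lf hbf hLf hsum
  have hω := SphericalStability.omegaN_pos hn hH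
  have := SphericalStability.isFiniteMeasure_sphLebesgue hω
  have := SphericalStability.isFiniteMeasure_surfaceAreaMeasure hn hKc.isClosed hR hKR hμK
  have := SphericalStability.isFiniteMeasure_surfaceAreaMeasure hn hLc.isClosed hR hLR hμL
  have hmK := SphericalStability.surfaceAreaMeasure_real_univ_le hn hKc.isClosed hR hKR hμK
  have hmL := SphericalStability.surfaceAreaMeasure_real_univ_le hn hLc.isClosed hR hLR hμL
  obtain ⟨w⟩ := SphericalStability.nonempty_sphere hn
  have hbf0 : 0 ≤ bf := (abs_nonneg _).trans (hbf w)
  have hLf0 : 0 ≤ Lf := by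
    have hne : w ≠ -w := ne_neg_of_mem_unit_sphere ℝ w
    exact nonneg_of_mul_nonneg_left ((abs_nonneg _).trans (hLf w (-w))) (dist_pos.2 hne)
  have hL1 : ∀ u v, |f u - f v| ≤ dist u v := fun u v =>
    (hLf u v).trans (mul_le_of_le_one_left dist_nonneg (by linarith))
  have hfc : Continuous f := (LipschitzWith.of_le_add fun u v => by
    linarith [(abs_le.1 (hL1 u v)).2]).continuous
  obtain ⟨P, hPd, hP1, hPf⟩ := SphericalStability.exists_restr_approx hn hω hfc
    (fun u => (hbf u).trans (by linarith)) hL1 hs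
  have hE : 0 ≤ ((n : ℝ) + 1) / √s := by positivity
  have hPc := SphericalStability.continuous_restr P
  have hK := (SphericalStability.abs_integral_sub_integral_le (μ := μK) hfc hPc hPf).trans
    (mul_le_mul_of_nonneg_left hmK hE)
  have hL := (SphericalStability.abs_integral_sub_integral_le (μ := μL) hfc hPc hPf).trans
    (mul_le_mul_of_nonneg_left hmL hE)
  have hP := (SphericalStability.abs_integral_restr_sub_integral_restr_le hn hH hPd hP1 μK μL).trans
    (by simpa using hδ)
  have hs1 : (1 : ℝ) ≤ s := by exact_mod_cast hs
  have hpow : 1 / √(s : ℝ) ≤ (s : ℝ) ^ ((ε - 1) / 2) := by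
    rw [Real.sqrt_eq_rpow, one_div, ← Real.rpow_neg (by linarith)]
    exact Real.rpow_le_rpow_of_exponent_le hs1 (by linarith)
  have hmain : 4 * (R ^ ((n : ℝ) - 1) * omegaN n) * (n + 1) * (1 / √(s : ℝ))
      ≤ 4 * (R ^ ((n : ℝ) - 1) * omegaN n) * (n + 1) * (s : ℝ) ^ ((ε - 1) / 2) :=
    mul_le_mul_of_nonneg_left hpow (by positivity)
  have hpow0 : 0 ≤ (s : ℝ) ^ ((ε - 1) / 2) := by positivity
  have e : 4 * (R ^ ((n : ℝ) - 1) * omegaN n) * (n + 1) * (1 / √(s : ℝ))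
      = (n + 1) / √s * (R ^ ((n : ℝ) - 1) * omegaN n * 2)
        + (n + 1) / √s * (R ^ ((n : ℝ) - 1) * omegaN n * 2) := by ring
  rw [abs_le] at hK hL hP ⊢
  constructor <;> linarith [hK.1, hK.2, hL.1, hL.2, hP.1, hP.2]
end
end
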